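/- (Zagier) Let K be a real quadratic field with discriminant D and associated character χ, and let k ≥ 1 be an integer. Then ζ_K(1 − 2k) = 4 · ∑_{j=1}^{⌊k/3⌋+1} b_j(4k) · ∑_{m ∣ j, m > 0} χ(m) · m^{2k−1} · e_{2k−1}((j/m)² · D). -/

import Mathlib

open scoped Classical
noncomputable section

open Module

/-- A field is totally real if every complex embedding takes values in `ℝ`. -/
def IsTotallyReal (F : Type*) [Field F] : Prop :=
  ∀ φ : F →+* ℂ, ∀ x : F, (φ x).im = 0

/-- `Z` is the Dedekind zeta function of `F`: it is holomorphic away from `1` and agrees with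
the Dirichlet series `∑ N(𝔞)^{-s}` over nonzero integral ideals on the half-plane `Re s > 1`. -/
def IsDedekindZeta (F : Type*) [Field F] (Z : ℂ → ℂ) : Prop :=
  (∀ s : ℂ, s ≠ 1 → DifferentiableAt ℂ Z s) ∧
  ∀ s : ℂ, 1 < s.re → Z s =
    ∑' I : {I : Ideal (NumberField.RingOfIntegers F) // I ≠ ⊥},
      (Nat.card (NumberField.RingOfIntegers F ⧸ (I : Ideal (NumberField.RingOfIntegers F))) : ℂ)
        ^ (-s)

/-- `e_j(m) = ∑ a^j` over triples `(a, b, c)` with `a, c > 0` integers, `b` an integer and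
`b² + 4ac = m`. -/
def eSum (j : ℕ) (m : ℤ) : ℤ :=
  ∑ᶠ (t : ℤ × ℤ × ℤ) (_ : 0 < t.1 ∧ 0 < t.2.2 ∧ t.2.1 ^ 2 + 4 * t.1 * t.2.2 = m), t.1 ^ j

/-- The Kronecker symbol `(D/m)` for `m : ℕ`, defined multiplicatively from the Jacobi symbol
on the odd part of `m` and the standard value at `2`. -/
def kron (D : ℤ) (m : ℕ) : ℤ :=
  (if D % 2 = 0 then 0 else if D % 8 = 1 ∨ D % 8 = 7 then 1 else -1) ^ (m.factorization 2) *
    jacobiSym D (m / 2 ^ (m.factorization 2))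

/-- `Δ = q·∏_{n≥1}(1 − q^n)^24` as a formal power series. -/
def Delta : PowerSeries ℚ :=
  PowerSeries.mk fun N => PowerSeries.coeff (R := ℚ) N
    (PowerSeries.X * ∏ n ∈ Finset.range (N + 1), (1 - PowerSeries.X ^ (n + 1)) ^ 24)

/-- The Eisenstein series `G_k = 1 − (2k/B_k)·∑_{n≥1} σ_{k−1}(n) q^n` (with `G_0 = 1`). -/
def Gser (k : ℕ) : PowerSeries ℚ :=
  PowerSeries.mk fun n =>
    if n = 0 then 1
    else -(2 * (k : ℚ) / bernoulli k) * ∑ d ∈ n.divisors, (d : ℚ) ^ (k - 1)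

/-- `r(h) = ⌊h/12⌋` if `h ≡ 2 (mod 12)` and `⌊h/12⌋ + 1` otherwise. -/
def rS (h : ℕ) : ℕ := if h % 12 = 2 then h / 12 else h / 12 + 1

/-- `T_h = G_{12·r(h) − h + 2} · Δ^{−r(h)}` as a formal Laurent series over `ℚ`. -/
def Tq (h : ℕ) : LaurentSeries ℚ :=
  (HahnSeries.ofPowerSeries ℤ ℚ (Gser (12 * rS h + 2 - h))) *
    (HahnSeries.ofPowerSeries ℤ ℚ Delta) ^ (-(rS h : ℤ))

/-- `c_{h,j}`, the coefficient of `q^{−j}` in `T_h`. -/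
def cCoeff (h j : ℕ) : ℚ := (Tq h).coeff (-(j : ℤ))

/-- The Siegel coefficients `b_j(h) = −c_{h,j}/c_{h,0}`. -/
def bSiegel (j h : ℕ) : ℚ := -(cCoeff h j) / cCoeff h 0

/-- The operator `θ = X d/dX` on power series. -/
def theta {R : Type*} [CommRing R] (f : PowerSeries R) : PowerSeries R :=
  PowerSeries.mk fun n => (n : R) * PowerSeries.coeff n f

/-- The power series of the weight two Eisenstein series. -/
def E2ser (R : Type*) [CommRing R] : PowerSeries R :=
  PowerSeries.mk fun n => if n = 0 then 1 else -24 * ∑ d ∈ n.divisors, (d : R)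

lemma theta_coeff {R : Type*} [CommRing R] (f : PowerSeries R) (n : ℕ) :
    PowerSeries.coeff n (theta f) = n * PowerSeries.coeff n f := by simp [theta]

lemma theta_eq {R : Type*} [CommRing R] (f : PowerSeries R) :
    theta f = PowerSeries.X * PowerSeries.derivative R f := by
  ext n
  rw [theta_coeff]
  cases n with
  | zero => simp
  | succ n =>
    rw [PowerSeries.coeff_succ_X_mul, PowerSeries.coeff_derivative]
    push_cast; ring

lemma theta_mul {R : Type*} [CommRing R] (f g : PowerSeries R) :
    theta (f * g) = theta f * g + f * theta g := by
  simp only [theta_eq, Derivation.leibniz, smul_eq_mul]; ring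

lemma theta_pow {R : Type*} [CommRing R] (f : PowerSeries R) (n : ℕ) :
    theta (f ^ n) = n * f ^ (n - 1) * theta f := by
  simp only [theta_eq, Derivation.leibniz_pow, smul_eq_mul, nsmul_eq_mul]; ring

/-- Solutions of `θ f = E₂ f` are determined by their linear coefficient. -/
lemma theta_eq_E2_unique {R : Type*} [Field R] [CharZero R] {f g : PowerSeries R}
    (hf : theta f = E2ser R * f) (hg : theta g = E2ser R * g)
    (h1 : PowerSeries.coeff 1 f = PowerSeries.coeff 1 g) : f = g := by
  have key : theta (f - g) = E2ser R * (f - g) := by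
    rw [mul_sub, ← hf, ← hg]; ext n; simp [theta_coeff]; ring
  rw [← sub_eq_zero]
  have h1' : PowerSeries.coeff 1 (f - g) = 0 := by simp [h1]
  generalize f - g = u at key h1'
  ext n
  induction n using Nat.strong_induction_on with
  | _ n ih =>
    have := congrArg (PowerSeries.coeff n) key
    rw [theta_coeff, PowerSeries.coeff_mul, Finset.Nat.sum_antidiagonal_eq_sum_range_succ
      (fun i j => PowerSeries.coeff i (E2ser R) * PowerSeries.coeff j u),
      Finset.sum_range_succ'] at this
    rw [Finset.sum_eq_zero] at this
    · simp only [E2ser, PowerSeries.coeff_mk, if_true, one_mul, zero_add, Nat.sub_zero] at this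
      by_cases hn : n = 1
      · subst hn; simpa using h1'
      · have h2 : ((n : R) - 1) * PowerSeries.coeff n u = 0 := by linear_combination this
        rcases mul_eq_zero.1 h2 with h | h
        · exact absurd (by exact_mod_cast sub_eq_zero.1 h) hn
        · simpa using h
    · intro i hi
      rw [ih (n - (i + 1)) (by have := Finset.mem_range.1 hi; omega)]
      simp

lemma theta_one_sub_X_pow (n : ℕ) :
    theta ((1 - PowerSeries.X ^ (n + 1) : PowerSeries ℚ) ^ 24) =
      (-24 * PowerSeries.mk fun m => if m ≠ 0 ∧ (n + 1) ∣ m then ((n + 1 : ℕ) : ℚ) else 0) *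
        (1 - PowerSeries.X ^ (n + 1)) ^ 24 := by
  have h1 : (1 - PowerSeries.X ^ (n + 1) : PowerSeries ℚ) *
      (PowerSeries.mk fun m => if m ≠ 0 ∧ (n + 1) ∣ m then ((n + 1 : ℕ) : ℚ) else 0) =
      ((n + 1 : ℕ) : PowerSeries ℚ) * PowerSeries.X ^ (n + 1) := by
    ext m
    rw [sub_mul, one_mul, map_sub, PowerSeries.coeff_X_pow_mul', PowerSeries.coeff_mk,
      ← map_natCast (PowerSeries.C (R := ℚ)), PowerSeries.coeff_C_mul, PowerSeries.coeff_X_pow]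
    by_cases hm : m = n + 1
    · subst hm; simp
    · by_cases hle : n + 1 ≤ m
      · have e : (n + 1 ∣ m - (n + 1)) ↔ n + 1 ∣ m := by
          rw [Nat.dvd_sub_iff_left hle (dvd_refl _)]
        have : m - (n + 1) ≠ 0 := by omega
        have h0 : m ≠ 0 := by omega
        simp [hle, e, hm, this, h0]
      · have : ¬ (m ≠ 0 ∧ n + 1 ∣ m) := fun ⟨h, h'⟩ => hle (Nat.le_of_dvd (by omega) h')
        rw [if_neg this]
        simp [hle, hm]
  have h2 : theta (1 - PowerSeries.X ^ (n + 1) : PowerSeries ℚ) =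
      - (((n + 1 : ℕ) : PowerSeries ℚ) * PowerSeries.X ^ (n + 1)) := by
    ext m
    rw [theta_coeff, map_sub, map_neg, ← map_natCast (PowerSeries.C (R := ℚ)),
      PowerSeries.coeff_C_mul, PowerSeries.coeff_X_pow, PowerSeries.coeff_one]
    by_cases hm : m = n + 1
    · subst hm; simp
    · by_cases h0 : m = 0 <;> simp [hm, h0]
  rw [theta_pow, h2, ← h1]
  push_cast
  ring

lemma theta_X : theta (PowerSeries.X : PowerSeries ℚ) = PowerSeries.X := by
  ext n; rw [theta_coeff, PowerSeries.coeff_X]; split_ifs with h <;> simp [h]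

lemma theta_partial (N : ℕ) :
    theta (PowerSeries.X * ∏ n ∈ Finset.range N, (1 - PowerSeries.X ^ (n + 1) : PowerSeries ℚ) ^ 24) =
      (1 - 24 * ∑ n ∈ Finset.range N,
        PowerSeries.mk fun m => if m ≠ 0 ∧ (n + 1) ∣ m then ((n + 1 : ℕ) : ℚ) else 0) *
      (PowerSeries.X * ∏ n ∈ Finset.range N, (1 - PowerSeries.X ^ (n + 1) : PowerSeries ℚ) ^ 24) := by
  induction N with
  | zero => simp [theta_X]
  | succ N ih =>
    rw [Finset.prod_range_succ, ← mul_assoc, theta_mul, ih, theta_one_sub_X_pow,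
      Finset.sum_range_succ]
    ring

lemma Delta_coeff {N M : ℕ} (h : N ≤ M) : PowerSeries.coeff N Delta =
    PowerSeries.coeff N (PowerSeries.X * ∏ n ∈ Finset.range (M + 1),
      (1 - PowerSeries.X ^ (n + 1) : PowerSeries ℚ) ^ 24) := by
  induction M, h using Nat.le_induction with
  | base => simp [Delta]
  | succ M hM ih =>
    rw [ih, Finset.prod_range_succ _ (M + 1), ← mul_assoc]
    have : ∃ u : PowerSeries ℚ, (1 - PowerSeries.X ^ (M + 1 + 1) : PowerSeries ℚ) ^ 24 =
        1 + PowerSeries.X ^ (M + 2) * u := by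
      have h3 := sub_dvd_pow_sub_pow (1 - PowerSeries.X ^ (M + 1 + 1) : PowerSeries ℚ) 1 24
      obtain ⟨u, hu⟩ := h3
      refine ⟨-u, ?_⟩
      rw [one_pow] at hu
      linear_combination hu
    obtain ⟨u, hu⟩ := this
    rw [hu, mul_add, mul_one, map_add]
    conv_rhs => rw [mul_left_comm, PowerSeries.coeff_X_pow_mul', if_neg (by omega), add_zero]

lemma theta_Delta : theta Delta = E2ser ℚ * Delta := by
  ext N
  set P := PowerSeries.X * ∏ n ∈ Finset.range (N + 1),
      (1 - PowerSeries.X ^ (n + 1) : PowerSeries ℚ) ^ 24 with hP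
  have hc : ∀ m ≤ N, PowerSeries.coeff m Delta = PowerSeries.coeff m P :=
    fun m hm => Delta_coeff hm
  rw [theta_coeff, hc N le_rfl, ← theta_coeff, hP, theta_partial, ← hP, PowerSeries.coeff_mul,
    PowerSeries.coeff_mul]
  refine Finset.sum_congr rfl fun x hx => ?_
  have hx' := Finset.HasAntidiagonal.mem_antidiagonal.1 hx
  rw [hc x.2 (by omega)]
  congr 1
  rw [map_sub, PowerSeries.coeff_one, E2ser, PowerSeries.coeff_mk,
    show (24 : PowerSeries ℚ) = PowerSeries.C 24 from rfl, PowerSeries.coeff_C_mul, map_sum]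
  simp only [PowerSeries.coeff_mk]
  by_cases h0 : x.1 = 0
  · simp [h0]
  · simp only [h0, ne_eq, not_false_eq_true, true_and, if_false]
    rw [zero_sub, neg_mul, neg_inj]
    congr 1
    rw [← Finset.sum_filter]
    refine Finset.sum_bij (fun n _ => n + 1) ?_ ?_ ?_ ?_
    · intro n hn
      simp only [Finset.mem_filter] at hn
      exact Nat.mem_divisors.2 ⟨hn.2, h0⟩
    · intros; omega
    · intro d hd
      have hd' := Nat.mem_divisors.1 hd
      have h1 := Nat.le_of_dvd (by omega) hd'.1
      have h2 := Nat.pos_of_dvd_of_pos hd'.1 (by omega)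
      exact ⟨d - 1, by simp only [Finset.mem_filter, Finset.mem_range]; constructor; omega; rw [Nat.sub_add_cancel h2]; exact hd'.1, by omega⟩
    · intros; rfl

lemma Delta_coeff_zero : PowerSeries.coeff 0 Delta = 0 := by simp [Delta]

lemma Delta_coeff_one : PowerSeries.coeff 1 Delta = 1 := by
  rw [Delta, PowerSeries.coeff_mk, PowerSeries.coeff_succ_X_mul]
  simp [map_prod]

open UpperHalfPlane in
open scoped MatrixGroups ModularForm Manifold in
/-- A holomorphic bounded function on the upper half plane invariant under the slash action
is a modular form. -/
def mkModularForm {k : ℤ} (f : ℍ → ℂ) (hol : MDiff f) (hs : ∀ γ : SL(2, ℤ), f ∣[k] γ = f)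
    (hb : IsBoundedAtImInfty f) : ModularForm 𝒮ℒ k where
  toFun := f
  slash_action_eq' := fun _ ⟨γ, hγ⟩ ↦ hγ ▸ hs γ
  holo' := hol
  bdd_at_cusps' {c} hc := by
    rw [Subgroup.IsArithmetic.isCusp_iff_isCusp_SL2Z] at hc
    rw [OnePoint.isBoundedAt_iff_forall_SL2Z hc]
    intro γ _
    rw [hs γ]
    exact hb

open UpperHalfPlane Derivative Function.Periodic in
open scoped MatrixGroups ModularForm Manifold in
lemma hasSum_normalizedDeriv {k : ℤ} (f : ModularForm 𝒮ℒ k) (τ : ℍ) :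
    HasSum (fun m : ℕ => ((m : ℂ) * (qExpansion 1 f).coeff m) • qParam 1 (τ : ℂ) ^ m)
      (normalizedDerivOfComplex f τ) := by
  set q := qParam 1 (τ : ℂ) with hq
  have hqn : ‖q‖ < 1 := by
    rw [hq]; simpa using UpperHalfPlane.norm_qParam_lt_one 1 τ
  set g := cuspFunction 1 f with hg
  have hdiff : DifferentiableOn ℂ g (Metric.ball 0 1) := fun z hz =>
    (ModularFormClass.differentiableAt_cuspFunction f one_pos one_mem_strictPeriods_SL
      (mem_ball_zero_iff.1 hz)).differentiableWithinAt
  have hd' := hdiff.deriv Metric.isOpen_ball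
  have hs := Complex.hasSum_taylorSeries_on_ball hd' (z := q) (mem_ball_zero_iff.2 hqn)
  have hD : normalizedDerivOfComplex f τ = q * deriv g q := by
    have hev : (f ∘ ofComplex : ℂ → ℂ) =ᶠ[nhds (τ : ℂ)] fun z => g (qParam 1 z) := by
      filter_upwards [isOpen_upperHalfPlaneSet.mem_nhds τ.im_pos] with z hz
      have := SlashInvariantFormClass.eq_cuspFunction f ⟨z, hz⟩ one_mem_strictPeriods_SL one_ne_zero
      rw [hg]
      simp only [Function.comp_apply, ofComplex_apply_of_im_pos hz]
      exact this.symm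
    have hgd : DifferentiableAt ℂ g q := hdiff.differentiableAt
      (Metric.isOpen_ball.mem_nhds (mem_ball_zero_iff.2 hqn))
    have hqd : HasDerivAt (fun z => qParam 1 z) (2 * Real.pi * Complex.I * q) (τ : ℂ) := by
      have h1 : HasDerivAt (fun z : ℂ => 2 * Real.pi * Complex.I * z / (1 : ℝ))
          (2 * Real.pi * Complex.I * 1 / (1 : ℝ)) (τ : ℂ) :=
        ((hasDerivAt_id _).const_mul _).div_const _
      have := h1.cexp
      convert! this using 1
      rw [hq, qParam]; simp; ring
    have hchain : deriv (f ∘ ofComplex : ℂ → ℂ) τ = deriv g q * (2 * Real.pi * Complex.I * q) := by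
      rw [hev.deriv_eq]
      exact (HasDerivAt.comp (τ : ℂ) hgd.hasDerivAt hqd).deriv
    rw [normalizedDerivOfComplex, hchain]
    have : (Real.pi : ℂ) ≠ 0 := by exact_mod_cast Real.pi_ne_zero
    field_simp
  rw [hD, ← hasSum_nat_add_iff' 1]
  simp only [Finset.range_one, Finset.sum_singleton, Nat.cast_zero, zero_mul, zero_smul, sub_zero]
  convert! hs.mul_left q using 1
  funext m
  rw [qExpansion_coeff, iteratedDeriv_succ', Nat.factorial_succ]
  have h1 : ((m : ℂ) + 1) ≠ 0 := by exact_mod_cast Nat.succ_ne_zero m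
  have h2 : (m.factorial : ℂ) ≠ 0 := by exact_mod_cast m.factorial_ne_zero
  simp only [smul_eq_mul, sub_zero]
  push_cast
  field_simp
  ring

open UpperHalfPlane Derivative Function.Periodic in
open scoped MatrixGroups ModularForm Manifold in
lemma hasSum_serreDerivative {k : ℤ} (f : ModularForm 𝒮ℒ k) (τ : ℍ) :
    HasSum (fun m : ℕ => (PowerSeries.coeff m (theta (qExpansion 1 f) - PowerSeries.C ((k : ℂ) * 12⁻¹) *
      (E2ser ℂ * qExpansion 1 f))) • qParam 1 (τ : ℂ) ^ m)
      (serreDerivative k f τ) := by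
  have h1 := hasSum_normalizedDeriv f τ
  have : Fact (IsCusp OnePoint.infty 𝒮ℒ) :=
    ⟨Subgroup.isCusp_of_mem_strictPeriods one_pos one_mem_strictPeriods_SL⟩
  have h2 := ModularForm.hasSum_qExpansion (f := f) one_pos one_mem_strictPeriods_SL τ
  have h3 := EisensteinSeries.hasSum_qExpansion_E2 (z := τ)
  have hq : qParam 1 (τ : ℂ) = Complex.exp (2 * Real.pi * Complex.I * τ) := by
    simp [qParam]
  rw [← hq] at h3
  have h4 := summable_norm_sum_mul_antidiagonal_of_summable_norm h3.summable.norm h2.summable.norm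
  have h5 := tsum_mul_tsum_eq_tsum_sum_antidiagonal_of_summable_norm h3.summable.norm h2.summable.norm
  rw [h3.tsum_eq, h2.tsum_eq] at h5
  have h6 : HasSum _ _ := h4.of_norm.hasSum
  rw [← h5] at h6
  rw [serreDerivative_apply]
  have h7 := h1.sub (h6.mul_left ((k : ℂ) * 12⁻¹))
  convert! h7 using 1
  · funext m
    rw [map_sub, theta_coeff, PowerSeries.coeff_C_mul, PowerSeries.coeff_mul, sub_smul]
    congr 1
    rw [smul_eq_mul, mul_assoc, Finset.sum_mul]
    congr 1
    refine Finset.sum_congr rfl fun x hx => ?_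
    rw [← Finset.HasAntidiagonal.mem_antidiagonal.1 hx, pow_add]
    simp only [E2ser, PowerSeries.coeff_mk, smul_eq_mul, ArithmeticFunction.sigma_one_apply]
    push_cast
    ring
  · ring

open UpperHalfPlane Derivative in
open scoped MatrixGroups ModularForm Manifold in
/-- The Serre derivative of a level one modular form, as a modular form. -/
def serreForm {k : ℤ} (f : ModularForm 𝒮ℒ k) : ModularForm 𝒮ℒ (k + 2) :=
  mkModularForm (serreDerivative k f) (serreDerivative_mdifferentiable _ f.holo')
    (fun γ => serreDerivative_slash_invariant f.holo' (f.slash_action_eq' _ ⟨γ, rfl⟩))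
    (isBoundedAtImInfty_of_hasSum_qExpansion one_pos (hasSum_serreDerivative f))

open UpperHalfPlane in
open scoped MatrixGroups ModularForm in
lemma qExpansion_serreForm {k : ℤ} (f : ModularForm 𝒮ℒ k) :
    qExpansion 1 (serreForm f) = theta (qExpansion 1 f) -
      PowerSeries.C ((k : ℂ) * 12⁻¹) * (E2ser ℂ * qExpansion 1 f) := by
  ext m
  exact (ModularFormClass.qExpansion_coeff_unique (f := serreForm f) one_pos one_mem_strictPeriods_SL
    (fun τ => hasSum_serreDerivative f τ) m).symm

open UpperHalfPlane in
open scoped MatrixGroups ModularForm in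
lemma modularForm_weight_two_eq_zero (f : ModularForm 𝒮ℒ 2) : f = 0 :=
  rank_zero_iff_forall_zero.1 ModularForm.levelOne_weight_two_rank_zero f

open UpperHalfPlane in
open scoped MatrixGroups ModularForm in
lemma qExpansion_eq_zero_of_weight_fourteen {k : ℤ} (hk : k = 14) (f : ModularForm 𝒮ℒ k)
    (h : (qExpansion 1 f).coeff 0 = 0) : qExpansion 1 f = 0 := by
  subst hk
  rw [ModularForm.qExpansion_eq_qExpansion_discriminant_mul f h]
  have : ∀ ψ : ModularForm 𝒮ℒ (14 - 12), qExpansion 1 ψ = 0 := by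
    intro ψ
    rw [← ModularForm.qExpansion_mcast (show (14 - 12 : ℤ) = 2 by norm_num) rfl ψ,
      modularForm_weight_two_eq_zero (ModularForm.mcast _ ψ rfl)]
    exact UpperHalfPlane.qExpansion_zero 1
  rw [this, mul_zero]

open UpperHalfPlane in
open scoped MatrixGroups ModularForm in
lemma qExpansion_discriminant : qExpansion 1 ModularForm.discriminant =
    PowerSeries.map (algebraMap ℚ ℂ) Delta := by
  set d : ModularForm 𝒮ℒ 12 := mkModularForm CuspForm.discriminant CuspForm.discriminant.holo'
    (fun γ => CuspForm.discriminant.slash_action_eq' _ ⟨γ, rfl⟩)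
    ModularForm.discriminant_isZeroAtImInfty.isBoundedAtImInfty with hd
  have hdq : qExpansion 1 d = qExpansion 1 ModularForm.discriminant := rfl
  have h0 : (qExpansion 1 ModularForm.discriminant).coeff 0 = 0 :=
    CuspFormClass.qExpansion_coeff_zero CuspForm.discriminant one_pos one_mem_strictPeriods_SL
  have hs := qExpansion_serreForm d
  rw [qExpansion_eq_zero_of_weight_fourteen (by norm_num) (serreForm d) ?_] at hs
  · refine theta_eq_E2_unique (R := ℂ) ?_ ?_ ?_
    · rw [hdq] at hs
      norm_num at hs
      exact (sub_eq_zero.1 hs.symm)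
    · have := congrArg (PowerSeries.map (algebraMap ℚ ℂ)) theta_Delta
      rw [map_mul] at this
      convert! this using 1
      · ext n; simp [theta_coeff]
      · congr 1
        ext n; simp only [E2ser, PowerSeries.coeff_mk, PowerSeries.coeff_map]; split_ifs <;> simp
    · rw [ModularForm.discriminant_qExpansion_coeff_one, PowerSeries.coeff_map, Delta_coeff_one]
      simp
  · rw [hs, hdq, map_sub, theta_coeff, PowerSeries.coeff_C_mul, PowerSeries.coeff_mul]
    rw [PowerSeries.coeff_zero_eq_constantCoeff_apply] at h0
    simp [h0]

open UpperHalfPlane in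
open scoped MatrixGroups ModularForm in
lemma qExpansion_E {k : ℕ} (hk : 3 ≤ k) (hk2 : Even k) :
    qExpansion 1 (ModularForm.E hk) = PowerSeries.map (algebraMap ℚ ℂ) (Gser k) := by
  ext n
  rw [EisensteinSeries.E_qExpansion_coeff hk hk2, PowerSeries.coeff_map, Gser,
    PowerSeries.coeff_mk]
  split_ifs
  · simp
  · simp [ArithmeticFunction.sigma_apply]

lemma Gser_coeff_zero (k : ℕ) : PowerSeries.coeff 0 (Gser k) = 1 := by simp [Gser]

lemma map_algebraMap_injective :
    Function.Injective (PowerSeries.map (algebraMap ℚ ℂ)) := by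
  intro a b h
  ext n
  have := congrArg (PowerSeries.coeff n) h
  simpa using this

lemma map_theta (f : PowerSeries ℚ) : PowerSeries.map (algebraMap ℚ ℂ) (theta f) =
    theta (PowerSeries.map (algebraMap ℚ ℂ) f) := by
  ext n; simp [theta_coeff]

lemma map_E2ser : PowerSeries.map (algebraMap ℚ ℂ) (E2ser ℚ) = E2ser ℂ := by
  ext n; simp only [E2ser, PowerSeries.coeff_mk, PowerSeries.coeff_map]; split_ifs <;> simp

open UpperHalfPlane in
open scoped MatrixGroups ModularForm in
lemma theta_Gser_four : 3 * theta (Gser 4) = E2ser ℚ * Gser 4 - Gser 6 := by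
  apply map_algebraMap_injective
  have hs := qExpansion_serreForm ModularForm.E₄
  obtain ⟨c, hc⟩ := (finrank_eq_one_iff_of_nonzero' ModularForm.E₆
    (EisensteinSeries.E_ne_zero _ ⟨3, rfl⟩)).1
      (Module.rank_eq_one_iff_finrank_eq_one.mp ModularForm.levelOne_weight_six_rank_one)
      ((serreForm ModularForm.E₄).mcast (by norm_num : (4 + 2 : ℤ) = 6) rfl)
  have hq : qExpansion 1 (serreForm ModularForm.E₄) =
      c • PowerSeries.map (algebraMap ℚ ℂ) (Gser 6) := by
    rw [← ModularForm.qExpansion_mcast (show (4 + 2 : ℤ) = 6 by norm_num) rfl, ← hc,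
      ← qExpansion_E (by norm_num) ⟨3, rfl⟩]
    exact ModularForm.qExpansion_smul one_pos one_mem_strictPeriods_SL c ModularForm.E₆
  rw [hq, qExpansion_E (by norm_num) ⟨2, rfl⟩] at hs
  have h0 := congrArg (PowerSeries.coeff 0) hs
  rw [PowerSeries.coeff_smul, map_sub, theta_coeff, PowerSeries.coeff_C_mul,
    PowerSeries.coeff_mul] at h0
  simp [E2ser, Gser] at h0
  have hc' : c = -(1 / 3) := by rw [h0]; norm_num
  rw [hc'] at hs
  rw [map_mul, map_theta, map_sub, map_mul, map_E2ser]
  have h3 : PowerSeries.C ((((4 : ℤ) : ℂ)) * 12⁻¹) = (PowerSeries.C (1 / 3 : ℂ)) := by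
    congr 1; norm_num
  have h4 : (3 : PowerSeries ℂ) * PowerSeries.C (1 / 3 : ℂ) = 1 := by
    rw [show (3 : PowerSeries ℂ) = PowerSeries.C 3 from rfl, ← map_mul]; norm_num
  rw [h3, PowerSeries.smul_eq_C_mul, map_neg] at hs
  rw [map_ofNat]
  linear_combination 3 * (-hs) - (E2ser ℂ * PowerSeries.map (algebraMap ℚ ℂ) (Gser 4) -
    PowerSeries.map (algebraMap ℚ ℂ) (Gser 6)) * (- h4)

/-- The power series `X / Δ`. -/
def Wser : PowerSeries ℚ := (PowerSeries.mk fun n => PowerSeries.coeff (n + 1) Delta)⁻¹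

lemma Delta_mul_Wser : Delta * Wser = PowerSeries.X := by
  have h : Delta = PowerSeries.X * PowerSeries.mk fun n => PowerSeries.coeff (n + 1) Delta := by
    ext n
    cases n with
    | zero => simp [Delta]
    | succ n => rw [PowerSeries.coeff_succ_X_mul, PowerSeries.coeff_mk]
  conv_lhs => rw [h]
  rw [mul_assoc, Wser, PowerSeries.mul_inv_cancel, mul_one]
  simp [← PowerSeries.coeff_zero_eq_constantCoeff_apply, Delta_coeff_one]

lemma Delta_ne_zero : Delta ≠ 0 := by
  intro h
  have := Delta_coeff_one
  simp [h] at this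

lemma theta_Wser : theta Wser = Wser - E2ser ℚ * Wser := by
  have h := congrArg theta Delta_mul_Wser
  rw [theta_mul, theta_Delta, theta_X, ← Delta_mul_Wser] at h
  apply mul_left_cancel₀ Delta_ne_zero
  linear_combination h

lemma Wser_coeff_zero : PowerSeries.coeff 0 Wser = 1 := by
  have h := congrArg (PowerSeries.coeff 1) Delta_mul_Wser
  rw [PowerSeries.coeff_mul, Finset.Nat.sum_antidiagonal_eq_sum_range_succ
      (fun i j => PowerSeries.coeff i Delta * PowerSeries.coeff j Wser), Finset.sum_range_succ,
      Finset.sum_range_one, Delta_coeff_zero, Delta_coeff_one] at h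
  simpa using h

lemma Wser_nonneg (n : ℕ) : 0 ≤ PowerSeries.coeff n Wser := by
  induction n using Nat.strong_induction_on with
  | _ n ih =>
    rcases Nat.eq_zero_or_pos n with rfl | hn
    · rw [Wser_coeff_zero]; norm_num
    have h := congrArg (PowerSeries.coeff n) theta_Wser
    rw [theta_coeff, show Wser - E2ser ℚ * Wser = (1 - E2ser ℚ) * Wser by ring,
      PowerSeries.coeff_mul, Finset.Nat.sum_antidiagonal_eq_sum_range_succ
      (fun i j => PowerSeries.coeff i (1 - E2ser ℚ) * PowerSeries.coeff j Wser),
      Finset.sum_range_succ'] at h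
    have h0 : 0 ≤ (n : ℚ) * PowerSeries.coeff n Wser := by
      rw [h]
      refine add_nonneg (Finset.sum_nonneg fun i hi => mul_nonneg ?_
        (ih _ (by have := Finset.mem_range.1 hi; omega))) ?_
      · simp only [map_sub, PowerSeries.coeff_one, E2ser, PowerSeries.coeff_mk]
        simp
        positivity
      · simp [E2ser]
    exact nonneg_of_mul_nonneg_right h0 (by exact_mod_cast hn)

lemma constantTerm_theta_zero (f : PowerSeries ℚ) (r : ℕ) :
    PowerSeries.coeff r (theta f - (r : PowerSeries ℚ) * f) = 0 := by
  rw [map_sub, theta_coeff, ← map_natCast (PowerSeries.C (R := ℚ)), PowerSeries.coeff_C_mul,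
    sub_self]

lemma theta_Gser_pow_mul_Wser_pow (s r : ℕ) (hs : 1 ≤ s) (hr : 1 ≤ r) :
    theta (Gser 4 ^ s * Wser ^ r) - (r : PowerSeries ℚ) * (Gser 4 ^ s * Wser ^ r) =
      -(r : PowerSeries ℚ) * (Gser 4 ^ (s - 1) * Gser 6 * Wser ^ r) +
        ((s : PowerSeries ℚ) - 3 * r) * (Gser 4 ^ (s - 1) * theta (Gser 4) * Wser ^ r) := by
  have h6 : Gser 6 = E2ser ℚ * Gser 4 - 3 * theta (Gser 4) := by rw [theta_Gser_four]; ring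
  rw [theta_mul, theta_pow, theta_pow, theta_Wser, h6]
  obtain ⟨s, rfl⟩ := Nat.exists_eq_add_of_le hs
  obtain ⟨r, rfl⟩ := Nat.exists_eq_add_of_le hr
  simp only [Nat.add_sub_cancel_left]
  push_cast
  ring

lemma constantTerm_Gser_pow (r : ℕ) :
    PowerSeries.coeff (r + 1) (Gser 4 ^ (3 * r + 2) * Gser 6 * Wser ^ (r + 1)) = 0 := by
  have h := constantTerm_theta_zero (Gser 4 ^ (3 * (r + 1)) * Wser ^ (r + 1)) (r + 1)
  rw [theta_Gser_pow_mul_Wser_pow _ _ (by omega) (by omega)] at h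
  have e : ((3 * (r + 1) : ℕ) : PowerSeries ℚ) - 3 * ((r + 1 : ℕ) : PowerSeries ℚ) = 0 := by
    push_cast; ring
  rw [e, zero_mul, add_zero, ← map_natCast (PowerSeries.C (R := ℚ)), ← map_neg,
    PowerSeries.coeff_C_mul] at h
  rcases mul_eq_zero.1 h with h | h
  · exact absurd h (neg_ne_zero.2 (by exact_mod_cast Nat.succ_ne_zero r))
  · exact h

open UpperHalfPlane in
open scoped MatrixGroups ModularForm in
lemma exists_modularForm_E4_pow_mul_E6 (n : ℕ) : ∃ g : ModularForm 𝒮ℒ ((4 * n + 6 : ℕ) : ℤ),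
    qExpansion 1 g = PowerSeries.map (algebraMap ℚ ℂ) (Gser 4 ^ n * Gser 6) := by
  induction n with
  | zero => exact ⟨ModularForm.E₆, by rw [qExpansion_E (by norm_num) ⟨3, rfl⟩]; simp⟩
  | succ n ih =>
    obtain ⟨g, hg⟩ := ih
    refine ⟨(ModularForm.E₄.mul g).mcast (by push_cast; ring) rfl, ?_⟩
    rw [ModularForm.qExpansion_mcast, ModularForm.qExpansion_mul one_pos one_mem_strictPeriods_SL,
      hg, qExpansion_E (by norm_num) ⟨2, rfl⟩, ← map_mul]
    congr 1; ring

open UpperHalfPlane in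
open scoped MatrixGroups ModularForm in
lemma constantTerm_zero (r : ℕ) : ∀ φ : ModularForm 𝒮ℒ ((12 * r + 2 : ℕ) : ℤ),
    PowerSeries.coeff r (qExpansion 1 φ * PowerSeries.map (algebraMap ℚ ℂ) (Wser ^ r)) = 0 := by
  induction r with
  | zero =>
    intro φ
    rw [modularForm_weight_two_eq_zero φ]
    simp [UpperHalfPlane.qExpansion_zero]
  | succ r ih =>
    intro φ
    obtain ⟨g, hg⟩ := exists_modularForm_E4_pow_mul_E6 (3 * r + 2)
    set g' : ModularForm 𝒮ℒ ((12 * (r + 1) + 2 : ℕ) : ℤ) := g.mcast (by congr 1; ring) rfl with hg'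
    have hgq : qExpansion 1 g' = PowerSeries.map (algebraMap ℚ ℂ) (Gser 4 ^ (3 * r + 2) * Gser 6) := by
      rw [hg', ModularForm.qExpansion_mcast, hg]
    set c := (qExpansion 1 φ).coeff 0 with hc
    set χ : ModularForm 𝒮ℒ ((12 * (r + 1) + 2 : ℕ) : ℤ) := φ - c • g' with hχ
    have hsub : qExpansion 1 χ = qExpansion 1 φ - c • qExpansion 1 g' := by
      refine (ModularForm.qExpansion_sub one_pos one_mem_strictPeriods_SL φ (c • g')).trans ?_
      congr 1
      exact ModularForm.qExpansion_smul one_pos one_mem_strictPeriods_SL c g'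
    have h0 : (qExpansion 1 χ).coeff 0 = 0 := by
      rw [hsub, map_sub, PowerSeries.coeff_smul, hgq, PowerSeries.coeff_map, ← hc]
      simp [Gser]
    have h1 := ModularForm.qExpansion_eq_qExpansion_discriminant_mul χ h0
    set ψ := CuspForm.discriminantEquiv (χ.toCuspForm h0)
    have h2 : qExpansion 1 ψ = qExpansion 1 (ψ.mcast
      (show (((12 * (r + 1) + 2 : ℕ) : ℤ) - 12) = ((12 * r + 2 : ℕ) : ℤ) by push_cast; ring) rfl) := by
      rw [ModularForm.qExpansion_mcast]
    have h3 := ih (ψ.mcast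
      (show (((12 * (r + 1) + 2 : ℕ) : ℤ) - 12) = ((12 * r + 2 : ℕ) : ℤ) by push_cast; ring) rfl)
    rw [← h2] at h3
    have h4 : qExpansion 1 φ = c • qExpansion 1 g' +
        PowerSeries.map (algebraMap ℚ ℂ) Delta * qExpansion 1 ψ := by
      rw [← qExpansion_discriminant, ← h1, hsub]; ring
    rw [h4, add_mul, map_add, hgq, smul_mul_assoc, ← map_mul, PowerSeries.coeff_smul,
      PowerSeries.coeff_map, constantTerm_Gser_pow, map_zero, smul_zero, zero_add, pow_succ,
      show PowerSeries.map (algebraMap ℚ ℂ) Delta * qExpansion 1 ψ *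
        PowerSeries.map (algebraMap ℚ ℂ) (Wser ^ r * Wser) = PowerSeries.map (algebraMap ℚ ℂ)
        (Delta * Wser) * (qExpansion 1 ψ * PowerSeries.map (algebraMap ℚ ℂ) (Wser ^ r)) by
        rw [map_mul, map_mul]; ring, Delta_mul_Wser, PowerSeries.map_X,
      PowerSeries.coeff_succ_X_mul, h3]

lemma cCoeff_eq (h j : ℕ) (hj : j ≤ rS h) : cCoeff h j =
    PowerSeries.coeff (rS h - j) (Gser (12 * rS h + 2 - h) * Wser ^ rS h) := by
  set r := rS h
  have hD : (HahnSeries.ofPowerSeries ℤ ℚ Delta) ^ (-(r : ℤ)) =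
      HahnSeries.single (-(r : ℤ)) 1 * HahnSeries.ofPowerSeries ℤ ℚ (Wser ^ r) := by
    rw [zpow_neg, zpow_natCast, ← map_pow]
    refine inv_eq_of_mul_eq_one_right ?_
    rw [mul_left_comm, ← map_mul, ← mul_pow, Delta_mul_Wser, HahnSeries.ofPowerSeries_X_pow,
      HahnSeries.single_mul_single]
    simp
  rw [cCoeff, Tq, hD, mul_left_comm, ← map_mul]
  have : (-(j : ℤ)) = ((r - j : ℕ) : ℤ) + (-(r : ℤ)) := by push_cast [hj]; ring
  rw [this, HahnSeries.coeff_single_mul_add, one_mul, HahnSeries.ofPowerSeries_apply_coeff]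

open UpperHalfPlane in
open scoped MatrixGroups ModularForm in
lemma qExpansion_eq_zero_of_weight_ten {k : ℤ} (hk : k = 10) (f : ModularForm 𝒮ℒ k)
    (h : (qExpansion 1 f).coeff 0 = 0) : qExpansion 1 f = 0 := by
  subst hk
  rw [ModularForm.qExpansion_eq_qExpansion_discriminant_mul f h]
  have : ∀ ψ : ModularForm 𝒮ℒ (10 - 12), qExpansion 1 ψ = 0 := by
    intro ψ
    rw [rank_zero_iff_forall_zero.1 (ModularForm.levelOne_neg_weight_rank_zero (by norm_num)) ψ]
    exact UpperHalfPlane.qExpansion_zero 1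
  rw [this, mul_zero]

open UpperHalfPlane in
open scoped MatrixGroups ModularForm in
lemma Gser_eq_pow (n : ℕ) (hn : n ≤ 2) : Gser (4 * n + 6) = Gser 4 ^ n * Gser 6 := by
  obtain ⟨g, hg⟩ := exists_modularForm_E4_pow_mul_E6 n
  have hE := qExpansion_E (k := 4 * n + 6) (by omega) ⟨2 * n + 3, by ring⟩
  set e : ModularForm 𝒮ℒ ((4 * n + 6 : ℕ) : ℤ) := ModularForm.E (show 3 ≤ 4 * n + 6 by omega) with he
  set χ : ModularForm 𝒮ℒ ((4 * n + 6 : ℕ) : ℤ) := e - g with hχ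
  have hsub : qExpansion 1 χ = qExpansion 1 e - qExpansion 1 g :=
    ModularForm.qExpansion_sub one_pos one_mem_strictPeriods_SL e g
  have h0 : (qExpansion 1 χ).coeff 0 = 0 := by
    rw [hsub, hE, hg, map_sub, PowerSeries.coeff_map, PowerSeries.coeff_map]
    simp [Gser]
  apply map_algebraMap_injective
  rw [← hE, ← hg, ← sub_eq_zero, ← hsub]
  interval_cases n
  · simp at hg
    rw [hsub, hE, hg]; simp
  · exact qExpansion_eq_zero_of_weight_ten (by norm_num) χ h0
  · exact qExpansion_eq_zero_of_weight_fourteen (by norm_num) χ h0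

lemma rS_four_mul (k : ℕ) : rS (4 * k) = k / 3 + 1 := by
  unfold rS
  rw [if_neg (by omega)]
  omega

open UpperHalfPlane in
open scoped MatrixGroups ModularForm in
/-- The coefficients of `T_h` give a linear relation between the first coefficients of every
modular form of weight `h`. -/
theorem siegel_relation (k : ℕ) (g : ModularForm 𝒮ℒ ((4 * k : ℕ) : ℤ)) :
    ∑ j ∈ Finset.range (k / 3 + 2), (cCoeff (4 * k) j : ℂ) * (qExpansion 1 g).coeff j = 0 := by
  set r := k / 3 + 1 with hr
  set w := 12 * r + 2 - 4 * k with hw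
  have hw3 : 3 ≤ w := by omega
  have hw2 : Even w := ⟨6 * r + 1 - 2 * k, by omega⟩
  set φ : ModularForm 𝒮ℒ ((12 * r + 2 : ℕ) : ℤ) := ((ModularForm.E hw3).mul g).mcast
    (by rw [← Nat.cast_add]; congr 1; omega) rfl with hφ
  have h := constantTerm_zero r φ
  rw [hφ, ModularForm.qExpansion_mcast,
    ModularForm.qExpansion_mul one_pos one_mem_strictPeriods_SL, qExpansion_E hw3 hw2,
    mul_right_comm, ← map_mul, mul_comm, PowerSeries.coeff_mul,
    Finset.Nat.sum_antidiagonal_eq_sum_range_succ_mk] at h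
  rw [← h]
  refine Finset.sum_congr (by rfl) fun j hj => ?_
  rw [cCoeff_eq _ _ (by rw [rS_four_mul]; have := Finset.mem_range.1 hj; omega), rS_four_mul,
    PowerSeries.coeff_map, mul_comm]
  rfl

theorem cCoeff_zero_ne_zero (k : ℕ) (hk : 1 ≤ k) : cCoeff (4 * k) 0 ≠ 0 := by
  rw [cCoeff_eq _ _ (Nat.zero_le _), rS_four_mul, Nat.sub_zero]
  set r := k / 3 + 1 with hr
  obtain ⟨n, hn⟩ : ∃ n, n + k + 1 = 3 * r := ⟨3 * r - k - 1, by omega⟩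
  rw [show 12 * r + 2 - 4 * k = 4 * n + 6 by omega, Gser_eq_pow n (by omega)]
  have h := constantTerm_theta_zero (Gser 4 ^ (n + 1) * Wser ^ r) r
  rw [theta_Gser_pow_mul_Wser_pow _ _ (by omega) (by omega)] at h
  have e : ((n + 1 : ℕ) : PowerSeries ℚ) - 3 * (r : PowerSeries ℚ) = PowerSeries.C (-(k : ℚ)) := by
    have := congrArg (Nat.cast : ℕ → PowerSeries ℚ) hn
    push_cast at this
    rw [map_neg, map_natCast]; push_cast; linear_combination this
  rw [e, map_add, ← map_natCast (PowerSeries.C (R := ℚ)), ← map_neg,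
    PowerSeries.coeff_C_mul, PowerSeries.coeff_C_mul, Nat.add_sub_cancel] at h
  intro h0
  rw [h0, mul_zero, zero_add, mul_eq_zero] at h
  have hk0 : -(k : ℚ) ≠ 0 := neg_ne_zero.2 (by exact_mod_cast (by omega : k ≠ 0))
  have hcoef := h.resolve_left hk0
  let P (f : PowerSeries ℚ) : Prop := ∀ m, 0 ≤ PowerSeries.coeff m f
  have hPmul : ∀ f g, P f → P g → P (f * g) := by
    intro f g hf hg m
    rw [PowerSeries.coeff_mul]
    exact Finset.sum_nonneg fun x _ => mul_nonneg (hf _) (hg _)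
  have hPpow : ∀ f m, P f → P (f ^ m) := by
    intro f m hf
    induction m with
    | zero => intro j; rw [pow_zero, PowerSeries.coeff_one]; split_ifs <;> norm_num
    | succ m ih => rw [pow_succ]; exact hPmul _ _ ih hf
  have hG : ∀ m, m ≠ 0 → 0 < PowerSeries.coeff m (Gser 4) := by
    intro m hm
    rw [Gser, PowerSeries.coeff_mk, if_neg hm, show bernoulli 4 = -1 / 30 by decide +kernel]
    have : 0 < ∑ d ∈ m.divisors, (d : ℚ) ^ (4 - 1) :=
      Finset.sum_pos (fun d hd => by
        have := Nat.pos_of_mem_divisors hd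
        positivity) ⟨1, Nat.one_mem_divisors.2 hm⟩
    norm_num at this ⊢
    linarith
  have hG4 : P (Gser 4) := by
    intro m
    by_cases hm : m = 0
    · subst hm; rw [Gser_coeff_zero]; norm_num
    · exact (hG m hm).le
  have hTh : P (theta (Gser 4)) := fun m => by
    rw [theta_coeff]; exact mul_nonneg (Nat.cast_nonneg _) (hG4 m)
  have hpos : 0 < PowerSeries.coeff r (Gser 4 ^ n * theta (Gser 4) * Wser ^ r) := by
    rw [show Gser 4 ^ n * theta (Gser 4) * Wser ^ r = (Gser 4 ^ n * Wser ^ r) * theta (Gser 4) by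
      ring, PowerSeries.coeff_mul]
    have hQ : P (Gser 4 ^ n * Wser ^ r) :=
      hPmul _ _ (hPpow _ _ hG4) (hPpow _ _ Wser_nonneg)
    refine Finset.sum_pos' (fun x _ => mul_nonneg (hQ _) (hTh _))
      ⟨(0, r), by simp, ?_⟩
    refine mul_pos ?_ ?_
    · have h1 := Gser_coeff_zero 4
      have h2 := Wser_coeff_zero
      rw [PowerSeries.coeff_zero_eq_constantCoeff_apply] at h1 h2 ⊢
      rw [map_mul, map_pow, map_pow, h1, h2]; norm_num
    · rw [theta_coeff]
      exact mul_pos (by positivity) (hG r (by omega))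
  exact hpos.ne' hcoef

open Filter Topology MeasureTheory in
lemma sub_ofReal_ne_zero {z : ℂ} (hz : 0 < z.im) (x : ℝ) : z - x ≠ 0 := by
  intro h
  have := congrArg Complex.im h
  simp at this
  exact hz.ne' this

open MeasureTheory in
lemma integrable_one_div_sub_pow {z : ℂ} (hz : 0 < z.im) {m : ℕ} (hm : 2 ≤ m) :
    Integrable (fun x : ℝ => 1 / (z - x) ^ m) := by
  have h1 : Integrable (fun x : ℝ => (z.im ^ m)⁻¹ * (1 + ((x - z.re) / z.im) ^ 2)⁻¹) :=
    ((integrable_inv_one_add_sq.comp_div hz.ne').comp_sub_right z.re).const_mul _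
  refine h1.mono' ?_ (ae_of_all _ fun x => ?_)
  · refine (Continuous.aestronglyMeasurable ?_)
    exact continuous_const.div (by fun_prop) fun x => pow_ne_zero _ (sub_ofReal_ne_zero hz x)
  · have hn : ‖z - x‖ ^ 2 = (x - z.re) ^ 2 + z.im ^ 2 := by
      rw [Complex.sq_norm, Complex.normSq_apply]; simp; ring
    have him : z.im ≤ ‖z - x‖ := by
      refine le_of_sq_le_sq ?_ (norm_nonneg _) |>.trans le_rfl
      rw [hn]; nlinarith [sq_nonneg (x - z.re)]
    obtain ⟨l, rfl⟩ := Nat.exists_eq_add_of_le hm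
    rw [norm_div, norm_one, norm_pow, ← mul_inv, one_div]
    refine inv_anti₀ (by positivity) ?_
    rw [pow_add, pow_add, hn]
    have : z.im ^ 2 * z.im ^ l * (1 + ((x - z.re) / z.im) ^ 2) =
        ((x - z.re) ^ 2 + z.im ^ 2) * z.im ^ l := by
      field_simp; ring
    rw [this]
    gcongr

open MeasureTheory Filter Topology in
lemma integral_one_div_sub_pow {z : ℂ} (hz : 0 < z.im) {m : ℕ} (hm : 2 ≤ m) :
    ∫ x : ℝ, 1 / (z - x) ^ m = 0 := by
  obtain ⟨l, rfl⟩ := Nat.exists_eq_add_of_le hm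
  have hd : ∀ x : ℝ, HasDerivAt (fun x : ℝ => ((l : ℂ) + 1)⁻¹ * ((z - x) ^ (l + 1))⁻¹)
      (1 / (z - x) ^ (2 + l)) x := by
    intro x
    have hne := sub_ofReal_ne_zero hz x
    have h0 : HasDerivAt (fun x : ℝ => z - (x : ℂ)) (-1) x := by
      simpa using (Complex.ofRealCLM.hasDerivAt (x := x)).const_sub z
    have h1 := ((h0.pow (l + 1)).inv (pow_ne_zero _ hne)).const_mul ((l : ℂ) + 1)⁻¹
    convert! h1 using 1
    have : (l : ℂ) + 1 ≠ 0 := by exact_mod_cast Nat.succ_ne_zero l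
    simp
    field_simp
    ring
  have hlim : ∀ L : Filter ℝ, Tendsto (fun x : ℝ => |x|) L atTop →
      Tendsto (fun x : ℝ => ((l : ℂ) + 1)⁻¹ * ((z - x) ^ (l + 1))⁻¹) L (𝓝 0) := by
    intro L hL
    rw [← mul_zero ((l : ℂ) + 1)⁻¹]
    refine Tendsto.const_mul _ ?_
    rw [tendsto_zero_iff_norm_tendsto_zero]
    simp only [norm_inv, norm_pow]
    refine (tendsto_inv_atTop_zero.comp ?_)
    refine (tendsto_pow_atTop (Nat.succ_ne_zero l)).comp ?_
    refine tendsto_atTop_mono (fun x => ?_) (tendsto_atTop_add_const_right L (-‖z‖) hL)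
    have := norm_sub_norm_le (x : ℂ) z
    rw [norm_sub_rev] at this
    simpa [sub_eq_add_neg] using this
  have := integral_of_hasDerivAt_of_tendsto hd (integrable_one_div_sub_pow hz hm)
    (hlim _ tendsto_abs_atBot_atTop) (hlim _ tendsto_abs_atTop_atTop)
  simpa using this

open MeasureTheory Polynomial in
lemma integral_polynomial_div_sub_pow {z : ℂ} (hz : 0 < z.im) {h : ℕ} (P : ℂ[X])
    (hP : P.natDegree + 2 ≤ h) :
    Integrable (fun x : ℝ => P.eval (x : ℂ) / (z - x) ^ h) ∧
      ∫ x : ℝ, P.eval (x : ℂ) / (z - x) ^ h = 0 := by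
  have e : ∀ x : ℝ, P.eval (x : ℂ) / (z - x) ^ h = ∑ i ∈ Finset.range (P.natDegree + 1),
      ((-1) ^ i * (taylor z P).coeff i) * (1 / (z - x) ^ (h - i)) := by
    intro x
    have hne := sub_ofReal_ne_zero hz x
    have : P.eval (x : ℂ) = (taylor z P).eval (x - z) := by simp [taylor_eval]
    rw [this, eval_eq_sum_range, natDegree_taylor, Finset.sum_div]
    refine Finset.sum_congr rfl fun i hi => ?_
    have hi : i ≤ h := by have := Finset.mem_range.1 hi; omega
    have hp : (z - x) ^ h = (z - x) ^ (h - i) * (z - x) ^ i := by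
      rw [← pow_add]; congr 1; omega
    have hs : ((x : ℂ) - z) ^ i = (-1) ^ i * (z - x) ^ i := by rw [← mul_pow]; congr 1; ring
    rw [hp, hs]
    field_simp
  have h_int : ∀ i ∈ Finset.range (P.natDegree + 1), Integrable (fun x : ℝ =>
      ((-1) ^ i * (taylor z P).coeff i) * (1 / (z - x) ^ (h - i))) := fun i hi => by
    have := Finset.mem_range.1 hi
    exact (integrable_one_div_sub_pow hz (by omega)).const_mul _
  simp_rw [e]
  refine ⟨integrable_finsetSum _ h_int, ?_⟩
  rw [integral_finsetSum _ h_int]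
  refine Finset.sum_eq_zero fun i hi => ?_
  have := Finset.mem_range.1 hi
  rw [integral_const_mul, integral_one_div_sub_pow hz (by omega), mul_zero]

open MeasureTheory in
lemma integrable_bounded_div_sub_pow {z : ℂ} (hz : 0 < z.im) {m : ℕ} (hm : 2 ≤ m)
    {F : ℝ → ℂ} (hF : Continuous F) {C : ℝ} (hC : ∀ x, ‖F x‖ ≤ C) :
    Integrable (fun x : ℝ => F x / (z - x) ^ m) := by
  have := (integrable_one_div_sub_pow hz hm).bdd_mul (c := C) hF.aestronglyMeasurable
    (ae_of_all _ hC)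
  simpa [div_eq_mul_inv] using this

open MeasureTheory in
/-- The substitution `x ↦ -1/x` on the real line. -/
lemma integral_neg_inv (g : ℝ → ℂ) :
    ∫ x : ℝ, g x = ∫ x : ℝ, ((x : ℂ) ^ 2)⁻¹ * g (-1 / x) := by
  have hae : ({0}ᶜ : Set ℝ) =ᵐ[volume] (Set.univ : Set ℝ) :=
    ae_eq_univ.2 (by simp)
  have him : (fun x : ℝ => -1 / x) '' {0}ᶜ = {0}ᶜ := by
    ext y
    simp only [Set.mem_image, Set.mem_compl_iff, Set.mem_singleton_iff]
    constructor
    · rintro ⟨x, hx, rfl⟩; exact div_ne_zero (by norm_num) hx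
    · intro hy; exact ⟨-1 / y, div_ne_zero (by norm_num) hy, by field_simp⟩
  have hd : ∀ x ∈ ({0}ᶜ : Set ℝ), HasDerivWithinAt (fun x : ℝ => -1 / x) ((x ^ 2)⁻¹) {0}ᶜ x := by
    intro x hx
    have := ((hasDerivAt_inv (x := x) hx).const_mul (-1)).hasDerivWithinAt (s := {0}ᶜ)
    convert! this using 1
    ring
  have hinj : Set.InjOn (fun x : ℝ => -1 / x) {0}ᶜ := by
    intro x hx y hy h
    have hx : x ≠ 0 := hx
    have hy : y ≠ 0 := hy
    simp only at h
    field_simp at h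
    linarith
  have := integral_image_eq_integral_abs_deriv_smul (by measurability) hd hinj g
  rw [him, setIntegral_congr_set hae, setIntegral_congr_set hae, setIntegral_univ,
    setIntegral_univ] at this
  rw [this]
  congr 1; ext x
  rw [abs_of_nonneg (by positivity), Complex.real_smul]
  push_cast; rfl

open MeasureTheory Polynomial in
lemma integral_div_sub_pow_neg_inv {F : ℝ → ℂ} (hF : Continuous F) {C : ℝ} (hC : ∀ x, ‖F x‖ ≤ C)
    {h : ℕ} (P : ℂ[X]) (hP : P.natDegree + 2 ≤ h)
    (hFP : ∀ x : ℝ, x ≠ 0 → F x = (x : ℂ) ^ (h - 2) * F (-1 / x) + P.eval (x : ℂ))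
    {z : ℂ} (hz : 0 < z.im) :
    ∫ x : ℝ, F x / (-1 / z - x) ^ h = z ^ h * ∫ x : ℝ, F x / (z - x) ^ h := by
  have hz0 : z ≠ 0 := by rintro rfl; simp at hz
  rw [integral_neg_inv]
  obtain ⟨hPi, hP0⟩ := integral_polynomial_div_sub_pow hz P hP
  have e : ∀ᵐ x : ℝ, ((x : ℂ) ^ 2)⁻¹ * (F (-1 / x) / (-1 / z - ((-1 / x : ℝ) : ℂ)) ^ h) =
      z ^ h * (F x / (z - x) ^ h - P.eval (x : ℂ) / (z - x) ^ h) := by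
    filter_upwards [compl_mem_ae_iff.2 (measure_singleton (0 : ℝ))] with x hx
    have hx : x ≠ 0 := hx
    have hx' : (x : ℂ) ≠ 0 := by exact_mod_cast hx
    have hne := sub_ofReal_ne_zero hz x
    have e1 : (-1 / z - ((-1 / x : ℝ) : ℂ)) = (z - x) / (z * x) := by
      push_cast; field_simp; ring
    rw [e1, hFP x hx]
    obtain ⟨l, rfl⟩ := Nat.exists_eq_add_of_le (show 2 ≤ h by omega)
    rw [div_pow, mul_pow, Nat.add_sub_cancel_left, pow_add, pow_add, pow_add]
    field_simp
    ring
  rw [integral_congr_ae e, integral_const_mul, integral_sub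
    (integrable_bounded_div_sub_pow hz (by omega) hF hC) hPi, hP0, sub_zero]

/-- The `m`-th Fourier coefficient of a 1-periodic function. -/
def fourierInt (F : ℝ → ℂ) (m : ℕ) : ℂ :=
  ∫ x in (0 : ℝ)..1, F x * Complex.exp (-2 * Real.pi * Complex.I * m * x)

open MeasureTheory UpperHalfPlane in
open scoped Nat in
lemma hasSum_fourierInt {F : ℝ → ℂ} (hF : Continuous F) {C : ℝ} (hC : ∀ x, ‖F x‖ ≤ C)
    (hper : ∀ x, F (x + 1) = F x) {k : ℕ} (hk : 1 ≤ k) (z : ℍ) :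
    HasSum (fun m : ℕ => ((m : ℂ) ^ k * fourierInt F m) * Function.Periodic.qParam 1 (z : ℂ) ^ m)
      (((-2 * Real.pi * Complex.I) ^ (k + 1) / k !)⁻¹ * ∫ x : ℝ, F x / ((z : ℂ) - x) ^ (k + 1)) := by
  set K : ℂ := (-2 * Real.pi * Complex.I) ^ (k + 1) / k ! with hK
  have hK0 : K ≠ 0 := by
    have := Real.pi_ne_zero
    have h2 := Nat.factorial_ne_zero k
    simp [hK, Complex.I_ne_zero, this, h2]
  have hpern : ∀ (n : ℤ) x, F (x + n) = F x := fun n x => by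
    have : Function.Periodic F 1 := hper
    simpa using this.int_mul n x
  have h_int := integrable_bounded_div_sub_pow z.im_pos (show 2 ≤ k + 1 by omega) hF hC
  -- unfolding over the integers
  have hle : (0 : ℝ) ≤ 1 := zero_le_one
  have hA := h_int.hasSum_intervalIntegral_comp_add_int
  have hAn := h_int.norm.hasSum_intervalIntegral_comp_add_int.summable
  simp_rw [intervalIntegral.integral_of_le hle] at hA hAn
  have hB := hasSum_integral_of_summable_integral_norm (μ := volume.restrict (Set.Ioc (0 : ℝ) 1))
    (F := fun (n : ℤ) (x : ℝ) => F (x + n) / ((z : ℂ) - ((x + n : ℝ) : ℂ)) ^ (k + 1))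
    (fun n => (h_int.comp_add_right (n : ℝ)).integrableOn) hAn
  have hI := hA.unique hB
  -- expanding into exponentials
  have hq : ‖Function.Periodic.qParam 1 (z : ℂ)‖ < 1 := by
    simpa using UpperHalfPlane.norm_qParam_lt_one 1 z
  set q := Function.Periodic.qParam 1 (z : ℂ) with hqd
  have hlip : ∀ x : ℝ, ∑' n : ℤ, F (x + n) / ((z : ℂ) - ((x + n : ℝ) : ℂ)) ^ (k + 1) =
      ∑' m : ℕ, K * (((m : ℂ) ^ k * q ^ m) *
        (F x * Complex.exp (-2 * Real.pi * Complex.I * m * x))) := by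
    intro x
    have := EisensteinSeries.qExpansion_identity hk (⟨z - x, by simpa using z.im_pos⟩ : ℍ)
    simp_rw [hpern]
    have e1 : ∑' n : ℤ, F x / ((z : ℂ) - ((x + n : ℝ) : ℂ)) ^ (k + 1) =
        F x * ∑' n : ℤ, 1 / ((z : ℂ) - x + n) ^ (k + 1) := by
      rw [← tsum_mul_left, ← (Equiv.neg ℤ).tsum_eq]
      refine tsum_congr fun n => ?_
      simp only [Equiv.neg_apply]; push_cast
      rw [mul_one_div]; congr 2; ring
    have e2 : ∑' n : ℤ, 1 / ((z : ℂ) - x + n) ^ (k + 1) = K *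
      ∑' m : ℕ, (m : ℂ) ^ k * Complex.exp (2 * Real.pi * Complex.I * ((z : ℂ) - x)) ^ m := this
    rw [e1, e2, ← tsum_mul_left, ← tsum_mul_left]
    refine tsum_congr fun m => ?_
    have e3 : Complex.exp (2 * Real.pi * Complex.I * ((z : ℂ) - x)) ^ m =
        q ^ m * Complex.exp (-2 * Real.pi * Complex.I * m * x) := by
      rw [hqd, Function.Periodic.qParam, ← Complex.exp_nat_mul, ← Complex.exp_nat_mul,
        ← Complex.exp_add]
      congr 1; push_cast; ring
    rw [e3]; ring
  have hnorm : ∀ (m : ℕ) (x : ℝ), ‖F x * Complex.exp (-2 * Real.pi * Complex.I * m * x)‖ ≤ C := by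
    intro m x
    rw [norm_mul, show (-2 * Real.pi * Complex.I * m * x : ℂ) = ((-2 * Real.pi * m * x : ℝ) : ℂ) *
      Complex.I by push_cast; ring, Complex.norm_exp_ofReal_mul_I, mul_one]
    exact hC x
  have hcont : ∀ m : ℕ, Continuous fun x : ℝ =>
      F x * Complex.exp (-2 * Real.pi * Complex.I * m * x) := fun m => by fun_prop
  have hD := hasSum_integral_of_summable_integral_norm (μ := volume.restrict (Set.Ioc (0 : ℝ) 1))
    (F := fun (m : ℕ) (x : ℝ) => K * (((m : ℂ) ^ k * q ^ m) *
        (F x * Complex.exp (-2 * Real.pi * Complex.I * m * x))))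
    (fun m => by
      have : Continuous fun x : ℝ => K * (((m : ℂ) ^ k * q ^ m) *
        (F x * Complex.exp (-2 * Real.pi * Complex.I * m * x))) := by fun_prop
      exact (this.integrableOn_Ioc)) (by
      have hs : Summable fun m : ℕ => ‖K‖ * (‖(m : ℂ) ^ k * q ^ m‖ * C) :=
        ((summable_norm_pow_mul_geometric_of_norm_lt_one k hq).mul_right C).mul_left _
      refine hs.of_nonneg_of_le (fun m => integral_nonneg fun x => norm_nonneg _) fun m => ?_
      have : ∫ x in Set.Ioc (0 : ℝ) 1, ‖K * (((m : ℂ) ^ k * q ^ m) *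
        (F x * Complex.exp (-2 * Real.pi * Complex.I * m * x)))‖ ≤
          ∫ x in Set.Ioc (0 : ℝ) 1, ‖K‖ * (‖(m : ℂ) ^ k * q ^ m‖ * C) := by
        refine integral_mono ?_ ?_ fun x => ?_
        · have : Continuous fun x : ℝ => ‖K * (((m : ℂ) ^ k * q ^ m) *
            (F x * Complex.exp (-2 * Real.pi * Complex.I * m * x)))‖ := by fun_prop
          exact this.integrableOn_Ioc
        · exact integrable_const _
        · simp only [norm_mul K, norm_mul ((m : ℂ) ^ k * q ^ m)]
          gcongr
          exact hnorm m x
      simpa using this)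
  rw [hI]
  simp_rw [hlip]
  have hE := hD.mul_left K⁻¹
  convert! hE using 1
  funext m
  rw [integral_const_mul, integral_const_mul, fourierInt, intervalIntegral.integral_of_le hle]
  field_simp

lemma differentiableOn_tsum_pow_of_le {c : ℕ → ℂ} {C : ℝ} {k : ℕ}
    (hc : ∀ m, ‖c m‖ ≤ C * (m : ℝ) ^ k) :
    DifferentiableOn ℂ (fun w : ℂ => ∑' m : ℕ, c m * w ^ m) (Metric.ball 0 1) := by
  intro w hw
  rw [mem_ball_zero_iff] at hw
  obtain ⟨r, hr, hr1⟩ := exists_between hw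
  have hr0 : 0 < r := (norm_nonneg w).trans_lt hr
  have hu : Summable fun m : ℕ => C * ((m : ℝ) ^ k * r ^ m) := by
    have := summable_norm_pow_mul_geometric_of_norm_lt_one (R := ℝ) (r := r) k
      (by rwa [Real.norm_of_nonneg hr0.le])
    refine Summable.mul_left _ (this.congr fun m => ?_)
    rw [Real.norm_of_nonneg (by positivity)]
  have := Complex.differentiableOn_tsum_of_summable_norm (U := Metric.ball (0 : ℂ) r) hu
    (F := fun m w => c m * w ^ m) (fun m => by fun_prop) Metric.isOpen_ball (fun m v hv => by
      rw [mem_ball_zero_iff] at hv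
      have h0 : 0 ≤ C * (m : ℝ) ^ k := (norm_nonneg _).trans (hc m)
      rw [norm_mul, norm_pow, ← mul_assoc]
      exact mul_le_mul (hc m) (pow_le_pow_left₀ (norm_nonneg _) hv.le _) (by positivity) h0)
  exact (this.differentiableAt (Metric.isOpen_ball.mem_nhds
    (mem_ball_zero_iff.2 hr))).differentiableWithinAt

open MeasureTheory Polynomial UpperHalfPlane in
open scoped MatrixGroups ModularForm Manifold Nat in
lemma exists_modularForm_fourierInt {F : ℝ → ℂ} (hF : Continuous F) {C : ℝ}
    (hC : ∀ x, ‖F x‖ ≤ C) (hper : ∀ x, F (x + 1) = F x) {h : ℕ} (P : ℂ[X])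
    (hP : P.natDegree + 2 ≤ h)
    (hFP : ∀ x : ℝ, x ≠ 0 → F x = (x : ℂ) ^ (h - 2) * F (-1 / x) + P.eval (x : ℂ)) :
    ∃ g : ModularForm 𝒮ℒ (h : ℤ), ∀ m,
      (qExpansion 1 g).coeff m = (m : ℂ) ^ (h - 1) * fourierInt F m := by
  obtain ⟨k, rfl⟩ : ∃ k, h = k + 1 := ⟨h - 1, by omega⟩
  have hk : 1 ≤ k := by omega
  set K : ℂ := ((-2 * Real.pi * Complex.I) ^ (k + 1) / k !)⁻¹ with hK
  set f : ℍ → ℂ := fun z => K * ∫ x : ℝ, F x / ((z : ℂ) - x) ^ (k + 1) with hf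
  set c : ℕ → ℂ := fun m => (m : ℂ) ^ k * fourierInt F m with hcdef
  have hsum : ∀ z : ℍ, HasSum (fun m => c m • Function.Periodic.qParam 1 (z : ℂ) ^ m) (f z) :=
    fun z => hasSum_fourierInt hF hC hper hk z
  have hcC : ∀ m, ‖c m‖ ≤ C * (m : ℝ) ^ k := by
    intro m
    rw [hcdef]
    simp only [norm_mul, norm_pow, Complex.norm_natCast]
    rw [mul_comm]
    gcongr
    have := intervalIntegral.norm_integral_le_of_norm_le_const (a := (0 : ℝ)) (b := 1) (C := C)
      (f := fun x : ℝ => F x * Complex.exp (-2 * Real.pi * Complex.I * m * x)) fun x _ => by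
        rw [norm_mul, show (-2 * Real.pi * Complex.I * m * x : ℂ) =
          ((-2 * Real.pi * m * x : ℝ) : ℂ) * Complex.I by push_cast; ring,
          Complex.norm_exp_ofReal_mul_I, mul_one]
        exact hC x
    simpa [fourierInt] using this
  have hol : MDiff f := by
    rw [UpperHalfPlane.mdifferentiable_iff]
    have h1 : DifferentiableOn ℂ (fun z : ℂ =>
        (fun w : ℂ => ∑' m : ℕ, c m * w ^ m) (Function.Periodic.qParam 1 z))
        upperHalfPlaneSet := by
      refine (differentiableOn_tsum_pow_of_le hcC).comp ?_ fun z hz => ?_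
      · exact (Function.Periodic.differentiable_qParam).differentiableOn
      · rw [mem_ball_zero_iff]
        simpa using UpperHalfPlane.norm_qParam_lt_one 1 (⟨z, hz⟩ : ℍ)
    refine h1.congr fun z hz => ?_
    simp only [Function.comp_apply, ofComplex_apply_of_im_pos hz]
    have := (hsum ⟨z, hz⟩).tsum_eq
    simp only [smul_eq_mul] at this
    exact this.symm
  have hS : f ∣[((k + 1 : ℕ) : ℤ)] ModularGroup.S = f := by
    ext z
    rw [SlashInvariantForm.slash_S_apply, hf]
    simp only
    have := integral_div_sub_pow_neg_inv hF hC P hP hFP z.im_pos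
    have hz : (z : ℂ) ≠ 0 := z.ne_zero
    have e : (-(z : ℂ))⁻¹ = -1 / z := by field_simp
    rw [e, this, zpow_neg, zpow_natCast]
    field_simp
  have hT : f ∣[((k + 1 : ℕ) : ℤ)] ModularGroup.T = f := by
    ext z
    rw [ModularForm.SL_slash_apply, modular_T_smul]
    have e : f ((1 : ℝ) +ᵥ z) = f z := by
      refine (hsum _).unique ?_
      have : Function.Periodic.qParam 1 (((1 : ℝ) +ᵥ z : ℍ) : ℂ) =
          Function.Periodic.qParam 1 (z : ℂ) := by
        rw [Function.Periodic.qParam, Function.Periodic.qParam,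
          ← Complex.exp_periodic (2 * Real.pi * Complex.I * z / (1 : ℝ))]
        congr 1
        simp
        ring
      rw [this]
      exact hsum z
    rw [e, ModularGroup.denom_apply]
    simp [ModularGroup.T]
  refine ⟨mkModularForm f hol (SlashInvariantForm.slash_action_generators_SL2Z hS hT)
    (isBoundedAtImInfty_of_hasSum_qExpansion one_pos hsum), fun m => ?_⟩
  exact (ModularFormClass.qExpansion_coeff_unique one_pos one_mem_strictPeriods_SL
    (f := mkModularForm f hol (SlashInvariantForm.slash_action_generators_SL2Z hS hT)
      (isBoundedAtImInfty_of_hasSum_qExpansion one_pos hsum)) hsum m).symm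

lemma hasSum_iff_of_eq {ι : Type*} {f g : ι → ℝ} {S : ℝ} (h : ∀ t, f t = g t) :
    HasSum f S ↔ HasSum g S := by rw [funext h]

/-- The value at `x` of the binary quadratic polynomial with coefficients `t = (a, b, c)`. -/
def qval (t : ℤ × ℤ × ℤ) (x : ℝ) : ℝ := t.1 * x ^ 2 + t.2.1 * x + t.2.2

/-- The discriminant of the binary quadratic form with coefficients `t = (a, b, c)`. -/
def qdisc (t : ℤ × ℤ × ℤ) : ℤ := t.2.1 ^ 2 - 4 * t.1 * t.2.2

/-- The summand of Zagier's function attached to the discriminant `Δ`. -/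
def qterm (Δ : ℤ) (p : ℕ) (x : ℝ) (t : ℤ × ℤ × ℤ) : ℝ :=
  if t.1 < 0 ∧ qdisc t = Δ then max 0 (qval t x) ^ p else 0

/-- Zagier's function `∑ max(0, Q(x))^p` over forms `Q` of discriminant `Δ` with `Q(∞) < 0`. -/
def qsum (Δ : ℤ) (p : ℕ) (x : ℝ) : ℝ := ∑' t, qterm Δ p x t

lemma qterm_nonneg (Δ : ℤ) (p : ℕ) (x : ℝ) (t : ℤ × ℤ × ℤ) : 0 ≤ qterm Δ p x t := by
  unfold qterm; split_ifs <;> positivity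

/-- Translation of the variable as a permutation of the forms. -/
def qtrans : ℤ × ℤ × ℤ ≃ ℤ × ℤ × ℤ where
  toFun t := (t.1, 2 * t.1 + t.2.1, t.1 + t.2.1 + t.2.2)
  invFun t := (t.1, t.2.1 - 2 * t.1, t.1 - t.2.1 + t.2.2)
  left_inv t := by ext <;> simp; ring
  right_inv t := by ext <;> simp; ring

/-- Reflection of the variable as a permutation of the forms. -/
def qrefl : ℤ × ℤ × ℤ ≃ ℤ × ℤ × ℤ where
  toFun t := (t.1, -t.2.1, t.2.2)
  invFun t := (t.1, -t.2.1, t.2.2)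
  left_inv t := by simp
  right_inv t := by simp

/-- Inversion of the variable as a permutation of the forms. -/
def qswap : ℤ × ℤ × ℤ ≃ ℤ × ℤ × ℤ where
  toFun t := (t.2.2, t.2.1, t.1)
  invFun t := (t.2.2, t.2.1, t.1)
  left_inv t := by simp
  right_inv t := by simp

/-- Negation of forms. -/
def qneg : ℤ × ℤ × ℤ ≃ ℤ × ℤ × ℤ := Equiv.neg _

lemma qterm_add_one (Δ : ℤ) (p : ℕ) (x : ℝ) (t : ℤ × ℤ × ℤ) :
    qterm Δ p (x + 1) t = qterm Δ p x (qtrans t) := by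
  have h1 : qdisc (qtrans t) = qdisc t := by simp [qdisc, qtrans]; ring
  have h2 : qval (qtrans t) x = qval t (x + 1) := by simp [qval, qtrans]; ring
  simp only [qterm, h1, h2]; rfl

lemma qterm_neg (Δ : ℤ) (p : ℕ) (x : ℝ) (t : ℤ × ℤ × ℤ) :
    qterm Δ p (-x) t = qterm Δ p x (qrefl t) := by
  have h1 : qdisc (qrefl t) = qdisc t := by simp [qdisc, qrefl]
  have h2 : qval (qrefl t) x = qval t (-x) := by simp [qval, qrefl]
  simp only [qterm, h1, h2]; rfl

lemma hasSum_qterm_add_one {Δ : ℤ} {p : ℕ} {x S : ℝ} :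
    HasSum (qterm Δ p (x + 1)) S ↔ HasSum (qterm Δ p x) S := by
  rw [← qtrans.hasSum_iff (f := qterm Δ p x)]
  exact hasSum_iff_of_eq fun t => qterm_add_one Δ p x t

lemma hasSum_qterm_neg {Δ : ℤ} {p : ℕ} {x S : ℝ} :
    HasSum (qterm Δ p (-x)) S ↔ HasSum (qterm Δ p x) S := by
  rw [← qrefl.hasSum_iff (f := qterm Δ p x)]
  exact hasSum_iff_of_eq fun t => qterm_neg Δ p x t

lemma qset_finite (Δ : ℤ) :
    {t : ℤ × ℤ × ℤ | t.1 < 0 ∧ 0 < t.2.2 ∧ qdisc t = Δ}.Finite := by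
  refine (Set.finite_Icc ((-Δ, -Δ, -Δ) : ℤ × ℤ × ℤ) (Δ, Δ, Δ)).subset ?_
  rintro ⟨a, b, c⟩ ⟨ha, hc, h⟩
  simp only [qdisc] at ha hc h
  have h0 : 0 < (-a) * c := mul_pos (by omega) hc
  have h1 : -a ≤ (-a) * c := le_mul_of_one_le_right (by omega) (by omega)
  have h2 : c ≤ (-a) * c := le_mul_of_one_le_left (by omega) (by omega)
  have h3 : |b| ≤ b ^ 2 := by rw [← sq_abs]; nlinarith [abs_nonneg b, Int.le_self_sq |b|]
  have h4 := abs_le.1 (le_refl |b|)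
  simp only [Set.mem_Icc, Prod.mk_le_mk]
  refine ⟨⟨?_, ?_, ?_⟩, ?_, ?_, ?_⟩ <;> nlinarith [sq_nonneg b]

/-- The finite set of forms of discriminant `Δ` with `a < 0 < c`. -/
def qset (Δ : ℤ) : Finset (ℤ × ℤ × ℤ) := (qset_finite Δ).toFinset

lemma mem_qset {Δ : ℤ} {t : ℤ × ℤ × ℤ} :
    t ∈ qset Δ ↔ t.1 < 0 ∧ 0 < t.2.2 ∧ qdisc t = Δ := by simp [qset]

/-- The polynomial cocycle attached to the discriminant `Δ`. -/
def qpoly (Δ : ℤ) (p : ℕ) (x : ℝ) : ℝ := ∑ t ∈ qset Δ, qval t x ^ p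

lemma max_pow_sub_max_pow {p : ℕ} (hp : Odd p) (t : ℝ) :
    max 0 t ^ p - max 0 (-t) ^ p = t ^ p := by
  rcases le_total 0 t with h | h
  · rw [max_eq_right h, max_eq_left (by linarith), zero_pow hp.pos.ne', sub_zero]
  · rw [max_eq_left h, max_eq_right (by linarith), zero_pow hp.pos.ne', hp.neg_pow]; ring

lemma eq_zero_of_qdisc_not_square {Δ : ℤ} (hΔ : ¬ IsSquare Δ) {t : ℤ × ℤ × ℤ} (h : qdisc t = Δ) :
    t.1 ≠ 0 ∧ t.2.2 ≠ 0 := by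
  constructor <;> intro h0 <;> refine hΔ ⟨t.2.1, ?_⟩ <;> rw [← h, qdisc, h0] <;> ring

lemma hasSum_qterm_inv {Δ : ℤ} (hΔ : ¬ IsSquare Δ) {p : ℕ} (hp : Odd p) {x S : ℝ} (hx : x ≠ 0)
    (h : HasSum (qterm Δ p x⁻¹) S) :
    HasSum (qterm Δ p x) (x ^ (2 * p) * S + qpoly Δ p x) := by
  set f₂ : ℤ × ℤ × ℤ → ℝ := fun t =>
    if t.2.2 < 0 ∧ qdisc t = Δ then max 0 (qval t x) ^ p else 0 with hf₂
  have h2 : HasSum f₂ (x ^ (2 * p) * S) := by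
    rw [← qswap.hasSum_iff]
    convert! h.mul_left (x ^ (2 * p)) using 1
    ext t
    have h1 : qdisc (qswap t) = qdisc t := by simp [qdisc, qswap]; ring
    have h3 : qval (qswap t) x = x ^ 2 * qval t x⁻¹ := by
      simp [qval, qswap]; field_simp; ring
    have h4 : max 0 (qval (qswap t) x) = x ^ 2 * max 0 (qval t x⁻¹) := by
      rw [h3, mul_max_of_nonneg _ _ (sq_nonneg x), mul_zero]
    simp only [hf₂, Function.comp_apply, h1, h4, qterm, mul_ite, mul_zero, mul_pow, ← pow_mul]
    rfl
  have h3 : HasSum (fun t => if t ∈ qset Δ then max 0 (qval t x) ^ p else 0)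
      (∑ t ∈ qset Δ, max 0 (qval t x) ^ p) := by
    have := hasSum_sum_of_ne_finset_zero (L := .unconditional _) (s := qset Δ)
      (f := fun t => if t ∈ qset Δ then max 0 (qval t x) ^ p else 0) fun t ht => if_neg ht
    rwa [Finset.sum_congr rfl fun t ht => if_pos ht] at this
  have h4 : HasSum (fun t => if qneg t ∈ qset Δ then max 0 (qval t x) ^ p else 0)
      (∑ t ∈ qset Δ, max 0 (-qval t x) ^ p) := by
    rw [← qneg.hasSum_iff]
    have := hasSum_sum_of_ne_finset_zero (L := .unconditional _) (s := qset Δ)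
      (f := fun t => if t ∈ qset Δ then max 0 (-qval t x) ^ p else 0) fun t ht => if_neg ht
    rw [Finset.sum_congr rfl fun t ht => if_pos ht] at this
    convert! this using 1
    ext t
    have : qval (qneg t) x = -qval t x := by simp [qval, qneg]; ring
    have hn : qneg (qneg t) = t := neg_neg t
    simp only [Function.comp_apply, this, hn]
  have h5 := (h2.add h3).sub h4
  rw [add_sub_assoc, ← Finset.sum_sub_distrib,
    Finset.sum_congr rfl fun t _ => max_pow_sub_max_pow hp (qval t x)] at h5
  refine (hasSum_iff_of_eq fun t => ?_).mp h5
  have hd : qdisc (qneg t) = qdisc t := by simp [qdisc, qneg]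
  have e1 : qneg t ∈ qset Δ ↔ 0 < t.1 ∧ t.2.2 < 0 ∧ qdisc t = Δ := by
    rw [mem_qset, hd]; simp [qneg]
  simp only [hf₂, qterm, e1, mem_qset]
  by_cases hD : qdisc t = Δ
  · obtain ⟨ha, hc⟩ := eq_zero_of_qdisc_not_square hΔ hD
    rcases lt_or_gt_of_ne ha with ha | ha <;> rcases lt_or_gt_of_ne hc with hc | hc <;>
      simp [ha, hc, hD, not_lt.2 ha.le, not_lt.2 hc.le]
  · simp [hD]

lemma hasSum_qterm_zero (Δ : ℤ) {p : ℕ} (hp : p ≠ 0) :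
    HasSum (qterm Δ p 0) (qpoly Δ p 0) := by
  have := hasSum_sum_of_ne_finset_zero (L := .unconditional _) (s := qset Δ) (f := qterm Δ p 0) fun t ht => by
    rw [mem_qset] at ht
    unfold qterm
    split_ifs with h
    · have : t.2.2 ≤ 0 := by by_contra! h'; exact ht ⟨h.1, h', h.2⟩
      have : qval t 0 ≤ 0 := by simp [qval]; exact_mod_cast this
      rw [max_eq_left this, zero_pow hp]
    · rfl
  convert! this using 1
  refine Finset.sum_congr rfl fun t ht => ?_
  rw [mem_qset] at ht
  have : 0 ≤ qval t 0 := by simp [qval]; exact_mod_cast ht.2.1.le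
  rw [qterm, if_pos ⟨ht.1, ht.2.2⟩, max_eq_right this]

lemma qpoly_zero_eq_eSum (Δ : ℤ) (p : ℕ) : qpoly Δ p 0 = (eSum p Δ : ℝ) := by
  have h1 : eSum p Δ = ∑ t ∈ qset Δ, t.2.2 ^ p := by
    rw [eSum]
    have e : ∀ t : ℤ × ℤ × ℤ, (0 < t.1 ∧ 0 < t.2.2 ∧ t.2.1 ^ 2 + 4 * t.1 * t.2.2 = Δ) ↔
        t ∈ (qset Δ).image (fun t => (t.2.2, t.2.1, -t.1)) := by
      intro t
      simp only [Finset.mem_image, mem_qset, qdisc]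
      constructor
      · rintro ⟨h1, h2, h3⟩
        refine ⟨(-t.2.2, t.2.1, t.1), ⟨by simpa using h2, h1, by simp only; linarith⟩, by simp⟩
      · rintro ⟨s, ⟨h1, h2, h3⟩, rfl⟩
        refine ⟨h2, by simpa using h1, ?_⟩
        simp only; linarith
    rw [finsum_congr fun t => finsum_congr_Prop (propext (e t)) fun _ => rfl, finsum_mem_finset_eq_sum,
      Finset.sum_image]
    rintro ⟨a, b, c⟩ _ ⟨a', b', c'⟩ _ h
    simp only [Prod.mk.injEq, neg_inj] at h ⊢
    tauto
  rw [h1, qpoly]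
  push_cast
  exact Finset.sum_congr rfl fun t _ => by simp [qval]

lemma sum_qset_snd (Δ : ℤ) : ∑ t ∈ qset Δ, t.2.1 = 0 := by
  have : ∑ t ∈ qset Δ, t.2.1 = ∑ t ∈ qset Δ, -t.2.1 := by
    refine Finset.sum_nbij' qrefl qrefl.symm ?_ ?_ ?_ ?_ ?_ <;> intro t <;>
      simp +contextual [mem_qset, qrefl, qdisc]
  rw [Finset.sum_neg_distrib] at this
  omega

lemma sum_qset_fst (Δ : ℤ) : ∑ t ∈ qset Δ, t.1 = -∑ t ∈ qset Δ, t.2.2 := by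
  rw [← Finset.sum_neg_distrib]
  refine Finset.sum_nbij' (fun t => (-t.2.2, t.2.1, -t.1)) (fun t => (-t.2.2, t.2.1, -t.1))
    ?_ ?_ ?_ ?_ ?_ <;> intro t
  · simp only [mem_qset, qdisc]; rintro ⟨h1, h2, h3⟩
    exact ⟨by simpa using h2, by simpa using h1, by rw [← h3]; ring⟩
  · simp only [mem_qset, qdisc]; rintro ⟨h1, h2, h3⟩
    exact ⟨by simpa using h2, by simpa using h1, by rw [← h3]; ring⟩
  all_goals simp

lemma qpoly_one (Δ : ℤ) (x : ℝ) : qpoly Δ 1 x = qpoly Δ 1 0 * (1 - x ^ 2) := by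
  have h1 : (∑ t ∈ qset Δ, (t.2.1 : ℝ)) = 0 := by exact_mod_cast sum_qset_snd Δ
  have h2 : (∑ t ∈ qset Δ, (t.1 : ℝ)) = -∑ t ∈ qset Δ, (t.2.2 : ℝ) := by
    exact_mod_cast sum_qset_fst Δ
  simp only [qpoly, qval, pow_one, Finset.sum_add_distrib, ← Finset.sum_mul, h1, h2]
  simp
  ring

lemma hasSum_qterm_add_int {Δ : ℤ} {p : ℕ} {x S : ℝ} (n : ℤ) :
    HasSum (qterm Δ p (x + n)) S ↔ HasSum (qterm Δ p x) S := by
  induction n using Int.induction_on with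
  | zero => simp
  | succ i ih => rw [← ih, ← hasSum_qterm_add_one (x := x + (i : ℤ))]; push_cast; ring_nf
  | pred i ih => rw [← ih, ← hasSum_qterm_add_one]; push_cast; ring_nf

lemma hasSum_qterm_one_rat {Δ : ℤ} (hΔ : ¬ IsSquare Δ) (v : ℕ) (hv : 0 < v) (u : ℤ) :
    HasSum (qterm Δ 1 (u / v)) (qpoly Δ 1 0) := by
  induction v using Nat.strong_induction_on generalizing u with
  | _ v ih =>
    have hv' : (v : ℝ) ≠ 0 := by exact_mod_cast hv.ne'
    have e : (u / v : ℝ) = ((u % v : ℤ) : ℝ) / v + ((u / v : ℤ) : ℝ) := by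
      rw [div_add' _ _ _ hv']
      congr 1
      exact_mod_cast (by rw [mul_comm]; exact (Int.emod_add_mul_ediv u v).symm)
    rw [e, hasSum_qterm_add_int]
    have h0 := Int.emod_nonneg u (show (v : ℤ) ≠ 0 by omega)
    have h1 := Int.emod_lt_of_pos u (show (0 : ℤ) < v by omega)
    obtain ⟨w, hw⟩ := Int.eq_ofNat_of_zero_le h0
    rw [hw] at h1 ⊢
    rcases Nat.eq_zero_or_pos w with rfl | hw0
    · simpa using hasSum_qterm_zero Δ one_ne_zero
    · have hx : ((w : ℝ) / v) ≠ 0 := by positivity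
      have := hasSum_qterm_inv hΔ odd_one hx (S := qpoly Δ 1 0) (by
        have := ih w (by exact_mod_cast h1) hw0 v
        simpa using this)
      rw [qpoly_one Δ ((w : ℝ) / v)] at this
      convert! this using 1
      ring

lemma continuous_qterm (Δ : ℤ) (p : ℕ) (t : ℤ × ℤ × ℤ) : Continuous fun x => qterm Δ p x t := by
  unfold qterm qval
  split_ifs <;> fun_prop

lemma sum_qterm_one_le {Δ : ℤ} (hΔ : ¬ IsSquare Δ) (s : Finset (ℤ × ℤ × ℤ)) (x : ℝ) :
    ∑ t ∈ s, qterm Δ 1 x t ≤ qpoly Δ 1 0 := by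
  have hc : Continuous fun x => ∑ t ∈ s, qterm Δ 1 x t :=
    continuous_finsetSum _ fun t _ => continuous_qterm Δ 1 t
  have hd : IsClosed {x : ℝ | ∑ t ∈ s, qterm Δ 1 x t ≤ qpoly Δ 1 0} :=
    isClosed_le hc continuous_const
  have hr : Set.range ((↑) : ℚ → ℝ) ⊆ {x : ℝ | ∑ t ∈ s, qterm Δ 1 x t ≤ qpoly Δ 1 0} := by
    rintro _ ⟨r, rfl⟩
    have := hasSum_qterm_one_rat hΔ r.den r.pos r.num
    rw [← Rat.cast_def] at this
    exact sum_le_hasSum s (fun t _ => qterm_nonneg _ _ _ _) this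
  have := closure_minimal hr hd
  rw [Rat.denseRange_cast.closure_range] at this
  exact this (Set.mem_univ x)

/-- For exponent one Zagier's function is constant. -/
lemma hasSum_qterm_one {Δ : ℤ} (hΔ : ¬ IsSquare Δ) (x : ℝ) :
    HasSum (qterm Δ 1 x) (qpoly Δ 1 0) := by
  have hs : ∀ x, Summable (qterm Δ 1 x) := fun x =>
    summable_of_sum_le (fun t => qterm_nonneg _ _ _ _) fun s => sum_qterm_one_le hΔ s x
  set A := qpoly Δ 1 0 with hA
  set G : ℝ → ℝ := fun x => A - qsum Δ 1 x with hG
  have hS : ∀ x, HasSum (qterm Δ 1 x) (A - G x) := fun x => by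
    have := (hs x).hasSum
    simpa [hG, qsum] using this
  have hG0 : ∀ x, 0 ≤ G x := fun x =>
    sub_nonneg.2 ((hs x).tsum_le_of_sum_le fun s => sum_qterm_one_le hΔ s x)
  have hGA : ∀ x, G x ≤ A := fun x => sub_le_self _ (tsum_nonneg fun _ => qterm_nonneg _ _ _ _)
  have hper : ∀ (n : ℤ) x, G (x + n) = G x := fun n x => by
    have := ((hasSum_qterm_add_int n).1 (hS (x + n))).unique (hS x)
    linarith
  have heven : ∀ x, G (-x) = G x := fun x => by
    have := (hasSum_qterm_neg.1 (hS (-x))).unique (hS x)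
    linarith
  have hinv : ∀ x, x ≠ 0 → G x = x ^ 2 * G x⁻¹ := fun x hx => by
    have := (hasSum_qterm_inv hΔ odd_one hx (hS x⁻¹)).unique (hS x)
    rw [qpoly_one, ← hA] at this
    linarith
  have hzero : G 0 = 0 := by
    have := (hasSum_qterm_zero Δ one_ne_zero).unique (hS 0)
    rw [← hA] at this
    linarith
  have hbdd : BddAbove (Set.range G) := ⟨A, by rintro _ ⟨x, rfl⟩; exact hGA x⟩
  have hquarter : ∀ x, G x ≤ (⨆ y, G y) / 4 := by
    intro x
    have hsup : 0 ≤ ⨆ y, G y := (hG0 0).trans (le_ciSup hbdd 0)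
    have hr : G x = G (x - round x) := by
      rw [← hper (round x) (x - round x)]; simp
    rw [hr]
    have habs := abs_sub_round x
    set y := x - round x
    rcases eq_or_ne y 0 with h | h
    · rw [h, hzero]; positivity
    · rw [hinv y h]
      have h1 : y ^ 2 ≤ 1 / 4 := by rw [← sq_abs]; nlinarith [abs_nonneg y]
      have h2 := le_ciSup hbdd y⁻¹
      nlinarith [hG0 y⁻¹]
  have hsup : ⨆ y, G y ≤ (⨆ y, G y) / 4 := ciSup_le hquarter
  have : G x = 0 := le_antisymm ((le_ciSup hbdd x).trans (by linarith)) (hG0 x)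
  simpa [this] using hS x

lemma qterm_le {Δ : ℤ} {p : ℕ} (hp : 1 ≤ p) (x : ℝ) (t : ℤ × ℤ × ℤ) :
    qterm Δ p x t ≤ |(Δ : ℝ)| ^ (p - 1) * qterm Δ 1 x t := by
  unfold qterm
  split_ifs with h
  · obtain ⟨q, rfl⟩ := Nat.exists_eq_add_of_le' hp
    rw [pow_succ, pow_one, Nat.add_sub_cancel]
    gcongr
    refine max_le (abs_nonneg _) ?_
    have h1 : (t.1 : ℝ) ≤ -1 := by exact_mod_cast (by omega : t.1 ≤ -1)
    have h2 : (t.2.1 : ℝ) ^ 2 - 4 * t.1 * t.2.2 = Δ := by exact_mod_cast h.2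
    have h3 : -(4 * t.1) * qval t x = Δ - (2 * t.1 * x + t.2.1) ^ 2 := by
      rw [← h2, qval]; ring
    by_contra! h4
    have h5 : 0 < qval t x := (abs_nonneg _).trans_lt h4
    nlinarith [le_abs_self (Δ : ℝ), sq_nonneg (2 * t.1 * x + t.2.1)]
  · simp

lemma summable_qterm {Δ : ℤ} (hΔ : ¬ IsSquare Δ) {p : ℕ} (hp : 1 ≤ p) (x : ℝ) :
    Summable (qterm Δ p x) :=
  ((hasSum_qterm_one hΔ x).summable.mul_left _).of_nonneg_of_le
    (fun _ => qterm_nonneg _ _ _ _) (qterm_le hp x)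

lemma hasSum_qsum {Δ : ℤ} (hΔ : ¬ IsSquare Δ) {p : ℕ} (hp : 1 ≤ p) (x : ℝ) :
    HasSum (qterm Δ p x) (qsum Δ p x) := (summable_qterm hΔ hp x).hasSum

lemma qsum_nonneg (Δ : ℤ) (p : ℕ) (x : ℝ) : 0 ≤ qsum Δ p x :=
  tsum_nonneg fun _ => qterm_nonneg _ _ _ _

lemma continuous_qsum {Δ : ℤ} (hΔ : ¬ IsSquare Δ) {p : ℕ} (hp : 1 ≤ p) :
    Continuous (qsum Δ p) := by
  set M := |(Δ : ℝ)| ^ (p - 1) with hM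
  have hM0 : 0 ≤ M := by positivity
  rw [continuous_iff_continuousAt]
  intro x
  refine continuousAt_of_locally_uniform_approx_of_continuousAt fun u hu => ?_
  obtain ⟨ε, hε, hu⟩ := Metric.mem_uniformity_dist.1 hu
  have hδ : 0 < ε / (M + 1) := by positivity
  obtain ⟨s, hs⟩ : ∃ s : Finset (ℤ × ℤ × ℤ),
      qpoly Δ 1 0 - ε / (M + 1) < ∑ t ∈ s, qterm Δ 1 x t :=
    ((hasSum_qterm_one hΔ x).eventually (lt_mem_nhds (by linarith))).exists
  have hc : ∀ p, Continuous fun x => ∑ t ∈ s, qterm Δ p x t :=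
    fun p => continuous_finsetSum _ fun t _ => continuous_qterm Δ p t
  refine ⟨_, (hc 1).continuousAt.eventually (lt_mem_nhds hs), fun x => ∑ t ∈ s, qterm Δ p x t,
    (hc p).continuousAt, fun y hy => hu ?_⟩
  have hy : qpoly Δ 1 0 - ε / (M + 1) < ∑ t ∈ s, qterm Δ 1 y t := hy
  have h1 := (hasSum_qsum hΔ hp y)
  have h2 := (hasSum_qterm_one hΔ y)
  have h3 : HasSum (fun t => M * qterm Δ 1 y t - qterm Δ p y t)
      (M * qpoly Δ 1 0 - qsum Δ p y) := (h2.mul_left M).sub h1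
  have h4 := sum_le_hasSum s (fun t _ => sub_nonneg.2 (qterm_le hp y t)) h3
  have h5 := sum_le_hasSum s (fun t _ => qterm_nonneg Δ p y t) h1
  rw [Finset.sum_sub_distrib, ← Finset.mul_sum] at h4
  rw [Real.dist_eq, abs_of_nonneg (by linarith)]
  have h6 : M * (ε / (M + 1)) < ε := by
    rw [mul_div_assoc', div_lt_iff₀ (by positivity)]; nlinarith
  nlinarith

lemma qsum_le {Δ : ℤ} (hΔ : ¬ IsSquare Δ) {p : ℕ} (hp : 1 ≤ p) (x : ℝ) :
    qsum Δ p x ≤ |(Δ : ℝ)| ^ (p - 1) * qpoly Δ 1 0 :=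
  hasSum_le (qterm_le hp x) (hasSum_qsum hΔ hp x) ((hasSum_qterm_one hΔ x).mul_left _)

lemma qsum_add_one (Δ : ℤ) (p : ℕ) (x : ℝ) : qsum Δ p (x + 1) = qsum Δ p x := by
  rw [qsum, qsum, ← qtrans.tsum_eq (qterm Δ p x)]
  exact tsum_congr fun t => qterm_add_one Δ p x t

lemma qsum_neg (Δ : ℤ) (p : ℕ) (x : ℝ) : qsum Δ p (-x) = qsum Δ p x := by
  rw [qsum, qsum, ← qrefl.tsum_eq (qterm Δ p x)]
  exact tsum_congr fun t => qterm_neg Δ p x t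

lemma qsum_zero (Δ : ℤ) {p : ℕ} (hp : p ≠ 0) : qsum Δ p 0 = (eSum p Δ : ℝ) := by
  rw [← qpoly_zero_eq_eSum]
  exact (hasSum_qterm_zero Δ hp).tsum_eq

lemma qsum_inv {Δ : ℤ} (hΔ : ¬ IsSquare Δ) {p : ℕ} (hp : Odd p) {x : ℝ} (hx : x ≠ 0) :
    qsum Δ p x = x ^ (2 * p) * qsum Δ p (-1 / x) + qpoly Δ p x := by
  have : -1 / x = -x⁻¹ := by ring
  rw [this, qsum_neg]
  exact (hasSum_qterm_inv hΔ hp hx (hasSum_qsum hΔ hp.pos x⁻¹)).tsum_eq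

lemma kron_two (Δ : ℤ) :
    kron Δ 2 = if Δ % 2 = 0 then 0 else if Δ % 8 = 1 ∨ Δ % 8 = 7 then 1 else -1 := by
  simp [kron, Nat.prime_two.factorization_self]

lemma kron_odd_prime (Δ : ℤ) {l : ℕ} (hl : l.Prime) (h2 : l ≠ 2) :
    kron Δ l = jacobiSym Δ l := by
  have : l.factorization 2 = 0 := Nat.factorization_eq_zero_of_not_dvd fun h =>
    h2 ((Nat.prime_dvd_prime_iff_eq Nat.prime_two hl).1 h).symm
  simp [kron, this]

/-- The number of ways in which the form `(A, B, C)` arises in the Hecke operator at `l`. -/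
def heckeCount (l : ℕ) (t : ℤ × ℤ × ℤ) : ℤ :=
  (if (l : ℤ) ^ 2 ∣ t.1 ∧ (l : ℤ) ∣ t.2.1 then 1 else 0) +
    ∑ β ∈ Finset.range l, if (l : ℤ) ∣ t.2.1 - 2 * t.1 * β ∧
      (l : ℤ) ^ 2 ∣ t.2.2 - t.2.1 * β + t.1 * β ^ 2 then 1 else 0

/-- Divisibility of a form by an integer. -/
def qdvd (n : ℤ) (t : ℤ × ℤ × ℤ) : Prop := n ∣ t.1 ∧ n ∣ t.2.1 ∧ n ∣ t.2.2

set_option maxHeartbeats 1000000 in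
lemma heckeCount_two {Δ : ℤ} (h4 : Δ % 4 = 0 ∨ Δ % 4 = 1) {t : ℤ × ℤ × ℤ}
    (ht : qdisc t = (2 : ℕ) ^ 2 * Δ) :
    heckeCount 2 t = 1 + (if qdvd (2 : ℕ) t then kron Δ 2 else 0) +
      (if qdvd ((2 : ℕ) ^ 2) t then 2 else 0) := by
  obtain ⟨A, B, C⟩ := t
  simp only [qdisc, heckeCount, qdvd, Finset.sum_range_succ, Finset.sum_range_zero] at ht ⊢
  push_cast at ht ⊢
  obtain ⟨b, rfl⟩ : ∃ b, B = 2 * b := by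
    have : Even (B ^ 2) := ⟨2 * (Δ + A * C), by linarith⟩
    obtain ⟨b, hb⟩ := (Int.even_pow.1 this).1
    exact ⟨b, by omega⟩
  have hΔ : Δ = b ^ 2 - A * C := by linarith
  obtain ⟨a, r, hA, hr⟩ : ∃ a r : ℤ, A = 4 * a + r ∧ 0 ≤ r ∧ r < 4 :=
    ⟨A / 4, A % 4, by omega, by omega, by omega⟩
  obtain ⟨c, s, hC, hs⟩ : ∃ c s : ℤ, C = 4 * c + s ∧ 0 ≤ s ∧ s < 4 :=
    ⟨C / 4, C % 4, by omega, by omega, by omega⟩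
  obtain ⟨d, u, hb, hu⟩ : ∃ d u : ℤ, b = 2 * d + u ∧ 0 ≤ u ∧ u < 2 :=
    ⟨b / 2, b % 2, by omega, by omega, by omega⟩
  obtain ⟨m, hm⟩ : ∃ m, d ^ 2 + d = 2 * m := by
    obtain ⟨m, hm⟩ := Int.even_mul_succ_self d
    exact ⟨m, by linarith⟩
  have c1 : ((2 : ℤ) ^ 2 ∣ A ∧ (2 : ℤ) ∣ 2 * b) ↔ r = 0 := by
    clear ht h4 hΔ hm hC hs hb hu; omega
  have c2 : ((2 : ℤ) ∣ 2 * b - 2 * A * 0 ∧ (2 : ℤ) ^ 2 ∣ C - 2 * b * 0 + A * 0 ^ 2) ↔ s = 0 := by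
    simp only [mul_zero, sub_zero, zero_pow two_ne_zero, add_zero]
    clear ht h4 hΔ hm c1 hA hr hb hu; omega
  have c3 : ((2 : ℤ) ∣ 2 * b - 2 * A * 1 ∧ (2 : ℤ) ^ 2 ∣ C - 2 * b * 1 + A * 1 ^ 2) ↔
      (s - 2 * u + r) % 4 = 0 := by
    have e1 : 2 * b - 2 * A * 1 = 2 * (b - A) := by ring
    have e2 : C - 2 * b * 1 + A * 1 ^ 2 = 4 * (c - d + a) + (s - 2 * u + r) := by
      rw [hA, hC, hb]; ring
    rw [e1, e2]
    generalize c - d + a = k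
    generalize s - 2 * u + r = v
    clear ht h4 hΔ hm c1 c2 hA hC hb hr hs hu
    omega
  have c4 : ((2 : ℤ) ∣ A ∧ (2 : ℤ) ∣ 2 * b ∧ (2 : ℤ) ∣ C) ↔ r % 2 = 0 ∧ s % 2 = 0 := by
    clear ht h4 hΔ hm c1 c2 c3 hb hu hr hs; omega
  have c5 : ((2 : ℤ) ^ 2 ∣ A ∧ (2 : ℤ) ^ 2 ∣ 2 * b ∧ (2 : ℤ) ^ 2 ∣ C) ↔
      r = 0 ∧ s = 0 ∧ u = 0 := by
    clear ht h4 hΔ hm c1 c2 c3 c4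
    have d1 : (2 : ℤ) ^ 2 ∣ A ↔ r = 0 := by clear hC hs hb hu; omega
    have d2 : (2 : ℤ) ^ 2 ∣ C ↔ s = 0 := by clear hA hr hb hu; omega
    have d3 : (2 : ℤ) ^ 2 ∣ 2 * b ↔ u = 0 := by clear hA hr hC hs; omega
    rw [d1, d2, d3]; tauto
  have e4 : Δ = 4 * (d ^ 2 + d * u - 4 * a * c - a * s - r * c) + (u ^ 2 - r * s) := by
    rw [hΔ, hA, hC, hb]; ring
  have h4' : (u ^ 2 - r * s) % 4 = 0 ∨ (u ^ 2 - r * s) % 4 = 1 := by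
    clear c1 c2 c3 c4 c5; omega
  have c6 : r % 2 = 0 ∧ s % 2 = 0 → kron Δ 2 = if u = 0 then 0 else
      if (r * s) % 8 = 0 then 1 else -1 := by
    clear c1 c2 c3 c4 c5
    rintro ⟨h1, h2⟩
    obtain ⟨r', rfl⟩ : ∃ r', r = 2 * r' := ⟨r / 2, by omega⟩
    obtain ⟨s', rfl⟩ : ∃ s', s = 2 * s' := ⟨s / 2, by omega⟩
    rw [kron_two]
    have hu' : u = 0 ∨ u = 1 := by omega
    rcases hu' with rfl | rfl
    · have : Δ % 2 = 0 := by
        rw [e4, show (4 * (d ^ 2 + d * 0 - 4 * a * c - a * (2 * s') - 2 * r' * c) +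
          (0 ^ 2 - 2 * r' * (2 * s')) : ℤ) = 2 * (2 * (d ^ 2 + d * 0 - 4 * a * c - a * (2 * s') -
            2 * r' * c) - 2 * r' * s') by ring]
        omega
      simp [this]
    · have : Δ = 8 * (m - 2 * a * c - a * s' - r' * c) + (1 - 2 * r' * (2 * s')) := by
        rw [e4]; linear_combination 4 * hm
      generalize (m - 2 * a * c - a * s' - r' * c) = k at this
      generalize hg : 2 * r' * (2 * s') = g at this
      have hg' : g = 4 * (r' * s') := by rw [← hg]; ring
      have o1 : ¬ Δ % 2 = 0 := by omega
      have o2 : (Δ % 8 = 1 ∨ Δ % 8 = 7) ↔ g % 8 = 0 := by omega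
      simp [o1, o2]
  have key : (if r = 0 then (1 : ℤ) else 0) + ((if s = 0 then 1 else 0) +
      if (s - 2 * u + r) % 4 = 0 then 1 else 0) = 1 + (if r % 2 = 0 ∧ s % 2 = 0 then kron Δ 2 else 0) +
      if r = 0 ∧ s = 0 ∧ u = 0 then 2 else 0 := by
    generalize kron Δ 2 = y at c6 ⊢
    clear c1 c2 c3 c4 c5 e4 hA hC hb hΔ ht h4 hm
    obtain ⟨hr0, hr1⟩ := hr; obtain ⟨hs0, hs1⟩ := hs; obtain ⟨hu0, hu1⟩ := hu
    interval_cases r <;> interval_cases s <;> interval_cases u <;> simp_all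
  simp only [← c5] at key
  simp only [← c1, ← c2, ← c3, ← c4] at key
  norm_num at key ⊢
  convert! key
  congr

lemma sum_range_zmod {l : ℕ} [NeZero l] (g : ZMod l → ℤ) :
    ∑ β ∈ Finset.range l, g (β : ZMod l) = ∑ y, g y :=
  Finset.sum_nbij' (fun β => (β : ZMod l)) ZMod.val (by simp)
    (by intro y _; simpa using ZMod.val_lt y)
    (by intro β hβ; exact ZMod.val_cast_of_lt (Finset.mem_range.1 hβ))
    (by intro y _; exact ZMod.natCast_zmod_val y) (by simp)

lemma count_quadratic_roots {l : ℕ} [Fact l.Prime] (h2 : l ≠ 2) {a b c : ZMod l}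
    (h : ¬ (a = 0 ∧ b = 0 ∧ c = 0)) :
    (if a = 0 then (1 : ℤ) else 0) + ∑ y, (if c - b * y + a * y ^ 2 = 0 then 1 else 0) =
      1 + quadraticChar (ZMod l) (b ^ 2 - 4 * a * c) := by
  have hring : ringChar (ZMod l) ≠ 2 := by rwa [ZMod.ringChar_zmod_n]
  have h20 : (2 : ZMod l) ≠ 0 := Ring.two_ne_zero hring
  rw [Finset.sum_boole]
  by_cases ha : a = 0
  · subst ha
    by_cases hb : b = 0
    · subst hb
      have : c ≠ 0 := by tauto
      simp [this]
    · have : (Finset.univ.filter fun y : ZMod l => c - b * y + 0 * y ^ 2 = 0) = {c / b} := by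
        ext y
        simp only [Finset.mem_filter, Finset.mem_univ, true_and, Finset.mem_singleton, zero_mul,
          add_zero, eq_div_iff hb, sub_eq_zero]
        constructor <;> intro h <;> linear_combination -h
      rw [this]
      simp [quadraticChar_sq_one' hb]
  · rw [if_neg ha, zero_add, ← add_comm (quadraticChar _ _),
      ← quadraticChar_card_sqrts hring]
    congr 1
    refine Finset.card_nbij' (fun y => 2 * a * y - b) (fun z => (z + b) / (2 * a)) ?_ ?_ ?_ ?_
    · intro y hy
      simp only [Finset.coe_filter, Finset.mem_univ, true_and, Set.mem_ofPred_eq, Set.coe_toFinset] at hy ⊢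
      linear_combination 4 * a * hy
    · intro z hz
      simp only [Finset.coe_filter, Finset.mem_univ, true_and, Set.mem_ofPred_eq, Set.coe_toFinset] at hz ⊢
      field_simp
      linear_combination hz
    · intro y _
      simp only
      field_simp; ring
    · intro y _
      simp only
      field_simp; ring

lemma heckeCount_odd {Δ : ℤ} {l : ℕ} (hl : l.Prime) (h2 : l ≠ 2) {t : ℤ × ℤ × ℤ}
    (ht : qdisc t = (l : ℤ) ^ 2 * Δ) :
    heckeCount l t = 1 + (if qdvd l t then kron Δ l else 0) +
      (if qdvd ((l : ℤ) ^ 2) t then (l : ℤ) else 0) := by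
  have : Fact l.Prime := ⟨hl⟩
  have hl0 : (l : ℤ) ≠ 0 := by exact_mod_cast hl.ne_zero
  have hp : Prime (l : ℤ) := Nat.prime_iff_prime_int.1 hl
  have hcop : IsCoprime ((l : ℤ)) 4 := by
    exact_mod_cast Nat.isCoprime_iff_coprime.2
      (((Nat.coprime_primes hl Nat.prime_two).2 h2).pow_right 2)
  have hkron : kron Δ l = quadraticChar (ZMod l) (Δ : ZMod l) := by
    rw [kron_odd_prime Δ hl h2, ← jacobiSym.legendreSym.to_jacobiSym]; rfl
  obtain ⟨A, B, C⟩ := t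
  simp only [qdisc, heckeCount] at ht ⊢
  by_cases hR : qdvd (l : ℤ) (A, B, C)
  · rw [if_pos hR]
    obtain ⟨⟨a, rfl⟩, ⟨b, rfl⟩, ⟨c, rfl⟩⟩ := hR
    have hΔ : Δ = b ^ 2 - 4 * a * c := by
      apply mul_left_cancel₀ (pow_ne_zero 2 hl0); linear_combination -ht
    have e1 : ∀ z, (l : ℤ) ^ 2 ∣ l * z ↔ (l : ℤ) ∣ z := fun z => by
      rw [pow_two, mul_dvd_mul_iff_left hl0]
    have e2 : ∀ z : ℤ, (l : ℤ) ∣ z ↔ (z : ZMod l) = 0 := fun z =>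
      (ZMod.intCast_zmod_eq_zero_iff_dvd z l).symm
    have e3 : ∀ β : ℕ, ((l : ℤ) ∣ l * b - 2 * (l * a) * β ∧
        (l : ℤ) ^ 2 ∣ l * c - l * b * β + l * a * β ^ 2) ↔
        (c : ZMod l) - b * (β : ZMod l) + a * (β : ZMod l) ^ 2 = 0 := fun β => by
      rw [show (l * b - 2 * (l * a) * β : ℤ) = l * (b - 2 * a * β) by ring,
        show (l * c - l * b * β + l * a * β ^ 2 : ℤ) = l * (c - b * β + a * β ^ 2) by ring, e1,
        and_iff_right (dvd_mul_right _ _), e2]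
      push_cast; rfl
    have e4 : qdvd ((l : ℤ) ^ 2) (l * a, l * b, l * c) ↔
        (a : ZMod l) = 0 ∧ (b : ZMod l) = 0 ∧ (c : ZMod l) = 0 := by
      simp only [qdvd, e1, e2]
    simp only [e3, e1, e4, dvd_mul_right, and_true]
    rw [sum_range_zmod fun y : ZMod l => if (c : ZMod l) - b * y + a * y ^ 2 = 0 then (1 : ℤ) else 0]
    by_cases hS : (a : ZMod l) = 0 ∧ (b : ZMod l) = 0 ∧ (c : ZMod l) = 0
    · have hΔ0 : (Δ : ZMod l) = 0 := by rw [hΔ]; push_cast; simp [hS]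
      rw [hkron, hΔ0]
      simp [e2, hS]
    · have := count_quadratic_roots h2 hS
      rw [hkron, if_neg hS, hΔ]
      push_cast
      rw [← this, add_zero, if_congr (e2 a) rfl rfl]
  · rw [if_neg hR, if_neg (fun h : qdvd ((l : ℤ) ^ 2) (A, B, C) => hR ⟨(dvd_pow_self _ two_ne_zero).trans h.1,
      (dvd_pow_self _ two_ne_zero).trans h.2.1, (dvd_pow_self _ two_ne_zero).trans h.2.2⟩)]
    by_cases hA : (l : ℤ) ∣ A
    · have hB : (l : ℤ) ∣ B := by
        refine hp.dvd_of_dvd_pow (n := 2) ?_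
        rw [show B ^ 2 = l ^ 2 * Δ + A * (4 * C) by linear_combination ht]
        exact dvd_add ((dvd_pow_self _ two_ne_zero).mul_right _) (hA.mul_right _)
      have hC : ¬ (l : ℤ) ∣ C := fun h => hR ⟨hA, hB, h⟩
      have hA2 : (l : ℤ) ^ 2 ∣ A := by
        have h1 : (l : ℤ) ^ 2 ∣ (4 * C) * A := by
          rw [show 4 * C * A = B ^ 2 - l ^ 2 * Δ by linear_combination -ht]
          exact dvd_sub (pow_dvd_pow_of_dvd hB 2) (dvd_mul_right _ _)
        refine IsCoprime.dvd_of_dvd_mul_left (IsCoprime.pow_left (IsCoprime.mul_right hcop ?_)) h1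
        exact (Prime.coprime_iff_not_dvd hp).2 hC
      rw [if_pos ⟨hA2, hB⟩, Finset.sum_eq_zero]
      · simp
      · intro β _
        refine if_neg fun h => hC ?_
        have := (dvd_pow_self (l : ℤ) two_ne_zero).trans h.2
        rw [show C = (C - B * β + A * β ^ 2) + (B * β - A * β ^ 2) by ring]
        exact dvd_add this (dvd_sub (hB.mul_right _) (hA.mul_right _))
    · rw [if_neg (fun h => hA ((dvd_pow_self _ two_ne_zero).trans h.1))]
      have hA' : (A : ZMod l) ≠ 0 := by rwa [Ne, ZMod.intCast_zmod_eq_zero_iff_dvd]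
      have h20 : (2 : ZMod l) ≠ 0 := Ring.two_ne_zero (by rwa [ZMod.ringChar_zmod_n])
      have e3 : ∀ β : ℕ, ((l : ℤ) ∣ B - 2 * A * β ∧ (l : ℤ) ^ 2 ∣ C - B * β + A * β ^ 2) ↔
          (β : ZMod l) = (B : ZMod l) / (2 * A) := fun β => by
        have : (l : ℤ) ∣ B - 2 * A * β → (l : ℤ) ^ 2 ∣ C - B * β + A * β ^ 2 := fun h => by
          have h1 : (l : ℤ) ^ 2 ∣ (4 * A) * (C - B * β + A * β ^ 2) := by
            rw [show 4 * A * (C - B * β + A * β ^ 2) = (B - 2 * A * β) ^ 2 - l ^ 2 * Δ by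
              linear_combination -ht]
            exact dvd_sub (pow_dvd_pow_of_dvd h 2) (dvd_mul_right _ _)
          exact IsCoprime.dvd_of_dvd_mul_left (IsCoprime.pow_left (IsCoprime.mul_right hcop
            ((Prime.coprime_iff_not_dvd hp).2 hA))) h1
        rw [and_iff_left_of_imp this, ← ZMod.intCast_zmod_eq_zero_iff_dvd, eq_div_iff (by simp [h20, hA'])]
        push_cast
        constructor <;> intro h <;> linear_combination -h
      simp only [e3]
      rw [sum_range_zmod fun y : ZMod l => if y = (B : ZMod l) / (2 * A) then (1 : ℤ) else 0]
      simp

lemma heckeCount_eq {Δ : ℤ} (h4 : Δ % 4 = 0 ∨ Δ % 4 = 1) {l : ℕ} (hl : l.Prime) {t : ℤ × ℤ × ℤ}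
    (ht : qdisc t = (l : ℤ) ^ 2 * Δ) :
    heckeCount l t = 1 + (if qdvd l t then kron Δ l else 0) +
      (if qdvd ((l : ℤ) ^ 2) t then (l : ℤ) else 0) := by
  by_cases h2 : l = 2
  · subst h2; exact_mod_cast heckeCount_two h4 (by exact_mod_cast ht)
  · exact heckeCount_odd hl h2 ht

lemma hasSum_qterm_of_injective {Δ Δ' N : ℤ} {p : ℕ} {x y s S : ℝ} (hs : 0 < s) (hN : N ≠ 0)
    {g : ℤ × ℤ × ℤ → ℤ × ℤ × ℤ} (hg : g.Injective) {P : ℤ × ℤ × ℤ → Prop} [DecidablePred P]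
    (hP : ∀ R, P R → R ∈ Set.range g) (hPg : ∀ Q, P (g Q)) (hsgn : ∀ Q, (g Q).1 < 0 ↔ Q.1 < 0)
    (hdisc : ∀ Q, qdisc (g Q) = N * qdisc Q) (hΔ : Δ' = N * Δ)
    (hval : ∀ Q, qval (g Q) x = s * qval Q y) (h : HasSum (qterm Δ p y) S) :
    HasSum (fun R => if P R then qterm Δ' p x R else 0) (s ^ p * S) := by
  rw [← hg.hasSum_iff]
  · refine (hasSum_iff_of_eq fun Q => ?_).1 (h.mul_left (s ^ p))
    simp only [Function.comp, qterm, hPg, if_true, hsgn, hdisc, hΔ, mul_right_inj' hN, hval]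
    split_ifs
    · rw [← mul_pow, mul_max_of_nonneg _ _ hs.le, mul_zero]
    · simp
  · intro R hR
    exact if_neg fun h => hR (hP R h)

set_option maxHeartbeats 1000000 in
lemma qsum_hecke {Δ : ℤ} (hΔ : ¬ IsSquare Δ) (h4 : Δ % 4 = 0 ∨ Δ % 4 = 1) {l : ℕ} (hl : l.Prime)
    {p : ℕ} (hp : 1 ≤ p) (x : ℝ) :
    qsum Δ p (l * x) + (l : ℝ) ^ (2 * p) * ∑ β ∈ Finset.range l, qsum Δ p ((x + β) / l) =
      qsum ((l : ℤ) ^ 2 * Δ) p x + kron Δ l * (l : ℝ) ^ p * qsum Δ p x +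
        (l : ℝ) ^ (2 * p + 1) *
          (if (l : ℤ) ^ 2 ∣ Δ then qsum (Δ / (l : ℤ) ^ 2) p x else 0) := by
  have hl0 : (l : ℤ) ≠ 0 := by exact_mod_cast hl.ne_zero
  have hlpos : (0 : ℤ) < l := by exact_mod_cast hl.pos
  have hlR : (0 : ℝ) < l := by exact_mod_cast hl.pos
  have hsq : ∀ {n d : ℤ}, n ≠ 0 → IsSquare (n ^ 2 * d) → IsSquare d := by
    intro n d hn ⟨r, hr⟩
    obtain ⟨q, rfl⟩ : n ∣ r := by
      rw [← Int.pow_dvd_pow_iff two_ne_zero, pow_two r, ← hr]; exact dvd_mul_right _ _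
    exact ⟨q, mul_left_cancel₀ (pow_ne_zero 2 hn) (by linear_combination hr)⟩
  have hΔ' : ¬ IsSquare ((l : ℤ) ^ 2 * Δ) := fun h => hΔ (hsq hl0 h)
  set f := qterm ((l : ℤ) ^ 2 * Δ) p x with hf
  have H0 := hasSum_qsum hΔ' hp x
  have H1 : HasSum (fun R => if qdvd l R then f R else 0) ((l : ℝ) ^ p * qsum Δ p x) := by
    refine hasSum_qterm_of_injective (N := (l : ℤ) ^ 2)
      (g := fun Q => (l * Q.1, l * Q.2.1, l * Q.2.2)) hlR (pow_ne_zero 2 hl0) ?_ ?_ ?_ ?_ ?_ rfl ?_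
      (hasSum_qsum hΔ hp x)
    · rintro ⟨a, b, c⟩ ⟨a', b', c'⟩ h
      simpa [hl.ne_zero] using h
    · rintro ⟨A, B, C⟩ ⟨⟨a, rfl : A = _⟩, ⟨b, rfl : B = _⟩, ⟨c, rfl : C = _⟩⟩
      exact ⟨(a, b, c), rfl⟩
    · exact fun Q => ⟨dvd_mul_right _ _, dvd_mul_right _ _, dvd_mul_right _ _⟩
    · intro Q; simp only; constructor <;> intro h <;> nlinarith
    · intro Q; simp only [qdisc]; ring
    · intro Q; simp only [qval]; push_cast; ring
  have H2 : HasSum (fun R => if qdvd ((l : ℤ) ^ 2) R then f R else 0) ((l : ℝ) ^ (2 * p) *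
      (if (l : ℤ) ^ 2 ∣ Δ then qsum (Δ / (l : ℤ) ^ 2) p x else 0)) := by
    by_cases hd : (l : ℤ) ^ 2 ∣ Δ
    · obtain ⟨D, rfl⟩ := hd
      have hD : ¬ IsSquare D := by
        rintro ⟨r, hr⟩; exact hΔ ⟨l * r, by rw [hr]; ring⟩
      rw [if_pos (dvd_mul_right _ _), Int.mul_ediv_cancel_left _ (pow_ne_zero 2 hl0), pow_mul]
      refine hasSum_qterm_of_injective (N := (l : ℤ) ^ 4)
        (g := fun Q => ((l : ℤ) ^ 2 * Q.1, (l : ℤ) ^ 2 * Q.2.1, (l : ℤ) ^ 2 * Q.2.2)) (by positivity)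
        (pow_ne_zero 4 hl0) ?_ ?_ ?_ ?_ ?_ (by ring) ?_ (hasSum_qsum hD hp x)
      · rintro ⟨a, b, c⟩ ⟨a', b', c'⟩ h
        simpa [hl.ne_zero] using h
      · rintro ⟨A, B, C⟩ ⟨⟨a, rfl : A = _⟩, ⟨b, rfl : B = _⟩, ⟨c, rfl : C = _⟩⟩
        exact ⟨(a, b, c), rfl⟩
      · exact fun Q => ⟨dvd_mul_right _ _, dvd_mul_right _ _, dvd_mul_right _ _⟩
      · intro Q
        have := pow_pos hlpos 2
        simp only; constructor <;> intro h <;> nlinarith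
      · intro Q; simp only [qdisc]; ring
      · intro Q; simp only [qval]; push_cast; ring
    · rw [if_neg hd, mul_zero]
      convert! hasSum_zero using 2 with R
      refine ite_eq_right_iff.2 fun ⟨⟨a, ha⟩, ⟨b, hb⟩, ⟨c, hc⟩⟩ => ?_
      rw [hf]
      refine if_neg fun h => hd ⟨b ^ 2 - 4 * a * c, mul_left_cancel₀ (pow_ne_zero 2 hl0) ?_⟩
      have h2 := h.2
      rw [qdisc, ha, hb, hc] at h2
      linear_combination -h2
  have H3 : HasSum (fun R : ℤ × ℤ × ℤ => if (l : ℤ) ^ 2 ∣ R.1 ∧ (l : ℤ) ∣ R.2.1 then f R else 0)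
      (1 ^ p * qsum Δ p (l * x)) := by
    refine hasSum_qterm_of_injective (N := (l : ℤ) ^ 2)
      (g := fun Q => ((l : ℤ) ^ 2 * Q.1, l * Q.2.1, Q.2.2)) one_pos (pow_ne_zero 2 hl0)
      ?_ ?_ ?_ ?_ ?_ rfl ?_ (hasSum_qsum hΔ hp _)
    · rintro ⟨a, b, c⟩ ⟨a', b', c'⟩ h
      simpa [hl.ne_zero] using h
    · rintro ⟨A, B, C⟩ ⟨⟨a, rfl : A = _⟩, ⟨b, rfl : B = _⟩⟩
      exact ⟨(a, b, C), rfl⟩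
    · exact fun Q => ⟨dvd_mul_right _ _, dvd_mul_right _ _⟩
    · intro Q
      have := pow_pos hlpos 2
      simp only; constructor <;> intro h <;> nlinarith
    · intro Q; simp only [qdisc]; ring
    · intro Q; simp only [qval]; push_cast; ring
  have H4 : ∀ β ∈ Finset.range l, HasSum (fun R : ℤ × ℤ × ℤ => if (l : ℤ) ∣ R.2.1 - 2 * R.1 * β ∧
      (l : ℤ) ^ 2 ∣ R.2.2 - R.2.1 * β + R.1 * β ^ 2 then f R else 0)
      (((l : ℝ) ^ 2) ^ p * qsum Δ p ((x + β) / l)) := by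
    intro β _
    refine hasSum_qterm_of_injective (N := (l : ℤ) ^ 2)
      (g := fun Q => (Q.1, 2 * Q.1 * β + Q.2.1 * l, Q.1 * β ^ 2 + Q.2.1 * l * β + Q.2.2 * l ^ 2))
      (by positivity) (pow_ne_zero 2 hl0) ?_ ?_ ?_ ?_ ?_ rfl ?_ (hasSum_qsum hΔ hp _)
    · rintro ⟨a, b, c⟩ ⟨a', b', c'⟩ h
      simp only [Prod.mk.injEq] at h ⊢
      obtain ⟨rfl, h1, h2⟩ := h
      have hb : b = b' := mul_right_cancel₀ hl0 (by linarith)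
      subst hb
      exact ⟨rfl, rfl, mul_right_cancel₀ (pow_ne_zero 2 hl0) (by linarith)⟩
    · rintro ⟨A, B, C⟩ ⟨⟨b, hb⟩, ⟨c, hc⟩⟩
      refine ⟨(A, b, c), ?_⟩
      simp only [Prod.mk.injEq, true_and] at hb hc ⊢
      exact ⟨by linear_combination -hb, by linear_combination -hc - β * hb⟩
    · intro Q
      exact ⟨⟨Q.2.1, by ring⟩, ⟨Q.2.2, by ring⟩⟩
    · intro Q; rfl
    · intro Q; simp only [qdisc]; ring
    · intro Q; simp only [qval]; push_cast; field_simp; ring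
  have HL := H3.add (hasSum_sum H4)
  have HR := (H0.add (H1.mul_left (kron Δ l : ℝ))).add (H2.mul_left (l : ℝ))
  have key : ∀ R, ((if (l : ℤ) ^ 2 ∣ R.1 ∧ (l : ℤ) ∣ R.2.1 then f R else 0) +
      ∑ β ∈ Finset.range l, if (l : ℤ) ∣ R.2.1 - 2 * R.1 * β ∧
      (l : ℤ) ^ 2 ∣ R.2.2 - R.2.1 * β + R.1 * β ^ 2 then f R else 0) =
      f R + kron Δ l * (if qdvd l R then f R else 0) +
        l * (if qdvd ((l : ℤ) ^ 2) R then f R else 0) := by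
    intro R
    by_cases hR : qdisc R = (l : ℤ) ^ 2 * Δ
    · have := congrArg (fun z : ℤ => (z : ℝ) * f R) (heckeCount_eq h4 hl hR)
      simp only [heckeCount] at this
      push_cast at this
      simpa only [add_mul, Finset.sum_mul, ite_mul, mul_ite, one_mul, zero_mul, mul_zero] using this
    · have : f R = 0 := if_neg fun h => hR h.2
      simp [this]
  have := HL.unique ((hasSum_iff_of_eq fun R => (key R).symm).1 HR)
  rw [one_pow, one_mul, ← Finset.mul_sum, ← pow_mul] at this
  rw [this]; ring

lemma sum_divisors_gcd_div {l : ℕ} (hl : l ≠ 0) {j m : ℕ} (hjm : j ≠ 0 ∨ m ≠ 0) (h : ℕ → ℂ) :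
    (if l ∣ j then ∑ d ∈ (Nat.gcd (j / l) m).divisors, h (d * l) else 0) =
      ∑ e ∈ (Nat.gcd j (m * l)).divisors with l ∣ e, h e := by
  have hne : Nat.gcd j (m * l) ≠ 0 := by
    intro h0; obtain ⟨h1, h2⟩ := Nat.gcd_eq_zero_iff.1 h0
    rcases hjm with h3 | h3
    · exact h3 h1
    · exact (mul_ne_zero h3 hl) h2
  split_ifs with hj
  · obtain ⟨i, rfl⟩ := hj
    rw [Nat.mul_div_cancel_left _ (Nat.pos_of_ne_zero hl)]
    have hne' : Nat.gcd i m ≠ 0 := by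
      rw [mul_comm m, Nat.gcd_mul_left] at hne
      exact right_ne_zero_of_mul hne
    refine Finset.sum_nbij' (fun d => d * l) (fun e => e / l) ?_ ?_ ?_ ?_ ?_
    · intro d hd
      rw [Nat.mem_divisors] at hd
      refine Finset.mem_filter.2 ⟨Nat.mem_divisors.2 ⟨?_, hne⟩, dvd_mul_left _ _⟩
      rw [mul_comm m, Nat.gcd_mul_left, mul_comm d]
      exact mul_dvd_mul_left _ hd.1
    · intro e he
      obtain ⟨he1, ⟨d, rfl⟩⟩ := Finset.mem_filter.1 he
      rw [Nat.mem_divisors, mul_comm m, Nat.gcd_mul_left] at he1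
      rw [Nat.mul_div_cancel_left _ (Nat.pos_of_ne_zero hl)]
      exact Nat.mem_divisors.2 ⟨Nat.dvd_of_mul_dvd_mul_left (Nat.pos_of_ne_zero hl) he1.1, hne'⟩
    · intro d _; exact Nat.mul_div_cancel _ (Nat.pos_of_ne_zero hl)
    · intro e he; exact Nat.div_mul_cancel (Finset.mem_filter.1 he).2
    · intro d _; rfl
  · symm
    refine Finset.sum_eq_zero fun e he => absurd ?_ hj
    obtain ⟨he1, he2⟩ := Finset.mem_filter.1 he
    exact he2.trans ((Nat.dvd_of_mem_divisors he1).trans (Nat.gcd_dvd_left _ _))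

/-- The divisor sum through which a Hecke eigen-system is determined by its first row. -/
def heckeSum (κ : ℕ) (g : ℕ → ℂ) (j m : ℕ) : ℂ :=
  ∑ d ∈ (Nat.gcd j m).divisors, (d : ℂ) ^ κ * g (j * m / d ^ 2)

lemma heckeSum_rel (κ : ℕ) (g : ℕ → ℂ) {l : ℕ} (hl : l.Prime) {j : ℕ} (hj : j ≠ 0) (m : ℕ) :
    heckeSum κ g (j * l) m + (if l ∣ j then (l : ℂ) ^ κ * heckeSum κ g (j / l) m else 0) =
      heckeSum κ g j (m * l) + (if l ∣ m then (l : ℂ) ^ κ * heckeSum κ g j (m / l) else 0) := by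
  have hl0 := hl.ne_zero
  set φ : ℕ → ℂ := fun e => (e : ℂ) ^ κ * g (j * m * l / e ^ 2) with hφ
  have e1 : heckeSum κ g (j * l) m = ∑ e ∈ (Nat.gcd (j * l) m).divisors, φ e := by
    simp only [heckeSum, hφ, mul_right_comm]
  have e2 : heckeSum κ g j (m * l) = ∑ e ∈ (Nat.gcd j (m * l)).divisors, φ e := by
    simp only [heckeSum, hφ, mul_assoc]
  have e3 : (if l ∣ j then (l : ℂ) ^ κ * heckeSum κ g (j / l) m else 0) =
      ∑ e ∈ (Nat.gcd j (m * l)).divisors with l ∣ e, φ e := by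
    rw [← sum_divisors_gcd_div hl0 (Or.inl hj)]
    refine if_ctx_congr Iff.rfl (fun hd => ?_) fun _ => rfl
    obtain ⟨i, rfl⟩ := hd
    rw [heckeSum, Finset.mul_sum, Nat.mul_div_cancel_left _ hl.pos]
    refine Finset.sum_congr rfl fun d _ => ?_
    rw [hφ]
    simp only
    rw [show l * i * m * l = (i * m) * l ^ 2 by ring, show (d * l) ^ 2 = d ^ 2 * l ^ 2 by ring,
      Nat.mul_div_mul_right _ _ (pow_pos hl.pos 2)]
    push_cast; ring
  have e4 : (if l ∣ m then (l : ℂ) ^ κ * heckeSum κ g j (m / l) else 0) =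
      ∑ e ∈ (Nat.gcd (j * l) m).divisors with l ∣ e, φ e := by
    rw [Nat.gcd_comm, ← sum_divisors_gcd_div hl0 (Or.inr hj)]
    refine if_ctx_congr Iff.rfl (fun hd => ?_) fun _ => rfl
    obtain ⟨i, rfl⟩ := hd
    rw [heckeSum, Finset.mul_sum, Nat.mul_div_cancel_left _ hl.pos, Nat.gcd_comm]
    refine Finset.sum_congr rfl fun d _ => ?_
    rw [hφ]
    simp only
    rw [show j * (l * i) * l = (j * i) * l ^ 2 by ring, show (d * l) ^ 2 = d ^ 2 * l ^ 2 by ring,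
      Nat.mul_div_mul_right _ _ (pow_pos hl.pos 2)]
    push_cast; ring
  have e5 : ∑ e ∈ (Nat.gcd (j * l) m).divisors with ¬ l ∣ e, φ e =
      ∑ e ∈ (Nat.gcd j (m * l)).divisors with ¬ l ∣ e, φ e := by
    refine Finset.sum_congr ?_ fun _ _ => rfl
    ext e
    simp only [Finset.mem_filter, Nat.mem_divisors, Nat.dvd_gcd_iff]
    have hc : ¬ l ∣ e → Nat.Coprime e l := fun h => ((hl.coprime_iff_not_dvd).2 h).symm
    have n1 : Nat.gcd (j * l) m ≠ 0 := fun h => mul_ne_zero hj hl0 (Nat.gcd_eq_zero_iff.1 h).1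
    have n2 : Nat.gcd j (m * l) ≠ 0 := fun h => hj (Nat.gcd_eq_zero_iff.1 h).1
    constructor
    · rintro ⟨⟨⟨h1, h2⟩, -⟩, h3⟩
      exact ⟨⟨⟨(hc h3).dvd_of_dvd_mul_right h1, h2.mul_right _⟩, n2⟩, h3⟩
    · rintro ⟨⟨⟨h1, h2⟩, -⟩, h3⟩
      exact ⟨⟨⟨h1.mul_right _, (hc h3).dvd_of_dvd_mul_right h2⟩, n1⟩, h3⟩
  rw [e1, e2, e3, e4, ← Finset.sum_filter_add_sum_filter_not (Nat.gcd (j * l) m).divisors (l ∣ ·),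
    ← Finset.sum_filter_add_sum_filter_not (Nat.gcd j (m * l)).divisors (l ∣ ·), e5]
  ring

lemma eq_heckeSum {κ : ℕ} {B : ℕ → ℕ → ℂ} (hB : ∀ l : ℕ, l.Prime → ∀ j, j ≠ 0 → ∀ m,
    B (j * l) m + (if l ∣ j then (l : ℂ) ^ κ * B (j / l) m else 0) =
      B j (m * l) + (if l ∣ m then (l : ℂ) ^ κ * B j (m / l) else 0)) {j : ℕ} (hj : j ≠ 0) (m : ℕ) :
    B j m = heckeSum κ (B 1) j m := by
  induction j using Nat.strong_induction_on generalizing m with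
  | _ j ih =>
    by_cases h1 : j = 1
    · subst h1; simp [heckeSum]
    · have hl := Nat.minFac_prime h1
      obtain ⟨i, hi⟩ := Nat.minFac_dvd j
      set l := j.minFac
      have hi0 : i ≠ 0 := by rintro rfl; exact hj hi
      have hij : i < j := by
        rw [hi]; exact lt_mul_left (Nat.pos_of_ne_zero hi0) hl.one_lt
      have r1 := hB l hl i hi0 m
      have r2 := heckeSum_rel κ (B 1) hl hi0 m
      have r3 : (if l ∣ i then (l : ℂ) ^ κ * B (i / l) m else 0) =
          if l ∣ i then (l : ℂ) ^ κ * heckeSum κ (B 1) (i / l) m else 0 := by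
        refine if_ctx_congr Iff.rfl (fun hd => ?_) fun _ => rfl
        rw [ih (i / l) ((Nat.div_le_self _ _).trans_lt hij)
          (Nat.div_pos (Nat.le_of_dvd (Nat.pos_of_ne_zero hi0) hd) hl.pos).ne']
      rw [r3, ih i hij hi0 (m * l), ih i hij hi0 (m / l)] at r1
      rw [hi, mul_comm l i]
      linear_combination r1 - r2

lemma heckeSum_comm (κ : ℕ) (g : ℕ → ℂ) (j m : ℕ) : heckeSum κ g j m = heckeSum κ g m j := by
  simp only [heckeSum, Nat.gcd_comm j m, mul_comm j m]

lemma heckeSum_zero (κ : ℕ) (g : ℕ → ℂ) (j : ℕ) :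
    heckeSum κ g j 0 = (∑ d ∈ j.divisors, (d : ℂ) ^ κ) * g 0 := by
  simp [heckeSum, Finset.sum_mul]

lemma sum_divisors_mul_prime {l : ℕ} (hl : l.Prime) {j : ℕ} (hj : j ≠ 0) (h : ℕ → ℂ) :
    ∑ e ∈ (j * l).divisors, h e =
      ∑ d ∈ j.divisors, (h d + if l ∣ j / d then 0 else h (d * l)) := by
  have hl0 := hl.ne_zero
  have hfil : (∑ d ∈ j.divisors, if l ∣ j / d then 0 else h (d * l)) =
      ∑ d ∈ j.divisors with ¬ l ∣ j / d, h (d * l) := by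
    rw [Finset.sum_filter]; simp only [ite_not]
  rw [Finset.sum_add_distrib, hfil,
    ← Finset.sum_filter_add_sum_filter_not (j * l).divisors (· ∣ j)]
  congr 1
  · refine Finset.sum_congr ?_ fun _ _ => rfl
    ext e
    simp only [Finset.mem_filter, Nat.mem_divisors]
    exact ⟨fun h => ⟨h.2, hj⟩, fun h => ⟨⟨h.1.mul_right _, mul_ne_zero hj hl0⟩, h.1⟩⟩
  · symm
    refine Finset.sum_nbij' (fun d => d * l) (fun e => e / l) ?_ ?_ ?_ ?_ ?_
    · intro d hd
      obtain ⟨hd1, hd2⟩ := Finset.mem_filter.1 hd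
      have hd3 := Nat.dvd_of_mem_divisors hd1
      refine Finset.mem_filter.2 ⟨Nat.mem_divisors.2 ⟨mul_dvd_mul_right hd3 l, mul_ne_zero hj hl0⟩,
        fun h => hd2 ?_⟩
      exact (Nat.dvd_div_iff_mul_dvd hd3).2 h
    · intro e he
      obtain ⟨he1, he2⟩ := Finset.mem_filter.1 he
      have he3 := Nat.dvd_of_mem_divisors he1
      have hle : l ∣ e := by
        by_contra hc
        exact he2 (((hl.coprime_iff_not_dvd).2 hc).symm.dvd_of_dvd_mul_right he3)
      obtain ⟨d, rfl⟩ := hle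
      rw [Nat.mul_div_cancel_left _ hl.pos]
      have hd : d ∣ j := by
        rw [mul_comm] at he3; exact Nat.dvd_of_mul_dvd_mul_right hl.pos he3
      refine Finset.mem_filter.2 ⟨Nat.mem_divisors.2 ⟨hd, hj⟩, fun h => he2 ?_⟩
      rw [mul_comm]
      exact (Nat.dvd_div_iff_mul_dvd hd).1 h
    · intro d _; exact Nat.mul_div_cancel _ hl.pos
    · intro e he
      obtain ⟨he1, he2⟩ := Finset.mem_filter.1 he
      have he3 := Nat.dvd_of_mem_divisors he1
      refine Nat.div_mul_cancel ?_
      by_contra hc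
      exact he2 (((hl.coprime_iff_not_dvd).2 hc).symm.dvd_of_dvd_mul_right he3)
    · intro d _; rfl

/-- Twisting the relations of the plain operators by the character `χ`. -/
lemma twisted_rel {κ p : ℕ} {χ : ℕ → ℂ} (hχ : ∀ d l : ℕ, d ≠ 0 → l.Prime → χ (d * l) = χ d * χ l)
    {f : ℕ → ℕ → ℂ} {l : ℕ} (hl : l.Prime)
    (hf : ∀ i, i ≠ 0 → ∀ m, f i (m * l) + (if l ∣ m then (l : ℂ) ^ κ * f i (m / l) else 0) =
      f (i * l) m + (if l ∣ i then 0 else χ l * (l : ℂ) ^ p * f i m) +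
        (if l ∣ i then (l : ℂ) ^ κ * f (i / l) m else 0))
    {B : ℕ → ℕ → ℂ} (hB : ∀ j m, B j m = ∑ d ∈ j.divisors, χ d * (d : ℂ) ^ p * f (j / d) m)
    {j : ℕ} (hj : j ≠ 0) (m : ℕ) :
    B (j * l) m + (if l ∣ j then (l : ℂ) ^ κ * B (j / l) m else 0) =
      B j (m * l) + (if l ∣ m then (l : ℂ) ^ κ * B j (m / l) else 0) := by
  have e1 : B (j * l) m = ∑ d ∈ j.divisors, χ d * (d : ℂ) ^ p *
      (f (j / d * l) m + (if l ∣ j / d then 0 else χ l * (l : ℂ) ^ p * f (j / d) m)) := by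
    rw [hB, sum_divisors_mul_prime hl hj]
    refine Finset.sum_congr rfl fun d hd => ?_
    have hdj := Nat.dvd_of_mem_divisors hd
    have hd0 : d ≠ 0 := by rintro rfl; exact hj (zero_dvd_iff.1 hdj)
    rw [Nat.div_mul_right_comm hdj, Nat.mul_div_mul_right _ _ hl.pos, hχ d l hd0 hl]
    split_ifs <;> push_cast <;> ring
  have e2 : (if l ∣ j then (l : ℂ) ^ κ * B (j / l) m else 0) = ∑ d ∈ j.divisors,
      χ d * (d : ℂ) ^ p * (if l ∣ j / d then (l : ℂ) ^ κ * f (j / d / l) m else 0) := by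
    simp only [mul_ite, mul_zero]
    rw [← Finset.sum_filter]
    split_ifs with hlj
    · rw [hB, Finset.mul_sum]
      refine Finset.sum_congr ?_ fun d _ => ?_
      · ext d
        simp only [Finset.mem_filter, Nat.mem_divisors]
        have : j / l ≠ 0 := (Nat.div_pos (Nat.le_of_dvd (Nat.pos_of_ne_zero hj) hlj) hl.pos).ne'
        constructor
        · rintro ⟨h, -⟩
          have h1 := (Nat.dvd_div_iff_mul_dvd hlj).1 h
          have h2 : d ∣ j := (dvd_mul_left _ _).trans h1
          exact ⟨⟨h2, hj⟩, (Nat.dvd_div_iff_mul_dvd h2).2 (by rwa [mul_comm])⟩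
        · rintro ⟨⟨h, -⟩, h1⟩
          refine ⟨(Nat.dvd_div_iff_mul_dvd hlj).2 ?_, this⟩
          rw [mul_comm]
          exact (Nat.dvd_div_iff_mul_dvd h).1 h1
      · rw [Nat.div_div_eq_div_mul, Nat.div_div_eq_div_mul, mul_comm l d]; ring
    · symm
      refine Finset.sum_eq_zero fun d hd => absurd ?_ hlj
      obtain ⟨hd1, hd2⟩ := Finset.mem_filter.1 hd
      exact hd2.trans (Nat.div_dvd_of_dvd (Nat.dvd_of_mem_divisors hd1))
  have e3 : (if l ∣ m then (l : ℂ) ^ κ * B j (m / l) else 0) = ∑ d ∈ j.divisors,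
      χ d * (d : ℂ) ^ p * (if l ∣ m then (l : ℂ) ^ κ * f (j / d) (m / l) else 0) := by
    split_ifs
    · rw [hB, Finset.mul_sum]
      exact Finset.sum_congr rfl fun _ _ => by ring
    · simp
  rw [e1, e2, e3, hB j (m * l), ← Finset.sum_add_distrib, ← Finset.sum_add_distrib]
  refine Finset.sum_congr rfl fun d hd => ?_
  have hdj := Nat.dvd_of_mem_divisors hd
  have : j / d ≠ 0 := (Nat.div_pos (Nat.le_of_dvd (Nat.pos_of_ne_zero hj) hdj)
    (Nat.pos_of_dvd_of_pos hdj (Nat.pos_of_ne_zero hj))).ne'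
  linear_combination -(χ d * (d : ℂ) ^ p) * hf (j / d) this m

lemma sum_integral_comp_div {H : ℝ → ℂ} (hH : Continuous H) {l : ℕ} (hl : l ≠ 0) :
    ∑ β ∈ Finset.range l, ∫ x in (0 : ℝ)..1, H ((x + β) / l) = l * ∫ x in (0 : ℝ)..1, H x := by
  have hlR : (l : ℝ) ≠ 0 := by exact_mod_cast hl
  have h1 : ∀ β : ℕ, ∫ x in (0 : ℝ)..1, H ((x + β) / l) =
      l * ∫ x in ((β : ℝ) / l)..(((β + 1 : ℕ) : ℝ) / l), H x := fun β => by
    have := intervalIntegral.integral_comp_div_add (a := 0) (b := 1) H hlR ((β : ℝ) / l)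
    simp only [add_div]
    rw [this, zero_div, zero_add, Complex.real_smul, Complex.ofReal_natCast]
    push_cast
    rw [add_div, add_comm ((β : ℝ) / l)]
  simp only [h1]
  rw [← Finset.mul_sum, intervalIntegral.sum_integral_adjacent_intervals
    (a := fun n : ℕ => (n : ℝ) / l) (fun k _ => hH.intervalIntegrable _ _)]
  simp [hlR]

lemma sum_fourierInt_comp_div {F : ℝ → ℂ} (hF : Continuous F) {l : ℕ} (hl : l ≠ 0) (m : ℕ) :
    ∑ β ∈ Finset.range l, fourierInt (fun x => F ((x + β) / l)) m = l * fourierInt F (m * l) := by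
  have hlC : (l : ℂ) ≠ 0 := by exact_mod_cast hl
  rw [fourierInt, ← sum_integral_comp_div (H := fun x => F x *
    Complex.exp (-2 * Real.pi * Complex.I * (m * l : ℕ) * x)) (by fun_prop) hl]
  refine Finset.sum_congr rfl fun β _ => ?_
  rw [fourierInt]
  congr 1; ext x; congr 1
  rw [Complex.exp_eq_exp_iff_exists_int]
  refine ⟨m * β, ?_⟩
  push_cast; field_simp; ring

lemma fourierInt_comp_mul {F : ℝ → ℂ} (hF : Continuous F) (hper : ∀ x, F (x + 1) = F x) {l : ℕ}
    (hl : l ≠ 0) (m : ℕ) :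
    fourierInt (fun x => F (l * x)) m = if l ∣ m then fourierInt F (m / l) else 0 := by
  have hlC : (l : ℂ) ≠ 0 := by exact_mod_cast hl
  have hlR : (l : ℝ) ≠ 0 := by exact_mod_cast hl
  have hper' : ∀ (n : ℕ) x, F (x + n) = F x := fun n => by
    induction n with
    | zero => simp
    | succ n ih => intro x; rw [Nat.cast_succ, ← add_assoc, hper, ih]
  set ζ : ℂ := Complex.exp (-2 * Real.pi * Complex.I * m / l) with hζ
  have h1 := sum_integral_comp_div (H := fun x => F (l * x) *
    Complex.exp (-2 * Real.pi * Complex.I * m * x)) (by fun_prop) hl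
  have h2 : ∀ β : ℕ, (∫ x in (0 : ℝ)..1, F (l * ((x + β) / l)) *
      Complex.exp (-2 * Real.pi * Complex.I * m * ((x + β) / l : ℝ))) =
      ζ ^ β * ∫ x in (0 : ℝ)..1, F x * Complex.exp (-2 * Real.pi * Complex.I * m / l * x) := by
    intro β
    rw [← intervalIntegral.integral_const_mul]
    congr 1; ext x
    rw [mul_div_cancel₀ _ hlR, hper', hζ, ← Complex.exp_nat_mul, mul_left_comm, ← Complex.exp_add]
    congr 2
    push_cast; field_simp; ring
  simp only [h2] at h1
  rw [← Finset.sum_mul] at h1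
  have h3 : fourierInt (fun x => F (l * x)) m = (∑ β ∈ Finset.range l, ζ ^ β) / l *
      ∫ x in (0 : ℝ)..1, F x * Complex.exp (-2 * Real.pi * Complex.I * m / l * x) := by
    rw [div_mul_eq_mul_div, h1, fourierInt, mul_div_cancel_left₀ _ hlC]
  rw [h3]
  split_ifs with hd
  · obtain ⟨n, rfl⟩ := hd
    have : ζ = 1 := by
      rw [hζ, Complex.exp_eq_one_iff]
      exact ⟨-n, by push_cast; field_simp⟩
    rw [this, Nat.mul_div_cancel_left _ (Nat.pos_of_ne_zero hl), fourierInt]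
    simp only [one_pow, Finset.sum_const, Finset.card_range, nsmul_eq_mul, mul_one, div_self hlC,
      one_mul]
    congr 1; ext x; congr 2
    push_cast; field_simp
  · have hne : ζ ≠ 1 := by
      rw [hζ, Ne, Complex.exp_eq_one_iff]
      rintro ⟨n, hn⟩
      have hpi : (2 * Real.pi * Complex.I : ℂ) ≠ 0 := Complex.two_pi_I_ne_zero
      have : (m : ℂ) = -n * l := by
        apply mul_left_cancel₀ hpi
        field_simp at hn
        linear_combination -(2 * Real.pi * Complex.I : ℂ) * hn
      have h' : (m : ℤ) = -n * l := by exact_mod_cast this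
      exact hd (Int.natCast_dvd_natCast.1 ⟨-n, by rw [h', mul_comm]⟩)
    have h1 : ζ ^ l = 1 := by
      rw [hζ, ← Complex.exp_nat_mul, Complex.exp_eq_one_iff]
      exact ⟨-m, by push_cast; field_simp⟩
    rw [geom_sum_eq hne, h1]; simp

/-- The conditions characterising fundamental discriminants (other than `1`). -/
def IsFundDisc (D : ℤ) : Prop :=
  (D % 4 = 0 ∨ D % 4 = 1) ∧ ¬ IsSquare D ∧
    ∀ l : ℕ, l.Prime → (l : ℤ) ^ 2 ∣ D → l = 2 ∧ (D / 4 % 4 = 2 ∨ D / 4 % 4 = 3)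

lemma sq_mod_eight {n : ℤ} (hn : Odd n) : n ^ 2 % 8 = 1 := by
  have := Int.eight_dvd_sq_sub_one_of_odd hn
  omega

lemma kron_mul (D : ℤ) {a b : ℕ} (ha : a ≠ 0) (hb : b ≠ 0) :
    kron D (a * b) = kron D a * kron D b := by
  have h1 : NeZero (a / 2 ^ a.factorization 2) := ⟨(Nat.ordCompl_pos 2 ha).ne'⟩
  have h2 : NeZero (b / 2 ^ b.factorization 2) := ⟨(Nat.ordCompl_pos 2 hb).ne'⟩
  rw [kron, kron, kron, Nat.ordCompl_mul, jacobiSym.mul_right, Nat.factorization_mul ha hb]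
  simp only [Finsupp.coe_add, Pi.add_apply, pow_add]
  ring

lemma kron_one (D : ℤ) : kron D 1 = 1 := by simp [kron]

lemma kron_sq_mul (D : ℤ) {l : ℕ} (hl : l.Prime) (i : ℕ) :
    kron ((i : ℤ) ^ 2 * D) l = if l ∣ i then 0 else kron D l := by
  by_cases h2 : l = 2
  · subst h2
    rw [kron_two, kron_two]
    by_cases hi : 2 ∣ i
    · obtain ⟨r, rfl⟩ := hi
      rw [if_pos, if_pos (dvd_mul_right _ _)]
      push_cast
      rw [show (2 * (r : ℤ)) ^ 2 * D = 2 * (2 * r ^ 2 * D) by ring]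
      omega
    · rw [if_neg hi]
      have hodd : (i : ℤ) ^ 2 % 8 = 1 := sq_mod_eight (by
        rw [Int.odd_coe_nat]; exact Nat.not_even_iff_odd.1 fun h => hi h.two_dvd)
      obtain ⟨q, hq⟩ : ∃ q, (i : ℤ) ^ 2 = 8 * q + 1 := ⟨(i : ℤ) ^ 2 / 8, by omega⟩
      have hN : (i : ℤ) ^ 2 * D = 8 * (q * D) + D := by rw [hq]; ring
      generalize q * D = s at hN
      rw [hN]
      have e1 : (8 * s + D) % 2 = D % 2 := by omega
      have e2 : (8 * s + D) % 8 = D % 8 := by omega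
      rw [e1, e2]
  · rw [kron_odd_prime _ hl h2, kron_odd_prime _ hl h2, jacobiSym.mul_left, jacobiSym.pow_left]
    have : Fact l.Prime := ⟨hl⟩
    rw [← jacobiSym.legendreSym.to_jacobiSym]
    split_ifs with hi
    · have : legendreSym l (i : ℤ) = 0 := by
        rw [legendreSym.eq_zero_iff]; push_cast
        exact (ZMod.natCast_eq_zero_iff _ _).2 hi
      rw [this]; simp
    · rw [legendreSym.sq_one, one_mul]
      push_cast
      rwa [Ne, ZMod.natCast_eq_zero_iff]

lemma qsum_eq_zero {Δ : ℤ} (h : Δ % 4 = 2 ∨ Δ % 4 = 3) (p : ℕ) (x : ℝ) : qsum Δ p x = 0 := by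
  have : ∀ t, qterm Δ p x t = 0 := fun t => by
    refine if_neg fun ht => ?_
    have h1 := ht.2
    rw [qdisc, mul_assoc] at h1
    rcases Int.even_or_odd' t.2.1 with ⟨c, hc | hc⟩
    · rw [hc, show (2 * c) ^ 2 = 4 * c ^ 2 by ring] at h1; omega
    · rw [hc, show (2 * c + 1) ^ 2 = 4 * (c ^ 2 + c) + 1 by ring] at h1; omega
  rw [qsum]; simp [this]

lemma continuous_qsum_ofReal {Δ : ℤ} (hΔ : ¬ IsSquare Δ) {p : ℕ} (hp : 1 ≤ p) :
    Continuous fun x => (qsum Δ p x : ℂ) :=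
  Complex.continuous_ofReal.comp (continuous_qsum hΔ hp)

lemma intervalIntegrable_fourier {F : ℝ → ℂ} (hF : Continuous F) (m : ℕ) :
    IntervalIntegrable (fun x : ℝ => F x * Complex.exp (-2 * Real.pi * Complex.I * m * x))
      MeasureTheory.volume 0 1 :=
  Continuous.intervalIntegrable (by fun_prop) _ _

lemma fourierInt_add {F G : ℝ → ℂ} (hF : Continuous F) (hG : Continuous G) (m : ℕ) :
    fourierInt (fun x => F x + G x) m = fourierInt F m + fourierInt G m := by
  simp only [fourierInt, add_mul]
  exact intervalIntegral.integral_add (intervalIntegrable_fourier hF m) (intervalIntegrable_fourier hG m)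

lemma fourierInt_const_mul (c : ℂ) (F : ℝ → ℂ) (m : ℕ) :
    fourierInt (fun x => c * F x) m = c * fourierInt F m := by
  simp only [fourierInt, mul_assoc c]
  exact intervalIntegral.integral_const_mul _ _

lemma fourierInt_sum {ι : Type*} (s : Finset ι) {F : ι → ℝ → ℂ} (hF : ∀ i ∈ s, Continuous (F i)) (m : ℕ) :
    fourierInt (fun x => ∑ i ∈ s, F i x) m = ∑ i ∈ s, fourierInt (F i) m := by
  simp only [fourierInt, Finset.sum_mul]
  exact intervalIntegral.integral_finsetSum fun i hi => intervalIntegrable_fourier (hF i hi) m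

lemma not_isSquare_sq_mul {D : ℤ} (hD : ¬ IsSquare D) {i : ℤ} (hi : i ≠ 0) : ¬ IsSquare (i ^ 2 * D) := by
  rintro ⟨r, hr⟩
  obtain ⟨q, rfl⟩ : i ∣ r := by
    rw [← Int.pow_dvd_pow_iff two_ne_zero, pow_two r, ← hr]; exact dvd_mul_right _ _
  exact hD ⟨q, mul_left_cancel₀ (pow_ne_zero 2 hi) (by linear_combination hr)⟩

lemma sq_mul_mod_four {D : ℤ} (hD : D % 4 = 0 ∨ D % 4 = 1) (i : ℤ) :
    (i ^ 2 * D) % 4 = 0 ∨ (i ^ 2 * D) % 4 = 1 := by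
  rcases Int.even_or_odd' i with ⟨c, rfl | rfl⟩
  · left; rw [show (2 * c) ^ 2 * D = 4 * (c ^ 2 * D) by ring]; omega
  · rw [show (2 * c + 1) ^ 2 * D = 4 * ((c ^ 2 + c) * D) + D by ring]; omega

/-- The (normalised) Fourier coefficients of Zagier's function of discriminant `l² D`. -/
def fcoef (D : ℤ) (p l m : ℕ) : ℂ :=
  (if m = 0 then 1 else (m : ℂ) ^ (2 * p + 1)) * fourierInt (fun x => (qsum ((l : ℤ) ^ 2 * D) p x : ℂ)) m

lemma qsum_hecke_of_fundDisc {D : ℤ} (hD : IsFundDisc D) {l : ℕ} (hl : l.Prime) {p : ℕ} (hp : 1 ≤ p)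
    {i : ℕ} (hi : i ≠ 0) (x : ℝ) :
    qsum ((i : ℤ) ^ 2 * D) p (l * x) +
      (l : ℝ) ^ (2 * p) * ∑ β ∈ Finset.range l, qsum ((i : ℤ) ^ 2 * D) p ((x + β) / l) =
      qsum (((i * l : ℕ) : ℤ) ^ 2 * D) p x +
        (if l ∣ i then 0 else kron D l * (l : ℝ) ^ p) * qsum ((i : ℤ) ^ 2 * D) p x +
        (if l ∣ i then (l : ℝ) ^ (2 * p + 1) else 0) * qsum (((i / l : ℕ) : ℤ) ^ 2 * D) p x := by
  have hi' : (i : ℤ) ≠ 0 := by exact_mod_cast hi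
  have hl0 : (l : ℤ) ≠ 0 := by exact_mod_cast hl.ne_zero
  rw [qsum_hecke (not_isSquare_sq_mul hD.2.1 hi') (sq_mul_mod_four hD.1 i) hl hp, kron_sq_mul D hl]
  congr 1
  · congr 1
    · push_cast; congr 1; ring
    · split_ifs <;> push_cast <;> ring
  · by_cases hli : l ∣ i
    · obtain ⟨j, rfl⟩ := hli
      rw [if_pos (dvd_mul_right _ _), if_pos, Nat.mul_div_cancel_left _ hl.pos]
      · congr 2
        rw [Int.ediv_eq_iff_eq_mul_left (pow_ne_zero 2 hl0)]
        · push_cast; ring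
        · exact ⟨(j : ℤ) ^ 2 * D, by push_cast; ring⟩
      · exact ⟨(j : ℤ) ^ 2 * D, by push_cast; ring⟩
    · rw [if_neg hli, zero_mul]
      split_ifs with hd
      · have hcop : IsCoprime ((l : ℤ) ^ 2) ((i : ℤ) ^ 2) :=
          (Nat.isCoprime_iff_coprime.2 ((hl.coprime_iff_not_dvd).2 hli)).pow
        have hdD := hcop.dvd_of_dvd_mul_left hd
        obtain ⟨rfl, h4⟩ := hD.2.2 l hl hdD
        rw [qsum_eq_zero, mul_zero]
        obtain ⟨E, rfl⟩ := hdD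
        push_cast at h4 ⊢
        rw [Int.mul_ediv_cancel_left _ (by norm_num)] at h4
        rw [show (i : ℤ) ^ 2 * (4 * E) = 4 * (i ^ 2 * E) by ring,
          Int.mul_ediv_cancel_left _ (by norm_num)]
        have hodd : (i : ℤ) ^ 2 % 8 = 1 := sq_mod_eight (by
          rw [Int.odd_coe_nat]; exact Nat.not_even_iff_odd.1 fun h => hli h.two_dvd)
        obtain ⟨q, hq⟩ : ∃ q, (i : ℤ) ^ 2 = 4 * q + 1 := ⟨(i : ℤ) ^ 2 / 4, by omega⟩
        have hN : (i : ℤ) ^ 2 * E = 4 * (q * E) + E := by rw [hq]; ring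
        rw [hN]; omega
      · simp

lemma fcoef_rel {D : ℤ} (hD : IsFundDisc D) {l : ℕ} (hl : l.Prime) {p : ℕ} (hp : 1 ≤ p)
    {i : ℕ} (hi : i ≠ 0) (m : ℕ) :
    fcoef D p i (m * l) + (if l ∣ m then (l : ℂ) ^ (2 * p + 1) * fcoef D p i (m / l) else 0) =
      fcoef D p (i * l) m + (if l ∣ i then 0 else (kron D l : ℂ) * (l : ℂ) ^ p * fcoef D p i m) +
        (if l ∣ i then (l : ℂ) ^ (2 * p + 1) * fcoef D p (i / l) m else 0) := by
  have hl0 := hl.ne_zero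
  have hlC : (l : ℂ) ≠ 0 := by exact_mod_cast hl0
  have cont : ∀ j : ℕ, j ≠ 0 → Continuous fun x => (qsum ((j : ℤ) ^ 2 * D) p x : ℂ) := fun j hj =>
    continuous_qsum_ofReal (not_isSquare_sq_mul hD.2.1 (by exact_mod_cast hj)) hp
  set F : ℕ → ℝ → ℂ := fun j x => (qsum ((j : ℤ) ^ 2 * D) p x : ℂ) with hF
  have per : ∀ x, F i (x + 1) = F i x := fun x => by simp only [hF, qsum_add_one]
  have hfun : (fun x => F i (l * x) + (l : ℂ) ^ (2 * p) * ∑ β ∈ Finset.range l, F i ((x + β) / l)) =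
      fun x => (F (i * l) x + ((if l ∣ i then 0 else (kron D l : ℂ) * (l : ℂ) ^ p) * F i x)) +
        (if l ∣ i then (l : ℂ) ^ (2 * p + 1) else 0) * F (i / l) x := by
    ext x
    have := congrArg (fun r : ℝ => (r : ℂ)) (qsum_hecke_of_fundDisc hD hl hp hi x)
    simp only [hF]
    push_cast at this ⊢
    convert! this using 3 <;> split_ifs <;> simp
  have hil : l ∣ i → i / l ≠ 0 := fun h =>
    (Nat.div_pos (Nat.le_of_dvd (Nat.pos_of_ne_zero hi) h) hl.pos).ne'
  have c1 := cont i hi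
  have hfou := congrArg (fun G => fourierInt G m) hfun
  rw [fourierInt_add (by fun_prop) (by fun_prop), fourierInt_const_mul, fourierInt_sum _ (by fun_prop),
    sum_fourierInt_comp_div c1 hl0, fourierInt_comp_mul c1 per hl0] at hfou
  have c2 := cont (i * l) (mul_ne_zero hi hl0)
  have hR : fourierInt (fun x => (F (i * l) x + ((if l ∣ i then 0 else (kron D l : ℂ) * (l : ℂ) ^ p) * F i x)) +
        (if l ∣ i then (l : ℂ) ^ (2 * p + 1) else 0) * F (i / l) x) m =
      fourierInt (F (i * l)) m + (if l ∣ i then 0 else (kron D l : ℂ) * (l : ℂ) ^ p) * fourierInt (F i) m +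
        (if l ∣ i then (l : ℂ) ^ (2 * p + 1) else 0) * fourierInt (F (i / l)) m := by
    by_cases hli : l ∣ i
    · have c3 := cont (i / l) (hil hli)
      rw [fourierInt_add (by fun_prop) (by fun_prop), fourierInt_add (by fun_prop) (by fun_prop),
        fourierInt_const_mul, fourierInt_const_mul]
    · simp only [if_neg hli, zero_mul, add_zero]
      rw [fourierInt_add (by fun_prop) (by fun_prop), fourierInt_const_mul]
  rw [hR] at hfou
  have hfc : ∀ j n, fcoef D p j n = (if n = 0 then 1 else (n : ℂ) ^ (2 * p + 1)) * fourierInt (F j) n :=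
    fun _ _ => rfl
  simp only [hfc]
  by_cases hm : m = 0
  · subst hm
    simp only [zero_mul, Nat.zero_div, dvd_zero, if_true, one_mul] at hfou ⊢
    split_ifs at hfou ⊢ <;> linear_combination hfou
  · have hml : m * l ≠ 0 := mul_ne_zero hm hl0
    simp only [if_neg hm, if_neg hml]
    by_cases hlm : l ∣ m
    · obtain ⟨n, rfl⟩ := hlm
      have hn : n ≠ 0 := right_ne_zero_of_mul hm
      rw [if_pos (dvd_mul_right _ _)] at hfou
      rw [if_pos (dvd_mul_right _ _)]
      rw [Nat.mul_div_cancel_left _ hl.pos, if_neg hn] at *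
      push_cast
      split_ifs at hfou ⊢ <;> linear_combination ((l : ℂ) * n) ^ (2 * p + 1) * hfou
    · rw [if_neg hlm] at hfou ⊢
      push_cast
      split_ifs at hfou ⊢ <;> linear_combination (m : ℂ) ^ (2 * p + 1) * hfou

lemma eq_fourierInt_zero_of_even {F : ℝ → ℂ} (hF : Continuous F) (hper : ∀ x, F (x + 1) = F x)
    (heven : ∀ x, F (-x) = F x) (h : ∀ m : ℕ, m ≠ 0 → fourierInt F m = 0) (x : ℝ) :
    F x = fourierInt F 0 := by
  have hp : Function.Periodic F (1 : ℝ) := hper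
  set f : C(AddCircle (1 : ℝ), ℂ) := ⟨hp.lift, continuous_coinduced_dom.2 hF⟩ with hf
  have hfx : ∀ y : ℝ, f (y : AddCircle (1 : ℝ)) = F y := fun y => rfl
  have hpos : ∀ m : ℕ, fourierCoeff f (m : ℤ) = fourierInt F m := by
    intro m
    rw [fourierCoeff_eq_intervalIntegral f _ 0, fourierInt]
    simp only [zero_add, div_one, one_smul]
    refine intervalIntegral.integral_congr fun y _ => ?_
    simp only [fourier_coe_apply, hfx, smul_eq_mul]
    rw [mul_comm]
    congr 2
    push_cast
    ring
  have hneg : ∀ m : ℕ, fourierCoeff f (-(m : ℤ)) = fourierInt F m := by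
    intro m
    rw [fourierCoeff_eq_intervalIntegral f _ 0, fourierInt]
    simp only [zero_add, div_one, one_smul]
    have hsub := intervalIntegral.integral_comp_sub_left (a := 0) (b := 1)
      (fun y : ℝ => fourier (- -(m : ℤ)) (y : AddCircle (1 : ℝ)) • f y) 1
    rw [sub_self, sub_zero] at hsub
    rw [← hsub]
    refine intervalIntegral.integral_congr fun y _ => ?_
    simp only [fourier_coe_apply, hfx, smul_eq_mul]
    rw [mul_comm, show F (1 - y) = F y by rw [← heven y, ← hper (-y)]; ring_nf]
    congr 1
    rw [Complex.exp_eq_exp_iff_exists_int]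
    exact ⟨m, by push_cast; ring⟩
  have hz : ∀ n : ℤ, n ≠ 0 → fourierCoeff f n = 0 := by
    intro n hn
    obtain ⟨m, rfl | rfl⟩ := n.eq_nat_or_neg
    · rw [hpos, h m (by simpa using hn)]
    · rw [hneg, h m (by simpa using hn)]
  have hs : Summable (fourierCoeff f) := summable_of_ne_finset_zero (s := {0}) fun n hn =>
    hz n (by simpa using hn)
  have h1 := has_pointwise_sum_fourier_series_of_summable hs (x : AddCircle (1 : ℝ))
  have h2 := hasSum_single (f := fun i : ℤ => fourierCoeff f i • fourier i (x : AddCircle (1 : ℝ))) 0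
    fun n hn => by simp [hz n hn]
  have h3 := h1.unique h2
  rw [hfx] at h3
  rw [h3, ← hpos 0]
  simp

/-- The twisted combination of Zagier's functions of discriminants `(j / d)² D`. -/
def zsum (D : ℤ) (p j : ℕ) (x : ℝ) : ℂ :=
  ∑ d ∈ j.divisors, (kron D d : ℂ) * (d : ℂ) ^ p * (qsum (((j / d : ℕ) : ℤ) ^ 2 * D) p x : ℂ)

section zsum

variable {D : ℤ} (hD : IsFundDisc D) {p : ℕ}

lemma zsum_zero (D : ℤ) (hp : p ≠ 0) (j : ℕ) :
    zsum D p j 0 = ∑ d ∈ j.divisors,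
      (kron D d : ℂ) * (d : ℂ) ^ p * (eSum p (((j / d : ℕ) : ℤ) ^ 2 * D) : ℂ) :=
  Finset.sum_congr rfl fun d _ => by rw [qsum_zero _ hp]; push_cast; rfl

lemma zsum_add_one (D : ℤ) (p j : ℕ) (x : ℝ) : zsum D p j (x + 1) = zsum D p j x := by
  simp only [zsum, qsum_add_one]

lemma zsum_neg (D : ℤ) (p j : ℕ) (x : ℝ) : zsum D p j (-x) = zsum D p j x := by
  simp only [zsum, qsum_neg]

lemma not_isSquare_div_sq_mul (hD : IsFundDisc D) {j d : ℕ} (hd : d ∈ j.divisors) :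
    ¬ IsSquare (((j / d : ℕ) : ℤ) ^ 2 * D) := by
  obtain ⟨h1, h2⟩ := Nat.mem_divisors.1 hd
  refine not_isSquare_sq_mul hD.2.1 ?_
  have := Nat.div_pos (Nat.le_of_dvd (Nat.pos_of_ne_zero h2) h1) (Nat.pos_of_dvd_of_pos h1 (Nat.pos_of_ne_zero h2))
  exact_mod_cast this.ne'

lemma continuous_zsum (hD : IsFundDisc D) (hp : 1 ≤ p) (j : ℕ) : Continuous (zsum D p j) :=
  continuous_finsetSum _ fun _ hd =>
    continuous_const.mul (continuous_qsum_ofReal (not_isSquare_div_sq_mul hD hd) hp)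

lemma exists_norm_zsum_le (hD : IsFundDisc D) (hp : 1 ≤ p) (j : ℕ) :
    ∃ C, ∀ x, ‖zsum D p j x‖ ≤ C := by
  refine ⟨∑ d ∈ j.divisors, ‖(kron D d : ℂ) * (d : ℂ) ^ p‖ *
    (|(((((j / d : ℕ) : ℤ) ^ 2 * D : ℤ)) : ℝ)| ^ (p - 1) *
      qpoly (((j / d : ℕ) : ℤ) ^ 2 * D) 1 0), fun x => (norm_sum_le _ _).trans ?_⟩
  refine Finset.sum_le_sum fun d hd => ?_
  rw [norm_mul]
  refine mul_le_mul_of_nonneg_left ?_ (norm_nonneg _)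
  rw [Complex.norm_real, Real.norm_of_nonneg (qsum_nonneg _ _ _)]
  exact qsum_le (not_isSquare_div_sq_mul hD hd) hp x

open Polynomial in
lemma exists_zsum_inv (hD : IsFundDisc D) (hp : Odd p) (j : ℕ) :
    ∃ P : ℂ[X], P.natDegree ≤ 2 * p ∧ ∀ x : ℝ, x ≠ 0 →
      zsum D p j x = (x : ℂ) ^ (2 * p) * zsum D p j (-1 / x) + P.eval (x : ℂ) := by
  refine ⟨∑ d ∈ j.divisors, C ((kron D d : ℂ) * (d : ℂ) ^ p) *
    ∑ t ∈ qset (((j / d : ℕ) : ℤ) ^ 2 * D),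
      (C (t.1 : ℂ) * X ^ 2 + C (t.2.1 : ℂ) * X + C (t.2.2 : ℂ)) ^ p, ?_, fun x hx => ?_⟩
  · refine natDegree_sum_le_of_forall_le _ _ fun d _ => (natDegree_C_mul_le _ _).trans ?_
    refine natDegree_sum_le_of_forall_le _ _ fun t _ => natDegree_pow_le.trans ?_
    rw [mul_comm]
    exact Nat.mul_le_mul_right _ natDegree_quadratic_le
  · simp only [zsum, eval_finsetSum, eval_mul, eval_pow, eval_add, eval_C, eval_X, Finset.mul_sum,
      ← Finset.sum_add_distrib]
    refine Finset.sum_congr rfl fun d hd => ?_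
    rw [qsum_inv (not_isSquare_div_sq_mul hD hd) hp hx]
    simp only [qpoly, qval]
    push_cast
    rw [← Finset.mul_sum]
    ring

lemma sum_fcoef_eq (hD : IsFundDisc D) (hp : 1 ≤ p) (j m : ℕ) :
    ∑ d ∈ j.divisors, (kron D d : ℂ) * (d : ℂ) ^ p * fcoef D p (j / d) m =
      (if m = 0 then 1 else (m : ℂ) ^ (2 * p + 1)) * fourierInt (zsum D p j) m := by
  have h : fourierInt (zsum D p j) m = ∑ d ∈ j.divisors, (kron D d : ℂ) * (d : ℂ) ^ p *
      fourierInt (fun x => (qsum (((j / d : ℕ) : ℤ) ^ 2 * D) p x : ℂ)) m := by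
    simp only [← fourierInt_const_mul]
    exact fourierInt_sum _ (fun d hd =>
      continuous_const.mul (continuous_qsum_ofReal (not_isSquare_div_sq_mul hD hd) hp)) m
  rw [h, Finset.mul_sum]
  refine Finset.sum_congr rfl fun d _ => ?_
  rw [fcoef]
  ring

lemma fourierInt_zsum (hD : IsFundDisc D) (hp : 1 ≤ p) {j : ℕ} (hj : j ≠ 0) (m : ℕ) :
    (if m = 0 then 1 else (m : ℂ) ^ (2 * p + 1)) * fourierInt (zsum D p j) m =
      heckeSum (2 * p + 1) (fcoef D p 1) j m := by
  set B : ℕ → ℕ → ℂ := fun j m =>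
    ∑ d ∈ j.divisors, (kron D d : ℂ) * (d : ℂ) ^ p * fcoef D p (j / d) m with hB
  have h1 : B 1 = fcoef D p 1 := by
    ext m
    simp [hB, kron_one]
  rw [← sum_fcoef_eq hD hp, ← h1]
  refine eq_heckeSum (B := B) (fun l hl j hj m => ?_) hj m
  refine twisted_rel (κ := 2 * p + 1) (p := p) (χ := fun d => (kron D d : ℂ)) (f := fcoef D p) ?_ hl
    (fun i hi m => fcoef_rel hD hl hp hi m) (fun j m => rfl) hj m
  intro d l hd hl
  rw [kron_mul D hd hl.ne_zero]
  push_cast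
  rfl

end zsum

open UpperHalfPlane in
open scoped MatrixGroups ModularForm Manifold in
lemma sum_cCoeff_fourierInt_zsum {D : ℤ} (hD : IsFundDisc D) {k : ℕ} (hk : 1 ≤ k) {m : ℕ}
    (hm : m ≠ 0) :
    ∑ j ∈ Finset.Icc 1 (k / 3 + 1), (cCoeff (4 * k) j : ℂ) *
      fourierInt (zsum D (2 * k - 1) j) m = 0 := by
  have hp : Odd (2 * k - 1) := ⟨k - 1, by omega⟩
  have hp1 : 1 ≤ 2 * k - 1 := by omega
  obtain ⟨C, hC⟩ := exists_norm_zsum_le hD hp1 m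
  obtain ⟨P, hP, hPx⟩ := exists_zsum_inv hD hp m
  obtain ⟨g, hg⟩ := exists_modularForm_fourierInt (continuous_zsum hD hp1 m) hC
    (zsum_add_one D _ m) (h := 4 * k) P (by omega)
    (fun x hx => by rw [show 4 * k - 2 = 2 * (2 * k - 1) by omega]; exact hPx x hx)
  have h := siegel_relation k g
  rw [Finset.sum_range_eq_add_Ico _ (by omega), hg 0] at h
  rw [show Finset.Icc 1 (k / 3 + 1) = Finset.Ico 1 (k / 3 + 2) by ext; simp; omega]
  have hmC : ((m : ℂ) ^ (2 * (2 * k - 1) + 1)) ≠ 0 := pow_ne_zero _ (by exact_mod_cast hm)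
  refine (mul_eq_zero.1 ?_).resolve_left hmC
  rw [Finset.mul_sum, ← h, Nat.cast_zero, zero_pow (by omega), zero_mul, mul_zero, zero_add]
  refine Finset.sum_congr rfl fun j hj => ?_
  have hj0 : j ≠ 0 := by have := (Finset.mem_Ico.1 hj).1; omega
  have e1 := fourierInt_zsum hD hp1 hj0 m
  have e2 := fourierInt_zsum hD hp1 hm j
  rw [if_neg hm] at e1
  rw [if_neg hj0] at e2
  rw [mul_left_comm, e1, hg, show 4 * k - 1 = 2 * (2 * k - 1) + 1 by omega, e2, heckeSum_comm]

open UpperHalfPlane in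
open scoped MatrixGroups ModularForm Manifold in
lemma cCoeff_zero_eq {k : ℕ} (hk : 1 ≤ k) :
    (cCoeff (4 * k) 0 : ℂ) * (bernoulli (4 * k) : ℂ) = 2 * (4 * k : ℂ) *
      ∑ j ∈ Finset.Icc 1 (k / 3 + 1), (cCoeff (4 * k) j : ℂ) *
        ∑ d ∈ j.divisors, (d : ℂ) ^ (4 * k - 1) := by
  have hb : (bernoulli (4 * k) : ℂ) ≠ 0 := by
    intro hb
    have h1 := riemannZeta_two_mul_nat (k := 2 * k) (by omega)
    rw [show 2 * (2 * k) = 4 * k by ring] at h1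
    rw [show (bernoulli (4 * k) : ℂ) = 0 from hb, mul_zero, zero_div] at h1
    exact riemannZeta_ne_zero_of_one_le_re (by simp; norm_cast; omega) h1
  have h := siegel_relation k (ModularForm.E (show 3 ≤ 4 * k by omega))
  rw [qExpansion_E _ ⟨2 * k, by ring⟩, Finset.sum_range_eq_add_Ico _ (by omega)] at h
  rw [show Finset.Icc 1 (k / 3 + 1) = Finset.Ico 1 (k / 3 + 2) by ext; simp; omega]
  simp only [PowerSeries.coeff_map, Gser, PowerSeries.coeff_mk] at h
  rw [if_true, map_one, mul_one] at h
  have h2 : (cCoeff (4 * k) 0 : ℂ) = ∑ j ∈ Finset.Ico 1 (k / 3 + 2),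
      (2 * (4 * k : ℂ) / (bernoulli (4 * k) : ℂ)) *
        ((cCoeff (4 * k) j : ℂ) * ∑ d ∈ j.divisors, (d : ℂ) ^ (4 * k - 1)) := by
    rw [eq_neg_of_add_eq_zero_left h, ← Finset.sum_neg_distrib]
    refine Finset.sum_congr rfl fun j hj => ?_
    have hj0 : j ≠ 0 := by have := (Finset.mem_Ico.1 hj).1; omega
    rw [if_neg hj0]
    simp
    ring
  rw [h2, ← Finset.mul_sum]
  field_simp

/-- The finite sum in Zagier's formula as the mean value of Zagier's function. -/
theorem sum_bSiegel_eq {D : ℤ} (hD : IsFundDisc D) {k : ℕ} (hk : 1 ≤ k) :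
    2 * (4 * k : ℂ) * ∑ j ∈ Finset.Icc 1 (k / 3 + 1), (bSiegel j (4 * k) : ℂ) *
      ∑ d ∈ j.divisors, (kron D d : ℂ) * (d : ℂ) ^ (2 * k - 1) *
        (eSum (2 * k - 1) (((j / d : ℕ) : ℤ) ^ 2 * D) : ℂ) =
    -(bernoulli (4 * k) : ℂ) * ∫ x in (0 : ℝ)..1, (qsum D (2 * k - 1) x : ℂ) := by
  have hp1 : 1 ≤ 2 * k - 1 := by omega
  set p := 2 * k - 1 with hp
  set s := Finset.Icc 1 (k / 3 + 1) with hs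
  have hcont : ∀ j ∈ s, Continuous fun x => (cCoeff (4 * k) j : ℂ) * zsum D p j x :=
    fun j _ => continuous_const.mul (continuous_zsum hD hp1 j)
  have h0 := eq_fourierInt_zero_of_even (F := fun x => ∑ j ∈ s, (cCoeff (4 * k) j : ℂ) * zsum D p j x)
    (continuous_finsetSum _ hcont) (by simp [zsum_add_one]) (by simp [zsum_neg])
    (fun m hm => by
      rw [fourierInt_sum _ hcont]
      simp only [fourierInt_const_mul]
      exact sum_cCoeff_fourierInt_zsum hD hk hm) 0
  rw [fourierInt_sum _ hcont] at h0
  simp only [fourierInt_const_mul, zsum_zero D (show p ≠ 0 by omega)] at h0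
  have hI : fcoef D p 1 0 = ∫ x in (0 : ℝ)..1, (qsum D p x : ℂ) := by
    simp [fcoef, fourierInt]
  rw [← hI]
  have h1 : ∀ j ∈ s, fourierInt (zsum D p j) 0 =
      (∑ d ∈ j.divisors, (d : ℂ) ^ (4 * k - 1)) * fcoef D p 1 0 := by
    intro j hj
    have hj0 : j ≠ 0 := by have := (Finset.mem_Icc.1 hj).1; omega
    have := fourierInt_zsum hD hp1 hj0 0
    rwa [if_pos rfl, one_mul, heckeSum_zero, show 2 * p + 1 = 4 * k - 1 by omega] at this
  have h2 : ∑ j ∈ s, (cCoeff (4 * k) j : ℂ) * fourierInt (zsum D p j) 0 =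
      (∑ j ∈ s, (cCoeff (4 * k) j : ℂ) * ∑ d ∈ j.divisors, (d : ℂ) ^ (4 * k - 1)) * fcoef D p 1 0 := by
    rw [Finset.sum_mul]
    exact Finset.sum_congr rfl fun j hj => by rw [h1 j hj, mul_assoc]
  rw [h2] at h0
  have hc0 : (cCoeff (4 * k) 0 : ℂ) ≠ 0 := by exact_mod_cast cCoeff_zero_ne_zero k hk
  have hc := cCoeff_zero_eq hk
  have h3 : ∀ a : ℕ → ℂ, ∑ j ∈ s, (bSiegel j (4 * k) : ℂ) * a j =
      -(∑ j ∈ s, (cCoeff (4 * k) j : ℂ) * a j) / (cCoeff (4 * k) 0 : ℂ) := by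
    intro a
    rw [← Finset.sum_neg_distrib, Finset.sum_div]
    refine Finset.sum_congr rfl fun j _ => ?_
    rw [bSiegel]
    push_cast
    ring
  rw [h3, h0, mul_div_assoc', div_eq_iff hc0]
  linear_combination (fcoef D p 1 0) * hc

/-- The number of square roots of `D` modulo `4A`, counted modulo `2A`. -/
def rootCount (D : ℤ) (A : ℕ) : ℕ :=
  ((Finset.range (2 * A)).filter fun b : ℕ => (4 * (A : ℤ)) ∣ D - (b : ℤ) ^ 2).card

/-- The truncated parabola. -/
def bump (p : ℕ) (u : ℝ) : ℝ := max 0 (1 - u ^ 2) ^ p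

lemma continuous_bump (p : ℕ) : Continuous (bump p) := by unfold bump; fun_prop

lemma bump_eq_zero {p : ℕ} (hp : p ≠ 0) {u : ℝ} (hu : 1 ≤ |u|) : bump p u = 0 := by
  have : 1 - u ^ 2 ≤ 0 := by nlinarith [sq_abs u]
  rw [bump, max_eq_left this, zero_pow hp]

lemma integrable_bump {p : ℕ} (hp : p ≠ 0) : MeasureTheory.Integrable (bump p) := by
  refine (continuous_bump p).integrable_of_hasCompactSupport ?_
  refine HasCompactSupport.intro (isCompact_Icc (a := (-1 : ℝ)) (b := 1)) fun u hu => ?_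
  refine bump_eq_zero hp ?_
  by_contra h
  exact hu ⟨by linarith [(abs_lt.1 (not_le.1 h)).1], by linarith [(abs_lt.1 (not_le.1 h)).2]⟩

open scoped Nat in
lemma prod_wallis (p : ℕ) : ∏ i ∈ Finset.range p, (2 * (i : ℝ) + 2) / (2 * i + 3) =
    4 ^ p * (p ! : ℝ) ^ 2 / ((2 * p + 1)! : ℝ) := by
  induction p with
  | zero => simp
  | succ n ih =>
    rw [Finset.prod_range_succ, ih, show 2 * (n + 1) + 1 = (2 * n + 1) + 1 + 1 by ring,
      Nat.factorial_succ (2 * n + 1 + 1), Nat.factorial_succ (2 * n + 1), Nat.factorial_succ n]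
    have : ((2 * n + 1)! : ℝ) ≠ 0 := by positivity
    push_cast
    field_simp
    ring

open scoped Nat in
lemma integral_bump {p : ℕ} (hp : p ≠ 0) :
    ∫ u, bump p u = 2 * 4 ^ p * (p ! : ℝ) ^ 2 / ((2 * p + 1)! : ℝ) := by
  have h1 : ∫ u, bump p u = ∫ u in (-1 : ℝ)..1, (1 - u ^ 2) ^ p := by
    rw [intervalIntegral.integral_of_le (by norm_num),
      ← MeasureTheory.setIntegral_eq_integral_of_forall_compl_eq_zero (s := Set.Ioc (-1 : ℝ) 1)]
    · refine MeasureTheory.setIntegral_congr_fun measurableSet_Ioc fun u hu => ?_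
      simp only [bump]
      rw [max_eq_right]
      nlinarith [hu.1, hu.2]
    · intro u hu
      refine bump_eq_zero hp ?_
      by_contra h
      exact hu ⟨(abs_lt.1 (not_le.1 h)).1, (abs_lt.1 (not_le.1 h)).2.le⟩
  have h2 := integral_sin_pow_odd_mul_cos_pow (a := 0) (b := Real.pi) p 0
  simp only [pow_zero, mul_one, one_mul, Real.cos_pi, Real.cos_zero] at h2
  rw [h1, ← h2, integral_sin_pow_odd, prod_wallis]
  ring

lemma hasSum_integral_qterm {Δ : ℤ} (hΔ : ¬ IsSquare Δ) {p : ℕ} (hp : 1 ≤ p) :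
    HasSum (fun t => ∫ x in (0 : ℝ)..1, qterm Δ p x t) (∫ x in (0 : ℝ)..1, qsum Δ p x) := by
  refine intervalIntegral.hasSum_integral_of_dominated_convergence (fun t x => qterm Δ p x t)
    (fun t => (continuous_qterm Δ p t).aestronglyMeasurable)
    (fun t => .of_forall fun x _ => (Real.norm_of_nonneg (qterm_nonneg _ _ _ _)).le)
    (.of_forall fun x _ => summable_qterm hΔ hp x)
    ((continuous_qsum hΔ hp).intervalIntegrable _ _)
    (.of_forall fun x _ => hasSum_qsum hΔ hp x)

section

variable {D : ℤ} {p : ℕ}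

lemma qval_eq_bump (hD : 0 < D) {A : ℕ} (hA : A ≠ 0) {b : ℤ} (h : (4 * (A : ℤ)) ∣ D - b ^ 2) (x : ℝ) :
    max 0 (qval (-(A : ℤ), b, (D - b ^ 2) / (4 * A)) x) ^ p =
      ((D : ℝ) / (4 * A)) ^ p * bump p (2 * A / √D * (x - b / (2 * A))) := by
  have hA' : (0 : ℝ) < A := by exact_mod_cast Nat.pos_of_ne_zero hA
  have hD' : (0 : ℝ) < D := by exact_mod_cast hD
  rw [bump, ← mul_pow, mul_max_of_nonneg _ _ (by positivity), mul_zero]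
  congr 2
  obtain ⟨c, hc⟩ := h
  have h4 : (4 * (A : ℤ)) ≠ 0 := by positivity
  rw [qval, hc, Int.mul_ediv_cancel_left _ h4]
  have hcR : (D : ℝ) - b ^ 2 = 4 * A * c := by exact_mod_cast hc
  have hs : √(D : ℝ) ^ 2 = D := Real.sq_sqrt hD'.le
  have hs0 : √(D : ℝ) ≠ 0 := (Real.sqrt_pos.2 hD').ne'
  push_cast
  rw [mul_pow, div_pow, hs]
  field_simp
  linear_combination -hcR

lemma hasSum_integral_bump (hp : p ≠ 0) (A : ℕ) (hA : A ≠ 0) (s : ℝ) (hs : s ≠ 0) :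
    HasSum (fun b : ℤ => if (4 * (A : ℤ)) ∣ D - b ^ 2 then
      ∫ x in (0 : ℝ)..1, bump p (s * (x - b / (2 * A))) else 0)
      (rootCount D A * (|s⁻¹| * ∫ u, bump p u)) := by
  have : NeZero (2 * A) := ⟨by omega⟩
  have hA' : (A : ℝ) ≠ 0 := by exact_mod_cast hA
  have hnn : ∀ b : ℤ, 0 ≤ if (4 * (A : ℤ)) ∣ D - b ^ 2 then
      ∫ x in (0 : ℝ)..1, bump p (s * (x - b / (2 * A))) else 0 := fun b => by
    split_ifs
    · exact intervalIntegral.integral_nonneg (by norm_num) fun x _ => by unfold bump; positivity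
    · exact le_rfl
  rw [← ((Equiv.prodComm _ _).trans (Int.divModEquiv (2 * A)).symm).hasSum_iff]
  have hfib : ∀ r : Fin (2 * A), HasSum (fun m : ℤ => if (4 * (A : ℤ)) ∣ D - ((r : ℕ) : ℤ) ^ 2 then
      ∫ x in (0 : ℝ)..1, bump p (s * (x - m - r / (2 * A))) else 0)
      (if (4 * (A : ℤ)) ∣ D - ((r : ℕ) : ℤ) ^ 2 then |s⁻¹| * ∫ u, bump p u else 0) := by
    intro r
    split_ifs
    · have h_int : MeasureTheory.Integrable fun x => bump p (s * (x - r / (2 * A))) :=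
        ((integrable_bump hp).comp_mul_left' hs).comp_sub_right _
      have := h_int.hasSum_intervalIntegral_comp_add_int
      rw [MeasureTheory.integral_sub_right_eq_self (fun x => bump p (s * x)),
        MeasureTheory.Measure.integral_comp_mul_left, smul_eq_mul] at this
      rw [← (Equiv.neg ℤ).hasSum_iff] at this
      refine (hasSum_iff_of_eq fun m => ?_).1 this
      simp only [Function.comp_apply, Equiv.neg_apply, Int.cast_neg, ← sub_eq_add_neg]
    · exact hasSum_zero
  set f := ((fun b : ℤ => if (4 * (A : ℤ)) ∣ D - b ^ 2 then
      ∫ x in (0 : ℝ)..1, bump p (s * (x - b / (2 * A))) else 0) ∘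
      ((Equiv.prodComm _ _).trans (Int.divModEquiv (2 * A)).symm)) with hf
  have hfeq : ∀ (r : Fin (2 * A)) (m : ℤ), f (r, m) = if (4 * (A : ℤ)) ∣ D - ((r : ℕ) : ℤ) ^ 2 then
      ∫ x in (0 : ℝ)..1, bump p (s * (x - m - r / (2 * A))) else 0 := by
    intro r m
    have e : ((Equiv.prodComm _ _).trans (Int.divModEquiv (2 * A)).symm) (r, m) =
        m * ((2 * A : ℕ) : ℤ) + ((r : ℕ) : ℤ) := rfl
    have hdvd : (4 * (A : ℤ)) ∣ D - (m * ((2 * A : ℕ) : ℤ) + ((r : ℕ) : ℤ)) ^ 2 ↔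
        (4 * (A : ℤ)) ∣ D - ((r : ℕ) : ℤ) ^ 2 := by
      rw [show D - (m * ((2 * A : ℕ) : ℤ) + ((r : ℕ) : ℤ)) ^ 2 = D - ((r : ℕ) : ℤ) ^ 2 -
        4 * A * (m ^ 2 * A + m * r) by push_cast; ring]
      exact dvd_sub_left (dvd_mul_right _ _)
    have hval : ∀ x : ℝ, x - ((m * ((2 * A : ℕ) : ℤ) + ((r : ℕ) : ℤ) : ℤ) : ℝ) / (2 * A) =
        x - m - (r : ℕ) / (2 * A) := by
      intro x
      push_cast
      field_simp
      ring
    simp only [hf, Function.comp_apply, e, hdvd, hval]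
  simp only [← hfeq] at hfib
  have hsum : Summable f := (summable_prod_of_nonneg (fun _ => hnn _)).2
    ⟨fun r => (hfib r).summable, .of_finite⟩
  have h1 := hsum.hasSum.prod_fiberwise hfib
  convert! hsum.hasSum using 1
  rw [h1.unique (hasSum_fintype _), rootCount, Finset.card_filter, Nat.cast_sum, Finset.sum_mul,
    Finset.sum_range]
  refine Finset.sum_congr rfl fun r _ => ?_
  split_ifs <;> simp

open scoped Nat in
/-- The mean value of Zagier's function in terms of the numbers of roots of `b² ≡ D`. -/
lemma hasSum_rootCount (hD : 0 < D) (hDs : ¬ IsSquare D) (hp : 1 ≤ p) :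
    HasSum (fun A : ℕ => (D : ℝ) ^ p * √D * (p ! : ℝ) ^ 2 / ((2 * p + 1)! : ℝ) *
      (rootCount D A / (A : ℝ) ^ (p + 1))) (∫ x in (0 : ℝ)..1, qsum D p x) := by
  have hp0 : p ≠ 0 := by omega
  set g : ℕ × ℤ → ℤ × ℤ × ℤ := fun t => (-(t.1 : ℤ), t.2, (D - t.2 ^ 2) / (4 * t.1)) with hg
  have hginj : g.Injective := by
    rintro ⟨A, b⟩ ⟨A', b'⟩ h
    simp only [hg, Prod.mk.injEq, neg_inj, Nat.cast_inj] at h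
    ext <;> simp [h.1, h.2.1]
  have hrange : ∀ t, t ∉ Set.range g → (∫ x in (0 : ℝ)..1, qterm D p x t) = 0 := by
    rintro ⟨a, b, c⟩ ht
    have : ∀ x, qterm D p x (a, b, c) = 0 := by
      intro x
      rw [qterm, if_neg]
      rintro ⟨h1, h2⟩
      refine ht ⟨(a.natAbs, b), ?_⟩
      simp only [qdisc] at h1 h2
      have h3 : (a.natAbs : ℤ) = -a := by omega
      simp only [hg, h3, neg_neg, Prod.mk.injEq, true_and]
      exact Int.ediv_eq_of_eq_mul_right (by omega) (by rw [← h2]; ring)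
    simp [this]
  have h0 := (hginj.hasSum_iff hrange).2 (hasSum_integral_qterm hDs hp)
  refine h0.prod_fiberwise fun A => ?_
  rcases eq_or_ne A 0 with rfl | hA
  · simp [hg, qterm, hasSum_zero]
  have hA' : (0 : ℝ) < A := by exact_mod_cast Nat.pos_of_ne_zero hA
  have hD' : (0 : ℝ) < D := by exact_mod_cast hD
  have hsq : 0 < √(D : ℝ) := Real.sqrt_pos.2 hD'
  have h1 := (hasSum_integral_bump (D := D) hp0 A hA (2 * A / √D) (by positivity)).mul_left
    (((D : ℝ) / (4 * A)) ^ p)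
  convert! h1 using 1
  · ext b
    have hdisc : qdisc (g (A, b)) = D ↔ (4 * (A : ℤ)) ∣ D - b ^ 2 := by
      simp only [hg, qdisc]
      constructor
      · intro h
        exact ⟨(D - b ^ 2) / (4 * A), by linarith⟩
      · intro h
        linarith [Int.mul_ediv_cancel' h]
    simp only [Function.comp_apply, qterm, hdisc]
    split_ifs with h2 h3 h3
    · rw [← intervalIntegral.integral_const_mul]
      exact intervalIntegral.integral_congr fun x _ => qval_eq_bump hD hA h2.2 x
    · exact absurd h2.2 h3
    · exact absurd ⟨by simp [hg]; omega, h3⟩ h2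
    · simp
  · rw [integral_bump hp0, abs_of_pos (by positivity), div_pow, mul_pow]
    field_simp
    ring

end

/-- The number of roots of `x² - tx + ν` modulo `A`. -/
def polyCount (t ν : ℤ) (A : ℕ) : ℕ :=
  Nat.card {x : ZMod A // x ^ 2 - (t : ZMod A) * x + (ν : ZMod A) = 0}

section polyCount

variable (t ν : ℤ)

lemma polyCount_one : polyCount t ν 1 = 1 := by
  rw [polyCount, Nat.card_eq_one_iff_unique]
  exact ⟨⟨fun a b => Subtype.ext (Subsingleton.elim _ _)⟩, ⟨⟨0, Subsingleton.elim _ _⟩⟩⟩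

lemma polyCount_mul {m n : ℕ} (h : m.Coprime n) :
    polyCount t ν (m * n) = polyCount t ν m * polyCount t ν n := by
  rw [polyCount, polyCount, polyCount, ← Nat.card_prod]
  let e := ZMod.chineseRemainder h
  have key : ∀ x, x ^ 2 - (t : ZMod (m * n)) * x + (ν : ZMod (m * n)) = 0 ↔
      ((e x).1 ^ 2 - (t : ZMod m) * (e x).1 + (ν : ZMod m) = 0 ∧
        (e x).2 ^ 2 - (t : ZMod n) * (e x).2 + (ν : ZMod n) = 0) := by
    intro x
    rw [← e.injective.eq_iff, map_zero, Prod.ext_iff]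
    simp
  refine Nat.card_congr ((e.toEquiv.subtypeEquiv (q := fun y =>
    (y.1 ^ 2 - (t : ZMod m) * y.1 + (ν : ZMod m) = 0 ∧
        y.2 ^ 2 - (t : ZMod n) * y.2 + (ν : ZMod n) = 0)) key).trans ?_)
  exact Equiv.subtypeProdEquivProd (p := fun x : ZMod m => x ^ 2 - (t : ZMod m) * x + (ν : ZMod m) = 0)
    (q := fun x : ZMod n => x ^ 2 - (t : ZMod n) * x + (ν : ZMod n) = 0)

lemma intCast_root_iff {A : ℕ} (n : ℤ) :
    (n : ZMod A) ^ 2 - (t : ZMod A) * (n : ZMod A) + (ν : ZMod A) = 0 ↔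
      (A : ℤ) ∣ n ^ 2 - t * n + ν := by
  rw [← ZMod.intCast_zmod_eq_zero_iff_dvd]
  push_cast
  rfl

lemma rootCount_eq_polyCount {A : ℕ} (hA : A ≠ 0) :
    rootCount (t ^ 2 - 4 * ν) A = polyCount t ν A := by
  have : NeZero A := ⟨hA⟩
  have hA0 : 0 < A := Nat.pos_of_ne_zero hA
  rw [rootCount, ← Fintype.card_coe, ← Nat.card_eq_fintype_card]
  have hpar : ∀ b : ℕ, (4 * (A : ℤ)) ∣ (t ^ 2 - 4 * ν) - (b : ℤ) ^ 2 → ∃ y : ℤ, (b : ℤ) = 2 * y - t := by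
    intro b hb
    obtain ⟨c, hc⟩ := hb
    refine ⟨((b : ℤ) + t) / 2, ?_⟩
    have h2 : (2 : ℤ) ∣ (b : ℤ) ^ 2 - t ^ 2 := ⟨-2 * ν - 2 * A * c, by linarith⟩
    have h3 : ((b : ℤ) + t) % 2 = 0 := by
      rw [sq_sub_sq] at h2
      rcases Int.prime_two.dvd_or_dvd h2 with h | h <;> omega
    omega
  have hdvd : ∀ y : ℤ, (4 * (A : ℤ)) ∣ (t ^ 2 - 4 * ν) - (2 * y - t) ^ 2 ↔
      (A : ℤ) ∣ y ^ 2 - t * y + ν := by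
    intro y
    rw [show (t ^ 2 - 4 * ν) - (2 * y - t) ^ 2 = 4 * -(y ^ 2 - t * y + ν) by ring,
      mul_dvd_mul_iff_left (by norm_num), dvd_neg]
  have hmem : ∀ b : {b // b ∈ (Finset.range (2 * A)).filter fun b : ℕ =>
      (4 * (A : ℤ)) ∣ (t ^ 2 - 4 * ν) - (b : ℤ) ^ 2},
      ∃ y : ℤ, (b : ℤ) = 2 * y - t ∧ (A : ℤ) ∣ y ^ 2 - t * y + ν ∧ b.1 < 2 * A := by
    rintro ⟨b, hb⟩
    obtain ⟨h1, h2⟩ := Finset.mem_filter.1 hb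
    obtain ⟨y, hy⟩ := hpar b h2
    rw [hy, hdvd] at h2
    exact ⟨y, hy, h2, Finset.mem_range.1 h1⟩
  choose f hf1 hf2 hf3 using hmem
  refine Nat.card_eq_of_bijective (fun b => ⟨(f b : ZMod A), (intCast_root_iff t ν _).2 (hf2 b)⟩) ⟨?_, ?_⟩
  · intro b b' h
    simp only [Subtype.mk.injEq, ZMod.intCast_eq_intCast_iff_dvd_sub] at h
    obtain ⟨c, hc⟩ := h
    have h1 := hf1 b
    have h2 := hf1 b'
    have h3 := hf3 b
    have h4 := hf3 b'
    have hc0 : c = 0 := by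
      have h5 : ((b'.1 : ℕ) : ℤ) - b.1 = (2 * A) * c := by linarith
      by_contra hc0
      have : 1 ≤ |c| := Int.one_le_abs hc0
      have h6 : |((b'.1 : ℕ) : ℤ) - b.1| = 2 * A * |c| := by
        rw [h5, abs_mul, abs_of_nonneg (by positivity)]
      have h7 : |((b'.1 : ℕ) : ℤ) - b.1| < 2 * A := by rw [abs_lt]; omega
      nlinarith
    rw [hc0, mul_zero] at hc
    ext
    omega
  · rintro ⟨x, hx⟩
    obtain ⟨n, rfl⟩ := ZMod.intCast_surjective x
    rw [intCast_root_iff] at hx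
    have hA2 : (0 : ℤ) < 2 * A := by omega
    set b := ((2 * n - t) % (2 * A)).toNat with hb
    have hb1 : (b : ℤ) = (2 * n - t) % (2 * A) := Int.toNat_of_nonneg (Int.emod_nonneg _ hA2.ne')
    have hb2 : (b : ℤ) = 2 * (n - A * ((2 * n - t) / (2 * A))) - t := by
      rw [hb1, Int.emod_def]
      ring
    have hb3 : (b : ℤ) < 2 * A := hb1 ▸ Int.emod_lt_of_pos _ hA2
    set q := (2 * n - t) / (2 * (A : ℤ)) with hq
    have hmem : b ∈ (Finset.range (2 * A)).filter fun b : ℕ =>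
        (4 * (A : ℤ)) ∣ (t ^ 2 - 4 * ν) - (b : ℤ) ^ 2 := by
      rw [Finset.mem_filter, Finset.mem_range, hb2, hdvd]
      refine ⟨by omega, ?_⟩
      rw [show (n - A * q) ^ 2 - t * (n - A * q) + ν = (n ^ 2 - t * n + ν) + A * (A * q ^ 2 - 2 * n * q + t * q)
        by ring]
      exact dvd_add hx (dvd_mul_right _ _)
    refine ⟨⟨b, hmem⟩, Subtype.ext ?_⟩
    simp only [ZMod.intCast_eq_intCast_iff_dvd_sub]
    have h1 := hf1 ⟨b, hmem⟩
    simp only [hb2] at h1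
    exact ⟨q, by linarith⟩

lemma polyCount_hensel {p : ℕ} (hp : p.Prime) (hpD : ¬ (p : ℤ) ∣ t ^ 2 - 4 * ν) {i : ℕ} (hi : 1 ≤ i) :
    polyCount t ν (p ^ (i + 1)) = polyCount t ν (p ^ i) := by
  have hdvd : p ^ i ∣ p ^ (i + 1) := pow_dvd_pow _ (Nat.le_succ i)
  let c := ZMod.castHom hdvd (ZMod (p ^ i))
  have hp' : Prime (p : ℤ) := Nat.prime_iff_prime_int.1 hp
  have hpi : (p : ℤ) ∣ (p : ℤ) ^ i := dvd_pow_self _ (by omega)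
  have hroot : ∀ n : ℤ, (p : ℤ) ^ i ∣ n ^ 2 - t * n + ν → ¬ (p : ℤ) ∣ 2 * n - t := by
    intro n hn h
    refine hpD ?_
    rw [show t ^ 2 - 4 * ν = (2 * n - t) * (2 * n - t) - 4 * (n ^ 2 - t * n + ν) by ring]
    exact dvd_sub (h.mul_right _) ((hpi.trans hn).mul_left _)
  refine Nat.card_eq_of_bijective (fun x => ⟨c x.1, by
    have := congrArg c x.2
    simpa using this⟩) ⟨?_, ?_⟩
  · rintro ⟨x, hx⟩ ⟨y, hy⟩ h
    obtain ⟨x, rfl⟩ := ZMod.intCast_surjective x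
    obtain ⟨y, rfl⟩ := ZMod.intCast_surjective y
    simp only [Subtype.mk.injEq, map_intCast, ZMod.intCast_eq_intCast_iff_dvd_sub] at h ⊢
    rw [intCast_root_iff] at hx hy
    push_cast at h hx hy ⊢
    have h1 : ¬ (p : ℤ) ∣ x + y - t := by
      intro h1
      refine hroot x ((pow_dvd_pow _ (Nat.le_succ i)).trans hx) ?_
      rw [show 2 * x - t = (x + y - t) - (y - x) by ring]
      exact dvd_sub h1 (hpi.trans h)
    refine (IsCoprime.pow_left ((hp'.coprime_iff_not_dvd).2 h1)).dvd_of_dvd_mul_right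
      (show (p : ℤ) ^ (i + 1) ∣ (y - x) * (x + y - t) from ?_)
    rw [show (y - x) * (x + y - t) = (y ^ 2 - t * y + ν) - (x ^ 2 - t * x + ν) by ring]
    exact dvd_sub hy hx
  · rintro ⟨x, hx⟩
    obtain ⟨x, rfl⟩ := ZMod.intCast_surjective x
    have hx' := hx
    rw [intCast_root_iff] at hx'
    push_cast at hx'
    obtain ⟨w, hw⟩ := hx'
    obtain ⟨u, v, huv⟩ := (hp'.coprime_iff_not_dvd).2 (hroot x ⟨w, hw⟩)
    refine ⟨⟨((x - p ^ i * (v * w) : ℤ) : ZMod (p ^ (i + 1))), ?_⟩, ?_⟩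
    · rw [intCast_root_iff]
      push_cast
      obtain ⟨i, rfl⟩ : ∃ j, i = j + 1 := ⟨i - 1, by omega⟩
      refine ⟨w * u + p ^ i * (v * w) ^ 2, ?_⟩
      linear_combination hw - (p : ℤ) ^ (i + 1) * w * huv
    · simp only [Subtype.mk.injEq, map_intCast, ZMod.intCast_eq_intCast_iff_dvd_sub]
      push_cast
      exact ⟨v * w, by ring⟩

lemma polyCount_eq_sum (A : ℕ) [NeZero A] : (polyCount t ν A : ℤ) =
    ∑ x : ZMod A, if x ^ 2 - (t : ZMod A) * x + (ν : ZMod A) = 0 then 1 else 0 := by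
  rw [polyCount, Nat.card_eq_fintype_card, Fintype.card_subtype, Finset.card_filter]
  push_cast
  rfl

lemma polyCount_prime {t : ℤ} (ht : t = 0 ∨ t = 1) {p : ℕ} (hp : p.Prime) :
    (polyCount t ν p : ℤ) = 1 + kron (t ^ 2 - 4 * ν) p := by
  have : Fact p.Prime := ⟨hp⟩
  rw [polyCount_eq_sum]
  rcases eq_or_ne p 2 with rfl | h2
  · have huniv : (Finset.univ : Finset (ZMod 2)) = {0, 1} := rfl
    have h01 : (0 : ZMod 2) ≠ 1 := zero_ne_one
    have h11 : (1 : ZMod 2) + 1 = 0 := rfl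
    rw [kron_two, huniv, Finset.sum_pair h01]
    rcases Int.even_or_odd ν with hν | hν
    · have hν0 : (ν : ZMod 2) = 0 := (ZMod.intCast_zmod_eq_zero_iff_dvd _ _).2 hν.two_dvd
      rcases ht with rfl | rfl
      · rw [if_pos (by omega : ((0 : ℤ) ^ 2 - 4 * ν) % 2 = 0)]
        simp [hν0]
      · obtain ⟨c, rfl⟩ := hν
        rw [if_neg (by omega : ¬ ((1 : ℤ) ^ 2 - 4 * (c + c)) % 2 = 0),
          if_pos (by omega : ((1 : ℤ) ^ 2 - 4 * (c + c)) % 8 = 1 ∨ ((1 : ℤ) ^ 2 - 4 * (c + c)) % 8 = 7)]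
        simp [hν0]
    · have hν0 : (ν : ZMod 2) = 1 := by
        obtain ⟨c, rfl⟩ := hν
        push_cast
        rw [show (2 : ZMod 2) = 0 from rfl, zero_mul, zero_add]
      rcases ht with rfl | rfl
      · rw [if_pos (by omega : ((0 : ℤ) ^ 2 - 4 * ν) % 2 = 0)]
        simp [hν0, h11]
      · obtain ⟨c, rfl⟩ := hν
        rw [if_neg (by omega : ¬ ((1 : ℤ) ^ 2 - 4 * (2 * c + 1)) % 2 = 0),
          if_neg (by omega : ¬ (((1 : ℤ) ^ 2 - 4 * (2 * c + 1)) % 8 = 1 ∨ ((1 : ℤ) ^ 2 - 4 * (2 * c + 1)) % 8 = 7))]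
        simp [hν0]
  · have h := count_quadratic_roots h2 (a := 1) (b := (t : ZMod p)) (c := (ν : ZMod p)) (by simp)
    rw [if_neg one_ne_zero, zero_add] at h
    rw [kron_odd_prime _ hp h2, ← jacobiSym.legendreSym.to_jacobiSym, legendreSym]
    push_cast
    rw [mul_one] at h
    rw [← h]
    refine Finset.sum_congr rfl fun y _ => ?_
    rw [show (y ^ 2 - (t : ZMod p) * y + ν) = (ν - t * y + 1 * y ^ 2 : ZMod p) by ring]

lemma polyCount_eq_zero (hD : IsFundDisc (t ^ 2 - 4 * ν)) (ht : t = 0 ∨ t = 1) {p : ℕ}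
    (hp : p.Prime) (hpD : (p : ℤ) ∣ t ^ 2 - 4 * ν) (i : ℕ) : polyCount t ν (p ^ (i + 2)) = 0 := by
  rw [polyCount, Nat.card_eq_zero]
  refine Or.inl ⟨?_⟩
  rintro ⟨x, hx⟩
  obtain ⟨n, rfl⟩ := ZMod.intCast_surjective x
  rw [intCast_root_iff] at hx
  push_cast at hx
  have hp' : Prime (p : ℤ) := Nat.prime_iff_prime_int.1 hp
  have h2 : (p : ℤ) ^ 2 ∣ n ^ 2 - t * n + ν := (pow_dvd_pow _ (by omega)).trans hx
  have h3 : (p : ℤ) ∣ 2 * n - t := by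
    refine hp'.dvd_of_dvd_pow (n := 2) ?_
    rw [show (2 * n - t) ^ 2 = (t ^ 2 - 4 * ν) + 4 * (n ^ 2 - t * n + ν) by ring]
    exact dvd_add hpD (((dvd_pow_self _ two_ne_zero).trans h2).mul_left _)
  have h4 : (p : ℤ) ^ 2 ∣ t ^ 2 - 4 * ν := by
    rw [show t ^ 2 - 4 * ν = (2 * n - t) ^ 2 - 4 * (n ^ 2 - t * n + ν) by ring]
    exact dvd_sub (pow_dvd_pow_of_dvd h3 2) (h2.mul_left _)
  obtain ⟨rfl, h5⟩ := hD.2.2 p hp h4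
  rcases ht with rfl | rfl
  · obtain ⟨c, hc⟩ := h2
    push_cast at hc
    rcases Int.even_or_odd' n with ⟨d, rfl | rfl⟩ <;> ring_nf at hc h5 <;> omega
  · push_cast at h3
    omega

lemma kron_eq_zero_iff {p : ℕ} (hp : p.Prime) :
    kron (t ^ 2 - 4 * ν) p = 0 ↔ (p : ℤ) ∣ t ^ 2 - 4 * ν := by
  rcases eq_or_ne p 2 with rfl | h2
  · rw [kron_two]
    push_cast
    rw [Int.dvd_iff_emod_eq_zero]
    split_ifs <;> simp_all
  · have : Fact p.Prime := ⟨hp⟩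
    rw [kron_odd_prime _ hp h2, ← jacobiSym.legendreSym.to_jacobiSym, legendreSym.eq_zero_iff,
      ZMod.intCast_zmod_eq_zero_iff_dvd]

lemma kron_prime_trichotomy (D : ℤ) {p : ℕ} (hp : p.Prime) :
    kron D p = 0 ∨ kron D p = 1 ∨ kron D p = -1 := by
  rcases eq_or_ne p 2 with rfl | h2
  · rw [kron_two]
    split_ifs <;> simp
  · rw [kron_odd_prime _ hp h2]
    exact jacobiSym.trichotomy _ _

lemma polyCount_prime_pow (hD : IsFundDisc (t ^ 2 - 4 * ν)) (ht : t = 0 ∨ t = 1) {p : ℕ}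
    (hp : p.Prime) (i : ℕ) : (polyCount t ν (p ^ (i + 2)) : ℤ) =
      kron (t ^ 2 - 4 * ν) p * (1 + kron (t ^ 2 - 4 * ν) p) := by
  by_cases h : (p : ℤ) ∣ t ^ 2 - 4 * ν
  · rw [polyCount_eq_zero t ν hD ht hp h, (kron_eq_zero_iff t ν hp).2 h]
    simp
  · have h1 : ∀ i, polyCount t ν (p ^ (i + 1)) = polyCount t ν p := by
      intro i
      induction i with
      | zero => simp
      | succ i ih => rw [polyCount_hensel t ν hp h (by omega), ih]
    rw [h1 (i + 1), polyCount_prime ν ht hp]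
    have h0 := mt (kron_eq_zero_iff t ν hp).1 h
    rcases kron_prime_trichotomy (t ^ 2 - 4 * ν) hp with h2 | h2 | h2
    · exact absurd h2 h0
    · rw [h2]; norm_num
    · rw [h2]; norm_num

end polyCount

/-- The number of roots of `x² - tx + ν` as an arithmetic function. -/
def polyCountFun (t ν : ℤ) : ArithmeticFunction ℤ :=
  ⟨fun n => if n = 0 then 0 else polyCount t ν n, if_pos rfl⟩

/-- The indicator function of the nonzero squares. -/
def squareFun : ArithmeticFunction ℤ :=
  ⟨fun n => if n = 0 then 0 else if IsSquare n then 1 else 0, if_pos rfl⟩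

/-- The Kronecker symbol as an arithmetic function. -/
def kronFun (D : ℤ) : ArithmeticFunction ℤ :=
  ⟨fun n => if n = 0 then 0 else kron D n, if_pos rfl⟩

lemma isMultiplicative_polyCountFun (t ν : ℤ) : (polyCountFun t ν).IsMultiplicative := by
  refine ArithmeticFunction.IsMultiplicative.iff_ne_zero.2 ⟨?_, fun {m n} hm hn h => ?_⟩
  · simp [polyCountFun, polyCount_one]
  · simp [polyCountFun, hm, hn, polyCount_mul t ν h]

lemma isMultiplicative_squareFun : squareFun.IsMultiplicative := by
  refine ArithmeticFunction.IsMultiplicative.iff_ne_zero.2 ⟨?_, fun {m n} hm hn h => ?_⟩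
  · simp [squareFun]
  · have : IsSquare (m * n) ↔ IsSquare m ∧ IsSquare n := by
      constructor
      · rintro ⟨c, hc⟩
        have hc' : m * n = c ^ 2 := by rw [hc, sq]
        have hu : IsUnit (gcd m n) := by
          rw [show gcd m n = m.gcd n from rfl, h]; exact isUnit_one
        have hu' : IsUnit (gcd n m) := by
          rw [show gcd n m = n.gcd m from rfl, h.symm]; exact isUnit_one
        obtain ⟨a, ha⟩ := exists_eq_pow_of_mul_eq_pow hu hc'
        obtain ⟨b, hb⟩ := exists_eq_pow_of_mul_eq_pow hu' ((mul_comm n m).trans hc')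
        exact ⟨⟨a, by rw [ha, sq]⟩, ⟨b, by rw [hb, sq]⟩⟩
      · exact fun h => h.1.mul h.2
    by_cases h1 : IsSquare m <;> by_cases h2 : IsSquare n <;> simp [squareFun, hm, hn, h1, h2, this]

lemma isMultiplicative_kronFun (D : ℤ) : (kronFun D).IsMultiplicative := by
  refine ArithmeticFunction.IsMultiplicative.iff_ne_zero.2 ⟨?_, fun {m n} hm hn h => ?_⟩
  · simp [kronFun, kron_one]
  · simp [kronFun, hm, hn, kron_mul D hm hn]

lemma polyCountFun_mul_squareFun {t ν : ℤ} (hD : IsFundDisc (t ^ 2 - 4 * ν)) (ht : t = 0 ∨ t = 1) :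
    polyCountFun t ν * squareFun = kronFun (t ^ 2 - 4 * ν) * ArithmeticFunction.zeta := by
  refine (ArithmeticFunction.IsMultiplicative.eq_iff_eq_on_prime_powers _
    ((isMultiplicative_polyCountFun t ν).mul isMultiplicative_squareFun) _
    ((isMultiplicative_kronFun _).mul ArithmeticFunction.isMultiplicative_zeta.natCast)).2 fun p i hp => ?_
  set χ := kron (t ^ 2 - 4 * ν) p with hχ
  have hp0 : ∀ j, p ^ j ≠ 0 := fun j => pow_ne_zero _ hp.ne_zero
  have hsq : ∀ j, squareFun (p ^ j) = if Even j then 1 else 0 := by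
    intro j
    have : IsSquare (p ^ j) ↔ Even j := by
      constructor
      · rintro ⟨c, hc⟩
        have hc0 : c ≠ 0 := by rintro rfl; exact hp0 j hc
        have h := congrArg (fun n => n.factorization p) hc
        simp only [hp.factorization_pow, Finsupp.single_eq_same,
          Nat.factorization_mul hc0 hc0, Finsupp.add_apply] at h
        exact ⟨_, h⟩
      · rintro ⟨c, rfl⟩
        exact ⟨p ^ c, pow_add p c c⟩
    simp [squareFun, hp.ne_zero, this]
  have hkron : ∀ j, kronFun (t ^ 2 - 4 * ν) (p ^ j) = χ ^ j := by
    intro j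
    have h : kron (t ^ 2 - 4 * ν) (p ^ j) = χ ^ j := by
      induction j with
      | zero => simp [kron_one]
      | succ j ih => rw [pow_succ p, kron_mul _ (hp0 j) hp.ne_zero, ih, pow_succ χ]
    simp [kronFun, hp.ne_zero, h]
  have hL : (polyCountFun t ν * squareFun) (p ^ i) =
      ∑ j ∈ Finset.range (i + 1), (if Even (i - j) then (polyCount t ν (p ^ j) : ℤ) else 0) := by
    rw [ArithmeticFunction.mul_apply,
      Nat.sum_divisorsAntidiagonal (fun x y => polyCountFun t ν x * squareFun y),
      Nat.sum_divisors_prime_pow hp]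
    refine Finset.sum_congr rfl fun j hj => ?_
    rw [Nat.pow_div (by have := Finset.mem_range.1 hj; omega) hp.pos, hsq]
    simp [polyCountFun, hp.ne_zero]
  have hR : (kronFun (t ^ 2 - 4 * ν) * ArithmeticFunction.zeta) (p ^ i) =
      ∑ j ∈ Finset.range (i + 1), χ ^ j := by
    rw [ArithmeticFunction.coe_mul_zeta_apply, Nat.sum_divisors_prime_pow hp]
    exact Finset.sum_congr rfl fun j _ => hkron j
  rw [hL, hR]
  have hc1 := polyCount_prime ν ht hp
  rw [← hχ] at hc1
  clear hL hR hsq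
  induction i using Nat.twoStepInduction with
  | zero => simp [polyCount_one]
  | one => simp [Finset.sum_range_succ, hc1]
  | more i ih _ =>
    have h1 : ∑ j ∈ Finset.range (i + 2 + 1),
        (if Even (i + 2 - j) then (polyCount t ν (p ^ j) : ℤ) else 0) =
        ∑ j ∈ Finset.range (i + 1), (if Even (i - j) then (polyCount t ν (p ^ j) : ℤ) else 0) +
          polyCount t ν (p ^ (i + 2)) := by
      rw [Finset.sum_range_succ, Finset.sum_range_succ,
        if_pos (show Even (i + 2 - (i + 2)) by simp),
        if_neg (show ¬ Even (i + 2 - (i + 1)) by rw [show i + 2 - (i + 1) = 1 by omega]; decide),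
        add_zero]
      congr 1
      refine Finset.sum_congr rfl fun j hj => ?_
      have hj' := Finset.mem_range.1 hj
      rw [show i + 2 - j = i - j + 2 by omega]
      simp [Nat.even_add]
    rw [h1, ih, Finset.sum_range_succ (n := i + 2), Finset.sum_range_succ (n := i + 1),
      polyCount_prime_pow t ν hD ht hp, ← hχ, add_assoc]
    congr 1
    rcases kron_prime_trichotomy (t ^ 2 - 4 * ν) hp with h | h | h <;> rw [← hχ] at h <;> rw [h]
    · simp
    · simp
    · simp [pow_succ]

section GaussSumSign

open Polynomial Real

lemma prod_one_sub_zeta_pow {p : ℕ} (hp : p.Prime) {ζ : ℂ} (hζ : IsPrimitiveRoot ζ p) :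
    ∏ k ∈ Finset.range (p - 1), (1 - ζ ^ (k + 1)) = p := by
  have : Fact p.Prime := ⟨hp⟩
  have h1 : eval 1 (cyclotomic p ℂ) = p := eval_one_cyclotomic_prime
  rw [cyclotomic_eq_prod_X_sub_primitiveRoots hζ, eval_prod] at h1
  rw [← h1]
  refine Finset.prod_bij (fun k _ => ζ ^ (k + 1)) (fun k hk => ?_) (fun a ha b hb hab => ?_)
    (fun μ hμ => ?_) (fun k hk => by simp)
  · rw [mem_primitiveRoots hp.pos]
    have hk := Finset.mem_range.1 hk
    exact hζ.pow_of_coprime _ ((Nat.Coprime.symm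
      ((Nat.Prime.coprime_iff_not_dvd hp).2 (Nat.not_dvd_of_pos_of_lt (by omega) (by omega)))))
  · have ha := Finset.mem_range.1 ha
    have hb := Finset.mem_range.1 hb
    have := hζ.pow_inj (by omega) (by omega) hab
    omega
  · rw [mem_primitiveRoots hp.pos] at hμ
    obtain ⟨i, hi, h⟩ := hζ.eq_pow_of_pow_eq_one hμ.pow_eq_one
    have hi0 : i ≠ 0 := by
      rintro rfl
      rw [pow_zero] at h
      have := hμ.eq_orderOf
      rw [← h, orderOf_one] at this
      exact hp.one_lt.ne' this
    refine ⟨i - 1, Finset.mem_range.2 (by omega), ?_⟩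
    rw [Nat.sub_add_cancel (Nat.pos_of_ne_zero hi0), h]

lemma iterate_euler_X_sub_one_pow {R : Type*} [CommRing R] (n i : ℕ) (hi : i ≤ n) :
    ∃ S : R[X], (fun f : R[X] => X * derivative f)^[i] ((X - 1) ^ n) = (X - 1) ^ (n - i) * S ∧
      S.eval 1 = ∏ l ∈ Finset.range i, ((n - l : ℕ) : R) := by
  induction i with
  | zero => exact ⟨1, by simp, by simp⟩
  | succ i ih =>
    obtain ⟨S, h1, h2⟩ := ih (by omega)
    obtain ⟨r, hr⟩ : ∃ r, n - i = r + 1 := ⟨n - i - 1, by omega⟩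
    refine ⟨X * (C ((r + 1 : ℕ) : R) * S + (X - 1) * derivative S), ?_, ?_⟩
    · rw [Function.iterate_succ_apply', h1, hr, show n - (i + 1) = r by omega]
      simp only [derivative_mul, derivative_pow, derivative_sub, derivative_X, derivative_one]
      simp only [Nat.add_sub_cancel]
      ring
    · rw [Finset.prod_range_succ, ← h2, hr]
      simp [mul_comm]

lemma iterate_euler_sum {R : Type*} [CommRing R] (n i : ℕ) :
    (fun f : R[X] => X * derivative f)^[i] (∑ j ∈ Finset.range n, X ^ j) =
      ∑ j ∈ Finset.range n, C ((j : R) ^ i) * X ^ j := by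
  induction i with
  | zero => simp
  | succ i ih =>
    rw [Function.iterate_succ_apply', ih, derivative_sum, Finset.mul_sum]
    refine Finset.sum_congr rfl fun j _ => ?_
    rw [derivative_C_mul_X_pow, pow_succ (j : R)]
    rcases j with _ | j
    · simp
    · rw [Nat.add_sub_cancel, pow_succ X]
      ring

/-- A polynomial whose value at a primitive `p`-th root of unity is plus or minus the quadratic
Gauss sum. -/
def sineProductPoly (m : ℕ) : ℤ[X] := ∏ k ∈ Finset.range m, X ^ ((k + 1) * m) * (X ^ (k + 1) - 1)

lemma sineProductPoly_map (R : Type*) [CommRing R] (m : ℕ) :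
    ∃ S : R[X], (sineProductPoly m).map (Int.castRingHom R) = (X - 1) ^ m * S ∧
      S.eval 1 = (m.factorial : R) := by
  refine ⟨∏ k ∈ Finset.range m, X ^ ((k + 1) * m) * ∑ i ∈ Finset.range (k + 1), X ^ i, ?_, ?_⟩
  · rw [sineProductPoly, Polynomial.map_prod]
    rw [show (X - 1 : R[X]) ^ m = ∏ k ∈ Finset.range m, (X - 1) by simp, ← Finset.prod_mul_distrib]
    refine Finset.prod_congr rfl fun k _ => ?_
    simp only [Polynomial.map_mul, Polynomial.map_pow, Polynomial.map_sub, map_X, Polynomial.map_one]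
    rw [← mul_geom_sum]
    ring
  · rw [eval_prod, ← Finset.prod_range_add_one_eq_factorial]
    push_cast
    refine Finset.prod_congr rfl fun k _ => ?_
    simp [eval_finsetSum]

lemma sign_eq_of_dvd {p m : ℕ} [hp : Fact p.Prime] (hpm : p = 2 * m + 1) (ε : ℤ)
    (h : cyclotomic p ℤ ∣
      ∑ j ∈ Finset.range p, C (legendreSym p j) * X ^ j - C ε * sineProductPoly m) :
    (ε : ZMod p) = (-1) ^ m := by
  have hm : 1 ≤ m := by have := hp.out.two_le; omega
  have h1 := Polynomial.map_dvd (Int.castRingHom (ZMod p)) h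
  have hcyc : (cyclotomic p ℤ).map (Int.castRingHom (ZMod p)) = (X - 1) ^ (p - 1) := by
    have := cyclotomic_mul_prime_eq_pow_of_not_dvd (ZMod p) (p := p) (n := 1) hp.out.not_dvd_one
    simpa using this
  have hgeom : ∑ j ∈ Finset.range p, (X : (ZMod p)[X]) ^ j = (X - 1) ^ (p - 1) := by
    rw [← hcyc, map_cyclotomic, cyclotomic_prime]
  obtain ⟨S, hS1, hS2⟩ := iterate_euler_X_sub_one_pow (R := ZMod p) (p - 1) m (by omega)
  rw [← hgeom, iterate_euler_sum] at hS1
  obtain ⟨T, hT1, hT2⟩ := sineProductPoly_map (ZMod p) m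
  have hleg : (∑ j ∈ Finset.range p, C (legendreSym p j) * X ^ j : ℤ[X]).map
      (Int.castRingHom (ZMod p)) = ∑ j ∈ Finset.range p, C ((j : ZMod p) ^ m) * X ^ j := by
    rw [Polynomial.map_sum]
    refine Finset.sum_congr rfl fun j _ => ?_
    rw [Polynomial.map_mul, map_C, Polynomial.map_pow, map_X, eq_intCast, legendreSym.eq_pow,
      show p / 2 = m by omega, Int.cast_natCast]
  rw [hcyc, Polynomial.map_sub, Polynomial.map_mul, hleg, hS1, hT1, show p - 1 - m = m by omega,
    show p - 1 = m + m by omega, pow_add] at h1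
  have h2 : (X - 1 : (ZMod p)[X]) ^ m ∣ S - C (ε : ZMod p) * T := by
    refine (mul_dvd_mul_iff_left (a := (X - 1 : (ZMod p)[X]) ^ m)
      (pow_ne_zero _ (X_sub_C_ne_zero 1))).1 ?_
    convert! h1 using 1
    simp
    ring
  obtain ⟨W, hW⟩ := h2
  have h3 := congrArg (eval 1) hW
  simp only [eval_sub, eval_mul, eval_C, eval_pow, eval_X, eval_one, sub_self, hS2, hT2,
    zero_pow (show m ≠ 0 by omega), zero_mul] at h3
  have h4 : ∏ l ∈ Finset.range m, ((p - 1 - l : ℕ) : ZMod p) = (-1) ^ m * (m.factorial : ZMod p) := by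
    rw [← Finset.prod_range_add_one_eq_factorial]
    push_cast
    rw [show (-1 : ZMod p) ^ m = ∏ l ∈ Finset.range m, (-1) by simp, ← Finset.prod_mul_distrib]
    refine Finset.prod_congr rfl fun l hl => ?_
    have hl := Finset.mem_range.1 hl
    rw [show p - 1 - l = p - (l + 1) by omega, Nat.cast_sub (by omega)]
    simp
  rw [h4, sub_eq_zero] at h3
  have h5 : (m.factorial : ZMod p) ≠ 0 := by
    rw [Ne, ZMod.natCast_eq_zero_iff, hp.out.dvd_factorial]
    omega
  exact (mul_right_cancel₀ h5 h3).symm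

lemma aeval_sineProductPoly {p m : ℕ} (hpm : p = 2 * m + 1) :
    aeval (Complex.exp (2 * π * Complex.I / p)) (sineProductPoly m) =
      (∏ k ∈ Finset.range m, (-1) ^ (k + 1)) * Complex.I ^ m *
        ((∏ k ∈ Finset.range m, 2 * Real.sin (π * (k + 1) / p) : ℝ) : ℂ) := by
  have hp0 : (p : ℂ) ≠ 0 := by rw [hpm]; exact_mod_cast (2 * m).succ_ne_zero
  rw [sineProductPoly, map_prod, show Complex.I ^ m = ∏ k ∈ Finset.range m, Complex.I by simp,
    Complex.ofReal_prod, ← Finset.prod_mul_distrib, ← Finset.prod_mul_distrib]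
  refine Finset.prod_congr rfl fun k _ => ?_
  simp only [map_mul, map_pow, map_sub, aeval_X, map_one]
  set z : ℂ := π * (k + 1) / p * Complex.I with hz
  have h1 : Complex.exp (2 * π * Complex.I / p) ^ (k + 1) = Complex.exp z * Complex.exp z := by
    rw [← Complex.exp_nat_mul, ← Complex.exp_add]
    congr 1
    rw [hz]; push_cast; ring
  have h2 : Complex.exp (2 * π * Complex.I / p) ^ ((k + 1) * m) =
      (-1) ^ (k + 1) * Complex.exp (-z) := by
    rw [← Complex.exp_pi_mul_I, ← Complex.exp_nat_mul, ← Complex.exp_nat_mul, ← Complex.exp_add]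
    congr 1
    have : (m : ℂ) = (p - 1) / 2 := by rw [hpm]; push_cast; ring
    rw [hz]; push_cast; rw [this]; field_simp; ring
  have h3 : ((2 * Real.sin (π * (k + 1) / p) : ℝ) : ℂ) =
      (Complex.exp (-z) - Complex.exp z) * Complex.I := by
    push_cast
    rw [Complex.sin, hz]
    ring_nf
  have h4 : Complex.exp (-z) * Complex.exp z = 1 := by rw [← Complex.exp_add]; simp
  rw [h1, h2, h3]
  linear_combination (-1) ^ (k + 1) * (Complex.exp z * h4 +
    (Complex.exp z - Complex.exp (-z)) * Complex.I_sq)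

lemma prod_two_sin {p m : ℕ} (hp : p.Prime) (hpm : p = 2 * m + 1) :
    ∏ k ∈ Finset.range m, 2 * Real.sin (π * (k + 1) / p) = √p := by
  have hp0 : (0 : ℝ) < p := by exact_mod_cast hp.pos
  have hp0' : (p : ℂ) ≠ 0 := by exact_mod_cast hp0.ne'
  have hpos : ∀ k ∈ Finset.range m, 0 ≤ 2 * Real.sin (π * (k + 1) / p) := by
    intro k hk
    have hk := Finset.mem_range.1 hk
    have : (k : ℝ) + 1 ≤ p := by exact_mod_cast (by omega : k + 1 ≤ p)
    refine mul_nonneg two_pos.le (Real.sin_nonneg_of_nonneg_of_le_pi (by positivity) ?_)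
    rw [div_le_iff₀ hp0]
    exact mul_le_mul_of_nonneg_left this Real.pi_pos.le
  refine ((Real.sqrt_eq_iff_mul_self_eq hp0.le (Finset.prod_nonneg hpos)).2 ?_).symm
  have h := prod_one_sub_zeta_pow hp (Complex.isPrimitiveRoot_exp p hp.ne_zero)
  rw [show p - 1 = m + m by omega, Finset.prod_range_add,
    ← Finset.prod_range_reflect (fun k => 1 - Complex.exp (2 * π * Complex.I / p) ^ (m + k + 1)),
    ← Finset.prod_mul_distrib] at h
  rw [← Finset.prod_mul_distrib]
  apply Complex.ofReal_injective
  rw [Complex.ofReal_natCast, ← h, Complex.ofReal_prod]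
  refine Finset.prod_congr rfl fun k hk => ?_
  have hk := Finset.mem_range.1 hk
  set z : ℂ := π * (k + 1) / p * Complex.I with hz
  have h1 : Complex.exp (2 * π * Complex.I / p) ^ (k + 1) = Complex.exp z * Complex.exp z := by
    rw [← Complex.exp_nat_mul, ← Complex.exp_add]
    congr 1
    rw [hz]; push_cast; ring
  have h2 : Complex.exp (2 * π * Complex.I / p) ^ (m + (m - 1 - k) + 1) =
      Complex.exp (-z) * Complex.exp (-z) := by
    rw [← Complex.exp_nat_mul, ← Complex.exp_add, ← mul_one (Complex.exp (-z + -z)),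
      ← Complex.exp_two_pi_mul_I, ← Complex.exp_add]
    congr 1
    have : ((m + (m - 1 - k) + 1 : ℕ) : ℂ) = p - (k + 1) := by
      rw [show m + (m - 1 - k) + 1 = p - (k + 1) by omega, Nat.cast_sub (by omega)]
      push_cast; ring
    rw [hz, this]; field_simp; ring
  have h3 : ((2 * Real.sin (π * (k + 1) / p) : ℝ) : ℂ) =
      (Complex.exp (-z) - Complex.exp z) * Complex.I := by
    push_cast
    rw [Complex.sin, hz]
    ring_nf
  have h4 : Complex.exp (-z) * Complex.exp z = 1 := by rw [← Complex.exp_add]; simp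
  rw [h1, h2, Complex.ofReal_mul, h3]
  linear_combination -(Complex.exp (-z) - Complex.exp z) ^ 2 * Complex.I_sq -
    (1 - Complex.exp (-z) * Complex.exp z) * h4

lemma neg_one_prod_eq (m : ℕ) :
    (-1 : ℂ) ^ m * ((∏ k ∈ Finset.range m, (-1) ^ (k + 1)) * Complex.I ^ m) =
      if Even m then 1 else Complex.I := by
  induction m using Nat.twoStepInduction with
  | zero => simp
  | one => simp
  | more m ih _ =>
    rw [Finset.prod_range_succ, Finset.prod_range_succ]
    have : Even (m + 2) ↔ Even m := by simp [Nat.even_add]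
    simp only [this]
    rw [← ih]
    have h : ((-1 : ℂ) ^ m) ^ 2 = 1 := by rw [← pow_mul, mul_comm, pow_mul]; simp
    generalize ∏ k ∈ Finset.range m, (-1 : ℂ) ^ (k + 1) = b
    simp only [pow_succ (-1 : ℂ)]
    generalize (-1 : ℂ) ^ m = a at h ⊢
    linear_combination -a * b * Complex.I ^ m * (h * Complex.I ^ 2 + Complex.I_sq)

/-- Gauss's evaluation of the quadratic Gauss sum of an odd prime. -/
lemma sum_legendreSym_mul_exp {p m : ℕ} [hp : Fact p.Prime] (hpm : p = 2 * m + 1) :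
    ∑ j ∈ Finset.range p, (legendreSym p j : ℂ) * Complex.exp (2 * π * Complex.I / p) ^ j =
      (if Even m then 1 else Complex.I) * √p := by
  set g := ∑ j ∈ Finset.range p, (legendreSym p j : ℂ) * Complex.exp (2 * π * Complex.I / p) ^ j with hg
  have hζ := Complex.isPrimitiveRoot_exp p hp.out.ne_zero
  have hQ := aeval_sineProductPoly hpm
  rw [prod_two_sin hp.out hpm] at hQ
  have hsq : g ^ 2 = (aeval (Complex.exp (2 * π * Complex.I / p)) (sineProductPoly m)) ^ 2 := by
    have hχ : ringChar (ZMod p) ≠ 2 := by rw [ZMod.ringChar_zmod_n]; omega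
    have h1 := gaussSum_sq (χ := (quadraticChar (ZMod p)).ringHomComp (Int.castRingHom ℂ))
      ((MulChar.ringHomComp_ne_one_iff Int.cast_injective).2 (quadraticChar_ne_one hχ))
      ((quadraticChar_isQuadratic (ZMod p)).comp _) (ZMod.isPrimitive_stdAddChar p)
    have h2 : gaussSum ((quadraticChar (ZMod p)).ringHomComp (Int.castRingHom ℂ))
        ZMod.stdAddChar = g := by
      rw [gaussSum, hg]
      refine Finset.sum_nbij' ZMod.val (fun j : ℕ => (j : ZMod p))
        (fun x _ => Finset.mem_range.2 (ZMod.val_lt x)) (fun _ _ => Finset.mem_univ _)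
        (fun x _ => ZMod.natCast_zmod_val x)
        (fun j hj => ZMod.val_cast_of_lt (Finset.mem_range.1 hj)) (fun x _ => ?_)
      have h3 : ZMod.stdAddChar x = Complex.exp (2 * π * Complex.I / p) ^ x.val := by
        have := ZMod.stdAddChar_coe (N := p) (x.val : ℤ)
        rw [Int.cast_natCast, ZMod.natCast_zmod_val] at this
        rw [this, ← Complex.exp_nat_mul]
        congr 1
        push_cast
        ring
      rw [h3, legendreSym]
      simp
    have h4 : quadraticChar (ZMod p) (-1) = (-1) ^ m := by
      have := legendreSym.at_neg_one (p := p) (by omega)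
      rw [legendreSym, ZMod.χ₄_eq_neg_one_pow (by omega), show p / 2 = m by omega] at this
      simpa using this
    rw [h2] at h1
    rw [h1, hQ, MulChar.ringHomComp_apply, h4, ZMod.card]
    have h5 : (∏ k ∈ Finset.range m, (-1 : ℂ) ^ (k + 1)) ^ 2 = 1 := by
      rw [← Finset.prod_pow]
      exact Finset.prod_eq_one fun k _ => by rw [← pow_mul, mul_comm, pow_mul]; simp
    have h6 : (√(p : ℝ) : ℂ) ^ 2 = p := by
      rw [← Complex.ofReal_pow, Real.sq_sqrt (by positivity)]; simp
    have h7 : (Complex.I ^ m) ^ 2 = (-1) ^ m := by rw [← pow_mul, mul_comm, pow_mul, Complex.I_sq]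
    rw [mul_pow, mul_pow, h5, h6, h7]
    simp
  have hmain : ∀ ε : ℤ, g = ε * aeval (Complex.exp (2 * π * Complex.I / p)) (sineProductPoly m) →
      (ε : ZMod p) = (-1) ^ m := by
    intro ε h
    refine sign_eq_of_dvd hpm ε ?_
    rw [cyclotomic_eq_minpoly hζ hp.out.pos]
    refine minpoly.isIntegrallyClosed_dvd (hζ.isIntegral hp.out.pos) ?_
    rw [map_sub, map_mul, map_sum, sub_eq_zero, aeval_C]
    simpa [hg] using h
  have hone : ∀ ε : ℤ, (ε = 1 ∨ ε = -1) → (ε : ZMod p) = (-1) ^ m → ε = (-1) ^ m := by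
    intro ε hε h
    have : Fact (2 < p) := ⟨by have := hp.out.two_le; omega⟩
    have h2 := ZMod.neg_one_ne_one (n := p)
    rcases Nat.even_or_odd m with hm | hm <;> rw [hm.neg_one_pow] at h ⊢ <;>
      rcases hε with rfl | rfl <;> first | rfl | push_cast at h
    · exact absurd h h2
    · exact absurd h.symm h2
  obtain ⟨ε, hε, h⟩ : ∃ ε : ℤ, (ε = 1 ∨ ε = -1) ∧
      g = ε * aeval (Complex.exp (2 * π * Complex.I / p)) (sineProductPoly m) := by
    rcases sq_eq_sq_iff_eq_or_eq_neg.1 hsq with h | h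
    · exact ⟨1, Or.inl rfl, by simpa using h⟩
    · exact ⟨-1, Or.inr rfl, by simpa using h⟩
  rw [h, hone ε hε (hmain ε h), hQ, ← neg_one_prod_eq]
  push_cast
  ring

end GaussSumSign

section FourierSelfDual

open Real

/-- A completely multiplicative periodic function which is its own finite Fourier transform, up to
the scalar `s`. -/
structure IsFourierSelfDual (N : ℕ) (f : ℤ → ℤ) (s : ℂ) : Prop where
  periodic : ∀ x, f (x + N) = f x
  map_mul : ∀ x y, f (x * y) = f x * f y
  dual : ∀ k : ℤ, ∑ x ∈ Finset.range N, (f x : ℂ) * Complex.exp (2 * π * Complex.I * (x * k / N)) =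
    s * f k

lemma exp_two_pi_I_int_div {N : ℕ} (hN : N ≠ 0) {a b : ℤ} (h : (N : ℤ) ∣ a - b) :
    Complex.exp (2 * π * Complex.I * (a / N)) = Complex.exp (2 * π * Complex.I * (b / N)) := by
  obtain ⟨c, hc⟩ := h
  refine Complex.exp_eq_exp_iff_exists_int.2 ⟨c, ?_⟩
  have hN' : (N : ℂ) ≠ 0 := Nat.cast_ne_zero.2 hN
  have h2 : (a : ℂ) = b + N * c := by
    have : a = b + N * c := by linarith
    rw [this]; push_cast; ring
  rw [h2]
  field_simp

lemma map_eq_of_periodic {N : ℕ} {f : ℤ → ℤ} (hf : ∀ x, f (x + N) = f x) {a b : ℤ}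
    (h : (N : ℤ) ∣ a - b) : f a = f b := by
  obtain ⟨c, hc⟩ := h
  have h1 : Function.Periodic f (N : ℤ) := hf
  have := h1.int_mul c b
  rw [show a = b + c * N by linarith]
  exact this

lemma sum_range_mul_of_coprime {E : Type*} [AddCommMonoid E] {M N : ℕ} (hM : M ≠ 0) (hN : N ≠ 0)
    (h : M.Coprime N) (F : ℤ → E) (hF : ∀ a b, ((M * N : ℕ) : ℤ) ∣ a - b → F a = F b) :
    ∑ x ∈ Finset.range (M * N), F x =
      ∑ x ∈ Finset.range M, ∑ y ∈ Finset.range N, F (N * x + M * y) := by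
  rw [← Finset.sum_product']
  have hMN : 0 < M * N := Nat.mul_pos (Nat.pos_of_ne_zero hM) (Nat.pos_of_ne_zero hN)
  have hmaps : Set.MapsTo (fun z : ℕ × ℕ => (N * z.1 + M * z.2) % (M * N))
      (Finset.range M ×ˢ Finset.range N : Finset (ℕ × ℕ)) (Finset.range (M * N) : Finset ℕ) :=
    fun z _ => Finset.mem_coe.2 (Finset.mem_range.2 (Nat.mod_lt _ hMN))
  have hinj : Set.InjOn (fun z : ℕ × ℕ => (N * z.1 + M * z.2) % (M * N))
      (Finset.range M ×ˢ Finset.range N : Finset (ℕ × ℕ)) := by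
    rintro ⟨x, y⟩ hz ⟨x', y'⟩ hz' heq
    simp only [Finset.coe_product, Set.mem_prod, Finset.mem_coe, Finset.mem_range] at hz hz'
    have h1 : N * x + M * y ≡ N * x' + M * y' [MOD M * N] := heq
    have hx : N * x ≡ N * x' [MOD M] := by
      have := h1.of_mul_right N
      simpa [Nat.ModEq, Nat.add_mul_mod_self_left] using this
    have hy : M * y ≡ M * y' [MOD N] := by
      have := h1.of_mul_left M
      simpa [Nat.ModEq, Nat.mul_add_mod] using this
    have hx' := (Nat.ModEq.cancel_left_of_coprime h hx).eq_of_lt_of_lt hz.1 hz'.1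
    have hy' := (Nat.ModEq.cancel_left_of_coprime h.symm hy).eq_of_lt_of_lt hz.2 hz'.2
    rw [hx', hy']
  symm
  refine Finset.sum_nbij _ hmaps hinj
    (Finset.surjOn_of_injOn_of_card_le _ hmaps hinj (by simp)) fun z _ => hF _ _ ?_
  have := (Nat.mod_modEq (N * z.1 + M * z.2) (M * N)).symm
  rw [← Int.natCast_modEq_iff] at this
  have := this.symm.dvd
  simpa using this

lemma IsFourierSelfDual.mul {M N : ℕ} (hM : M ≠ 0) (hN : N ≠ 0) (h : M.Coprime N) {f g : ℤ → ℤ}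
    {s t : ℂ} (hf : IsFourierSelfDual M f s) (hg : IsFourierSelfDual N g t) :
    IsFourierSelfDual (M * N) (fun x => f x * g x) (f N * g M * s * t) := by
  have hM' : (M : ℂ) ≠ 0 := Nat.cast_ne_zero.2 hM
  have hN' : (N : ℂ) ≠ 0 := Nat.cast_ne_zero.2 hN
  have hfp : ∀ a b : ℤ, (M : ℤ) ∣ a - b → f a = f b := fun a b => map_eq_of_periodic hf.periodic
  have hgp : ∀ a b : ℤ, (N : ℤ) ∣ a - b → g a = g b := fun a b => map_eq_of_periodic hg.periodic
  refine ⟨fun x => ?_, fun x y => ?_, fun k => ?_⟩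
  · rw [hfp (x + (M * N : ℕ)) x (by push_cast; simp), hgp (x + (M * N : ℕ)) x (by push_cast; simp)]
  · rw [hf.map_mul, hg.map_mul]; ring
  · have key := sum_range_mul_of_coprime hM hN h (fun x : ℤ => ((f x * g x : ℤ) : ℂ) *
      Complex.exp (2 * π * Complex.I * (x * k / (M * N : ℕ)))) ?_
    · simp only [Int.cast_natCast] at key
      rw [key]
      have h1 : ∀ x y : ℕ, ((f (N * x + M * y) * g (N * x + M * y) : ℤ) : ℂ) *
          Complex.exp (2 * π * Complex.I * ((N * x + M * y : ℤ) * k / (M * N : ℕ))) =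
          f N * g M * ((f x * Complex.exp (2 * π * Complex.I * (x * k / M))) *
            (g y * Complex.exp (2 * π * Complex.I * (y * k / N)))) := by
        intro x y
        rw [hfp (N * x + M * y) (N * x) (by simp), hgp (N * x + M * y) (M * y) (by simp),
          hf.map_mul, hg.map_mul]
        have : Complex.exp (2 * π * Complex.I * ((N * x + M * y : ℤ) * k / (M * N : ℕ))) =
            Complex.exp (2 * π * Complex.I * (x * k / M)) *
            Complex.exp (2 * π * Complex.I * (y * k / N)) := by
          rw [← Complex.exp_add]
          congr 1
          push_cast
          field_simp
        rw [this]
        push_cast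
        ring
      simp only [h1]
      simp only [← Finset.mul_sum, ← Finset.sum_mul]
      rw [hf.dual, hg.dual]
      push_cast
      ring
    · intro a b hab
      have ha : (M : ℤ) ∣ a - b := (Dvd.intro _ (by push_cast; rfl)).trans hab
      have hb : (N : ℤ) ∣ a - b := (Dvd.intro_left _ (by push_cast; rfl)).trans hab
      have := exp_two_pi_I_int_div (Nat.mul_ne_zero hM hN) (a := a * k) (b := b * k)
        (by rw [← sub_mul]; exact hab.mul_right k)
      rw [hfp a b ha, hgp a b hb]
      push_cast at this ⊢
      rw [this]

lemma IsFourierSelfDual.of_lt {N : ℕ} (hN : N ≠ 0) {f : ℤ → ℤ} {s : ℂ}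
    (hf : ∀ x, f (x + N) = f x) (hm : ∀ x y, f (x * y) = f x * f y)
    (h : ∀ k < N, ∑ x ∈ Finset.range N,
      (f x : ℂ) * Complex.exp (2 * π * Complex.I / N) ^ (x * k) = s * f k) :
    IsFourierSelfDual N f s := by
  refine ⟨hf, hm, fun k => ?_⟩
  have hN0 : (0 : ℤ) < N := by exact_mod_cast Nat.pos_of_ne_zero hN
  obtain ⟨r, hr⟩ := Int.eq_ofNat_of_zero_le (Int.emod_nonneg k hN0.ne')
  have hrN : r < N := by
    have := Int.emod_lt_of_pos k hN0
    omega
  have hk : (N : ℤ) ∣ k - r := by rw [← hr]; exact Int.dvd_self_sub_emod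
  rw [map_eq_of_periodic hf hk, ← h r hrN]
  refine Finset.sum_congr rfl fun x _ => ?_
  have h1 := exp_two_pi_I_int_div hN (a := x * k) (b := x * r)
    (by rw [← mul_sub]; exact hk.mul_left _)
  push_cast at h1
  rw [h1, ← Complex.exp_nat_mul]
  congr 2
  push_cast
  ring

end FourierSelfDual

section FourierSelfDual

open Real

lemma sum_range_natCast_zmod {E : Type*} [AddCommMonoid E] {N : ℕ} [NeZero N] (F : ZMod N → E) :
    ∑ x ∈ Finset.range N, F x = ∑ x, F x := by
  symm
  refine Finset.sum_nbij' ZMod.val (fun j : ℕ => (j : ZMod N))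
    (fun x _ => Finset.mem_range.2 (ZMod.val_lt x)) (fun _ _ => Finset.mem_univ _)
    (fun x _ => ZMod.natCast_zmod_val x)
    (fun j hj => ZMod.val_cast_of_lt (Finset.mem_range.1 hj)) (fun x _ => ?_)
  rw [ZMod.natCast_zmod_val x]

lemma stdAddChar_natCast {N : ℕ} [NeZero N] (x : ℕ) :
    ZMod.stdAddChar (x : ZMod N) = Complex.exp (2 * π * Complex.I / N) ^ x := by
  have := ZMod.stdAddChar_coe (N := N) (x : ℤ)
  rw [Int.cast_natCast] at this
  rw [this, ← Complex.exp_nat_mul]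
  congr 1
  push_cast
  ring

lemma isFourierSelfDual_legendreSym {p m : ℕ} [hp : Fact p.Prime] (hpm : p = 2 * m + 1) :
    IsFourierSelfDual p (fun x => legendreSym p x) ((if Even m then 1 else Complex.I) * √p) := by
  refine IsFourierSelfDual.of_lt hp.out.ne_zero (fun x => ?_) (fun x y => legendreSym.mul p x y)
    fun k hk => ?_
  · simp [legendreSym]
  · rw [← sum_legendreSym_mul_exp hpm]
    set χ := (quadraticChar (ZMod p)).ringHomComp (Int.castRingHom ℂ) with hχ
    have h1 : ∀ k : ℕ, ∑ x ∈ Finset.range p, (legendreSym p x : ℂ) *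
        Complex.exp (2 * π * Complex.I / p) ^ (x * k) =
        gaussSum χ (AddChar.mulShift ZMod.stdAddChar (k : ZMod p)) := by
      intro k
      rw [gaussSum, ← sum_range_natCast_zmod]
      refine Finset.sum_congr rfl fun x _ => ?_
      rw [AddChar.mulShift_apply, ← Nat.cast_mul, stdAddChar_natCast, hχ, mul_comm k x]
      simp [legendreSym]
    have h2 := h1 1
    simp only [mul_one] at h2
    rw [h1, h2, Nat.cast_one, AddChar.mulShift_one]
    have hne : χ ≠ 1 := (MulChar.ringHomComp_ne_one_iff Int.cast_injective).2
      (quadraticChar_ne_one (by rw [ZMod.ringChar_zmod_n]; have := hp.out.two_le; omega))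
    have hf : ((legendreSym p k : ℤ) : ℂ) = χ (k : ZMod p) := by simp [hχ, legendreSym]
    rw [hf]
    by_cases hk0 : (k : ZMod p) = 0
    · rw [hk0, AddChar.mulShift_zero, gaussSum, MulChar.map_zero, mul_zero]
      simpa using MulChar.sum_eq_zero_of_ne_one hne
    · have h4 := gaussSum_mulShift χ ZMod.stdAddChar (Units.mk0 _ hk0)
      rw [Units.val_mk0] at h4
      rw [← h4]
      have h3 : χ (k : ZMod p) * χ (k : ZMod p) = 1 := by
        rw [← hf, ← Int.cast_mul, ← sq, legendreSym.sq_one]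
        · simp
        · simpa using hk0
      linear_combination (-gaussSum χ (AddChar.mulShift ZMod.stdAddChar (k : ZMod p))) * h3

lemma isFourierSelfDual_χ₄ : IsFourierSelfDual 4 (fun x => ZMod.χ₄ x) (2 * Complex.I) := by
  refine IsFourierSelfDual.of_lt (by norm_num) (fun x => ?_) (fun x y => (congrArg ZMod.χ₄ (Int.cast_mul x y)).trans (map_mul ZMod.χ₄ _ _)) fun k hk => ?_
  · congr 1
    have : (4 : ZMod 4) = 0 := rfl
    push_cast
    rw [this, add_zero]
  · have h : Complex.exp (2 * π * Complex.I / (4 : ℕ)) = Complex.I := by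
      rw [show (2 * π * Complex.I / (4 : ℕ) : ℂ) = π / 2 * Complex.I by push_cast; ring,
        Complex.exp_pi_div_two_mul_I]
    have c0 : ZMod.χ₄ 0 = 0 := rfl
    have c1 : ZMod.χ₄ 1 = 1 := rfl
    have c2 : ZMod.χ₄ 2 = 0 := rfl
    have c3 : ZMod.χ₄ 3 = -1 := rfl
    rw [h]
    have hI := Complex.I_sq
    interval_cases k <;> simp [Finset.sum_range_succ, c0, c1, c2, c3] <;> grind

lemma exp_eighth_root : ∃ ω : ℂ, Complex.exp (2 * π * Complex.I / (8 : ℕ)) = ω ∧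
    ω ^ 2 = Complex.I ∧ 2 * ω - 2 * ω ^ 3 = √8 := by
  refine ⟨_, rfl, ?_, ?_⟩
  · rw [← Complex.exp_nat_mul,
      show (((2 : ℕ) : ℂ) * (2 * π * Complex.I / (8 : ℕ)) : ℂ) = π / 2 * Complex.I by
        push_cast; ring,
      Complex.exp_pi_div_two_mul_I]
  · have h2 : Complex.exp (2 * π * Complex.I / (8 : ℕ)) = (√2 / 2 : ℝ) + (√2 / 2 : ℝ) * Complex.I := by
      rw [show (2 * π * Complex.I / (8 : ℕ) : ℂ) = (π / 4 : ℝ) * Complex.I by push_cast; ring,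
        Complex.exp_mul_I, ← Complex.ofReal_cos, ← Complex.ofReal_sin, Real.cos_pi_div_four,
        Real.sin_pi_div_four]
    have h3 : √8 = 2 * √2 := by
      rw [show (8 : ℝ) = 2 ^ 2 * 2 by norm_num, Real.sqrt_mul (by norm_num),
        Real.sqrt_sq (by norm_num)]
    have h4 : (√2 : ℂ) ^ 2 = 2 := by
      rw [← Complex.ofReal_pow, Real.sq_sqrt (by norm_num)]; simp
    rw [h2, h3]
    push_cast
    have hI := Complex.I_sq
    grind

lemma isFourierSelfDual_χ₈ : IsFourierSelfDual 8 (fun x => ZMod.χ₈ x) (√8 : ℝ) := by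
  refine IsFourierSelfDual.of_lt (by norm_num) (fun x => ?_) (fun x y => (congrArg ZMod.χ₈ (Int.cast_mul x y)).trans (map_mul ZMod.χ₈ _ _)) fun k hk => ?_
  · congr 1
    have : (8 : ZMod 8) = 0 := rfl
    push_cast
    rw [this, add_zero]
  · obtain ⟨ω, h, h1, h2⟩ := exp_eighth_root
    have c0 : ZMod.χ₈ 0 = 0 := rfl
    have c1 : ZMod.χ₈ 1 = 1 := rfl
    have c2 : ZMod.χ₈ 2 = 0 := rfl
    have c3 : ZMod.χ₈ 3 = -1 := rfl
    have c4 : ZMod.χ₈ 4 = 0 := rfl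
    have c5 : ZMod.χ₈ 5 = -1 := rfl
    have c6 : ZMod.χ₈ 6 = 0 := rfl
    have c7 : ZMod.χ₈ 7 = 1 := rfl
    rw [h, ← h2]
    have h4 : ω ^ 4 = -1 := by linear_combination (ω ^ 2 + Complex.I) * h1 + Complex.I_sq
    clear h1 h2 h
    interval_cases k <;> simp [Finset.sum_range_succ, c0, c1, c2, c3, c4, c5, c6, c7] <;> grind

lemma isFourierSelfDual_χ₈' :
    IsFourierSelfDual 8 (fun x => ZMod.χ₈' x) (Complex.I * (√8 : ℝ)) := by
  refine IsFourierSelfDual.of_lt (by norm_num) (fun x => ?_) (fun x y => (congrArg ZMod.χ₈' (Int.cast_mul x y)).trans (map_mul ZMod.χ₈' _ _)) fun k hk => ?_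
  · congr 1
    have : (8 : ZMod 8) = 0 := rfl
    push_cast
    rw [this, add_zero]
  · obtain ⟨ω, h, h1, h2⟩ := exp_eighth_root
    have c0 : ZMod.χ₈' 0 = 0 := rfl
    have c1 : ZMod.χ₈' 1 = 1 := rfl
    have c2 : ZMod.χ₈' 2 = 0 := rfl
    have c3 : ZMod.χ₈' 3 = 1 := rfl
    have c4 : ZMod.χ₈' 4 = 0 := rfl
    have c5 : ZMod.χ₈' 5 = -1 := rfl
    have c6 : ZMod.χ₈' 6 = 0 := rfl
    have c7 : ZMod.χ₈' 7 = -1 := rfl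
    rw [h, ← h2, ← h1]
    have h4 : ω ^ 4 = -1 := by linear_combination (ω ^ 2 + Complex.I) * h1 + Complex.I_sq
    clear h1 h2 h
    interval_cases k <;> simp [Finset.sum_range_succ, c0, c1, c2, c3, c4, c5, c6, c7] <;> grind

end FourierSelfDual

section FourierSelfDual

open Real

lemma jacobiSym_mul_jacobiSym {a b : ℕ} (ha : Odd a) (hb : Odd b) (h : a.Coprime b) :
    jacobiSym a b * jacobiSym b a = if a % 4 = 3 ∧ b % 4 = 3 then -1 else 1 := by
  have h1 := jacobiSym.quadratic_reciprocity_if (Nat.odd_iff.1 ha) (Nat.odd_iff.1 hb)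
  have h2 : jacobiSym b a ^ 2 = 1 := jacobiSym.sq_one (by
    rw [Int.gcd_natCast_natCast]; exact h.symm)
  rw [← h1]
  split_ifs <;> linarith

lemma isFourierSelfDual_jacobiSym {c : ℕ} (hc : Odd c) (hsq : Squarefree c) :
    IsFourierSelfDual c (fun x => jacobiSym x c)
      ((if c % 4 = 1 then 1 else Complex.I) * (√c : ℝ)) := by
  induction c using induction_on_primes with
  | zero => simp at hc
  | one => exact ⟨fun x => by simp, fun x y => by simp, fun k => by simp⟩
  | prime_mul p a hp ih =>
    have : Fact p.Prime := ⟨hp⟩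
    obtain ⟨hpo, hao⟩ := Nat.odd_mul.1 hc
    have hcop : p.Coprime a := Nat.coprime_of_squarefree_mul hsq
    have ha0 : a ≠ 0 := by rintro rfl; simp at hao
    obtain ⟨m, hm⟩ := hpo
    have h1 := IsFourierSelfDual.mul hp.ne_zero ha0 hcop (isFourierSelfDual_legendreSym hm)
      (ih hao (hsq.squarefree_of_dvd (dvd_mul_left _ _)))
    have h2 := jacobiSym_mul_jacobiSym ⟨m, hm⟩ hao hcop
    rw [mul_comm] at h2
    simp only [jacobiSym.legendreSym.to_jacobiSym] at h1
    have h3 : (fun x : ℤ => jacobiSym x (p * a)) = fun x : ℤ => jacobiSym x p * jacobiSym x a := by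
      funext x
      have : NeZero a := ⟨ha0⟩
      have : NeZero p := ⟨hp.ne_zero⟩
      exact jacobiSym.mul_right x p a
    rw [h3]
    convert! h1 using 1
    have h4 : ((√(p * a : ℕ) : ℝ) : ℂ) = √p * √a := by
      rw [Nat.cast_mul, Real.sqrt_mul (Nat.cast_nonneg _)]; simp
    rw [← Int.cast_mul, h2, h4]
    have hev : Even m ↔ p % 4 = 1 := by rw [Nat.even_iff]; omega
    have ha4 : a % 4 = 1 ∨ a % 4 = 3 := by have := Nat.odd_iff.1 hao; omega
    have hp4 : p % 4 = 1 ∨ p % 4 = 3 := by omega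
    have hI := Complex.I_mul_I
    simp only [hev]
    rcases ha4 with h5 | h5 <;> rcases hp4 with h6 | h6 <;> simp [Nat.mul_mod, h5, h6]
    · ring
    · ring
    · linear_combination ((√p : ℂ) * √a) * hI

lemma jacobiSym_eight {b : ℕ} (hb : Odd b) : jacobiSym 8 b = ZMod.χ₈ b := by
  rw [show (8 : ℤ) = 4 * 2 by norm_num, jacobiSym.mul_left, jacobiSym.at_four hb, one_mul,
    jacobiSym.at_two hb]

lemma χ₄_mul_jacobiSym {m l : ℕ} (hm : m % 4 = 3) (hl : Odd l) :
    ZMod.χ₄ l * jacobiSym l m = jacobiSym m l := by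
  rcases (by have := Nat.odd_iff.1 hl; omega : l % 4 = 1 ∨ l % 4 = 3) with h | h
  · rw [ZMod.χ₄_nat_one_mod_four h, one_mul]
    exact jacobiSym.quadratic_reciprocity_one_mod_four h (Nat.odd_iff.2 (by omega))
  · rw [ZMod.χ₄_nat_three_mod_four h, jacobiSym.quadratic_reciprocity_three_mod_four hm h]
    ring

lemma isFourierSelfDual_kron {D : ℤ} (hD : IsFundDisc D) (h0 : 0 < D) :
    ∃ f : ℤ → ℤ, IsFourierSelfDual D.toNat f (√(D : ℝ) : ℝ) ∧ ∀ n : ℕ, n ≠ 0 → f n = kron D n := by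
  obtain ⟨N, rfl⟩ := Int.eq_ofNat_of_zero_le h0.le
  rw [Int.toNat_natCast, Int.cast_natCast]
  suffices h : ∃ f : ℤ → ℤ, IsFourierSelfDual N f (√N : ℝ) ∧
      f 1 = 1 ∧ ∀ l : ℕ, l.Prime → f l = kron N l by
    obtain ⟨f, hf, h1, hl⟩ := h
    refine ⟨f, hf, fun n => ?_⟩
    induction n using induction_on_primes with
    | zero => exact fun h => absurd rfl h
    | one => exact fun _ => by rw [kron_one]; exact h1
    | prime_mul p a hp ih =>
      intro h
      have ha := right_ne_zero_of_mul h
      rw [Nat.cast_mul, hf.map_mul, kron_mul _ hp.ne_zero ha, hl p hp, ih ha]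
  obtain ⟨h1, -, h2⟩ := hD
  have hsq : ∀ m : ℕ, Odd m → m ∣ N → Squarefree m := by
    intro m hm hmN
    rw [Nat.squarefree_iff_prime_squarefree]
    intro l hl hlm
    have := (h2 l hl (by rw [sq]; exact_mod_cast hlm.trans hmN)).1
    subst this
    exact Nat.not_even_iff_odd.2 hm ((even_iff_two_dvd.2 (dvd_mul_right 2 2)).trans_dvd hlm)
  rcases h1 with h1 | h1
  · have h4 := (h2 2 Nat.prime_two (by norm_num; omega)).2
    rcases h4 with h4 | h4
    · obtain ⟨m, rfl⟩ : ∃ m, N = 8 * m := ⟨N / 8, by omega⟩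
      have hm : Odd m := Nat.odd_iff.2 (by omega)
      have hcop : Nat.Coprime 8 m := Nat.Coprime.pow_left 3 (Nat.coprime_two_left.2 hm)
      have h3 := isFourierSelfDual_jacobiSym hm (hsq m hm (dvd_mul_left m 8))
      have hsqrt : ((√(8 * m : ℕ) : ℝ) : ℂ) = √8 * √m := by
        rw [Nat.cast_mul, Real.sqrt_mul (Nat.cast_nonneg _)]; simp
      have hm8 := jacobiSym_eight hm
      have hχ : (ZMod.χ₈ m : ℂ) * ZMod.χ₈ m = 1 := by
        rw [ZMod.χ₈_nat_eq_if_mod_eight, if_neg (by omega)]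
        split_ifs <;> simp
      have hl : ∀ l : ℕ, l.Prime → l ≠ 2 →
          kron ((8 * m : ℕ) : ℤ) l = ZMod.χ₈ l * jacobiSym m l := by
        intro l hl h2
        rw [kron_odd_prime _ hl h2, Nat.cast_mul, jacobiSym.mul_left, Nat.cast_ofNat,
          jacobiSym_eight (hl.odd_of_ne_two h2)]
      have hk2 : kron ((8 * m : ℕ) : ℤ) 2 = 0 := by rw [kron_two, if_pos (by omega)]
      rcases (by omega : m % 4 = 1 ∨ m % 4 = 3) with hm4 | hm4
      · have h5 := isFourierSelfDual_χ₈.mul (by norm_num) (by omega) hcop h3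
        refine ⟨fun x => ZMod.χ₈ x * jacobiSym x m, ?_, ?_, fun l hlp => ?_⟩
        · rw [hsqrt]
          convert! h5 using 1
          rw [if_pos hm4, Nat.cast_ofNat, hm8]
          push_cast
          linear_combination (-(√8 : ℂ) * √m) * hχ
        · simp
        · rcases eq_or_ne l 2 with rfl | h2
          · rw [hk2]
            exact mul_eq_zero_of_left rfl _
          · rw [hl l hlp h2]
            push_cast
            rw [jacobiSym.quadratic_reciprocity_one_mod_four hm4 (hlp.odd_of_ne_two h2)]
      · have h5 := isFourierSelfDual_χ₈'.mul (by norm_num) (by omega) hcop h3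
        refine ⟨fun x => ZMod.χ₈' x * jacobiSym x m, ?_, ?_, fun l hlp => ?_⟩
        · rw [hsqrt]
          convert! h5 using 1
          rw [if_neg (by omega), Nat.cast_ofNat, hm8, ZMod.χ₈'_int_eq_χ₄_mul_χ₈,
            ZMod.χ₄_int_three_mod_four (by omega)]
          push_cast
          linear_combination (-(√8 : ℂ) * √m) * hχ +
            (√8 : ℂ) * √m * ZMod.χ₈ m * ZMod.χ₈ m * Complex.I_sq
        · simp
        · rcases eq_or_ne l 2 with rfl | h2
          · rw [hk2]
            exact mul_eq_zero_of_left rfl _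
          · rw [hl l hlp h2, ← χ₄_mul_jacobiSym hm4 (hlp.odd_of_ne_two h2)]
            beta_reduce
            rw [ZMod.χ₈'_int_eq_χ₄_mul_χ₈]
            push_cast
            ring
    · obtain ⟨m, rfl⟩ : ∃ m, N = 4 * m := ⟨N / 4, by omega⟩
      have hm4 : m % 4 = 3 := by omega
      have hm : Odd m := Nat.odd_iff.2 (by omega)
      have hcop : Nat.Coprime 4 m := Nat.Coprime.pow_left 2 (Nat.coprime_two_left.2 hm)
      have h3 := isFourierSelfDual_jacobiSym hm (hsq m hm (dvd_mul_left m 4))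
      have hsqrt : ((√(4 * m : ℕ) : ℝ) : ℂ) = 2 * √m := by
        rw [Nat.cast_mul, Real.sqrt_mul (Nat.cast_nonneg _), Nat.cast_ofNat,
          show (4 : ℝ) = 2 ^ 2 by norm_num, Real.sqrt_sq (by norm_num)]
        simp
      have h5 := isFourierSelfDual_χ₄.mul (by norm_num) (by omega) hcop h3
      refine ⟨fun x => ZMod.χ₄ x * jacobiSym x m, ?_, ?_, fun l hlp => ?_⟩
      · rw [hsqrt]
        convert! h5 using 1
        rw [if_neg (by omega), Nat.cast_ofNat, jacobiSym.at_four hm,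
          ZMod.χ₄_int_three_mod_four (by omega)]
        push_cast
        linear_combination 2 * (√m : ℂ) * Complex.I_sq
      · simp
      · rcases eq_or_ne l 2 with rfl | h2
        · rw [kron_two, if_pos (by omega)]
          exact mul_eq_zero_of_left rfl _
        · rw [kron_odd_prime _ hlp h2, Nat.cast_mul, jacobiSym.mul_left, Nat.cast_ofNat,
            jacobiSym.at_four (hlp.odd_of_ne_two h2), one_mul]
          push_cast
          exact χ₄_mul_jacobiSym hm4 (hlp.odd_of_ne_two h2)
  · have hN : N % 4 = 1 := by omega
    have hNo : Odd N := Nat.odd_iff.2 (by omega)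
    have h3 := isFourierSelfDual_jacobiSym hNo (hsq N hNo dvd_rfl)
    rw [if_pos hN, one_mul] at h3
    refine ⟨_, h3, jacobiSym.one_left N, fun l hl => ?_⟩
    rcases hl.eq_two_or_odd' with rfl | h2
    · rw [kron_two, Nat.cast_ofNat, jacobiSym.at_two hNo, ZMod.χ₈_nat_eq_if_mod_eight]
      split_ifs <;> first | rfl | omega
    · rw [kron_odd_prime _ hl (by rintro rfl; exact absurd h2 (by decide))]
      exact (jacobiSym.quadratic_reciprocity_one_mod_four hN h2).symm

end FourierSelfDual

section QuadraticOrder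

/-- `1, ω` is a `ℤ`-basis of the ring `R`. -/
structure IsIntegralGenerator {R : Type*} [CommRing R] (ω : R) : Prop where
  exists_eq : ∀ x : R, ∃ u v : ℤ, x = u + v * ω
  eq_zero : ∀ u v : ℤ, (u : R) + v * ω = 0 → u = 0 ∧ v = 0

variable {R : Type*} [CommRing R] {ω : R}

theorem IsIntegralGenerator.ext (h : IsIntegralGenerator ω) {u v u' v' : ℤ}
    (he : (u : R) + v * ω = u' + v' * ω) : u = u' ∧ v = v' := by
  have := h.eq_zero (u - u') (v - v') (by push_cast; linear_combination he)
  omega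

theorem IsIntegralGenerator.add_int (h : IsIntegralGenerator ω) (c : ℤ) :
    IsIntegralGenerator (ω + c) where
  exists_eq x := by
    obtain ⟨u, v, rfl⟩ := h.exists_eq x
    exact ⟨u - v * c, v, by push_cast; ring⟩
  eq_zero u v he := by
    obtain ⟨h1, h2⟩ := h.eq_zero (u + v * c) v (by push_cast; linear_combination he)
    subst h2
    simpa using h1

theorem IsIntegralGenerator.exists_sq_eq (h : IsIntegralGenerator ω) :
    ∃ (ω' : R) (t ν : ℤ), IsIntegralGenerator ω' ∧ (t = 0 ∨ t = 1) ∧ ω' ^ 2 = t * ω' - ν := by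
  obtain ⟨u, v, huv⟩ := h.exists_eq (ω ^ 2)
  obtain ⟨c, hc⟩ : ∃ c, v / 2 = c := ⟨_, rfl⟩
  have hv : ((v % 2 : ℤ) : R) = v - 2 * c := by
    rw [show v % 2 = v - 2 * c by omega]
    push_cast
    ring
  refine ⟨ω + (-c : ℤ), v % 2, c * c - v * c - u, h.add_int _, by omega, ?_⟩
  rw [hv]
  push_cast
  linear_combination huv

/-- The basis `1, ω`. -/
def IsIntegralGenerator.basis (h : IsIntegralGenerator ω) : Basis (Fin 2) ℤ R :=
  Basis.mk (v := ![1, ω])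
    (by
      rw [LinearIndependent.pair_iff]
      intro s t hst
      exact h.eq_zero s t (by simpa using hst))
    (by
      intro x _
      obtain ⟨u, v, rfl⟩ := h.exists_eq x
      rw [Matrix.range_cons, Matrix.range_cons, Matrix.range_empty, Set.union_empty,
        Set.singleton_union, Submodule.mem_span_pair]
      exact ⟨u, v, by simp⟩)

theorem IsIntegralGenerator.basis_zero (h : IsIntegralGenerator ω) : h.basis 0 = 1 := by
  simp [IsIntegralGenerator.basis]

theorem IsIntegralGenerator.basis_one (h : IsIntegralGenerator ω) : h.basis 1 = ω := by
  simp [IsIntegralGenerator.basis]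

theorem IsIntegralGenerator.basis_repr (h : IsIntegralGenerator ω) {u v : ℤ} {x : R}
    (hx : x = u + v * ω) : h.basis.repr x 0 = u ∧ h.basis.repr x 1 = v := by
  have : x = u • h.basis 0 + v • h.basis 1 := by simp [hx, h.basis_zero, h.basis_one]
  rw [this]
  simp [-zsmul_eq_mul]

theorem IsIntegralGenerator.discr_basis (h : IsIntegralGenerator ω) {t ν : ℤ}
    (hω : ω ^ 2 = t * ω - ν) : Algebra.discr ℤ h.basis = t ^ 2 - 4 * ν := by
  have htr : ∀ u v : ℤ, ∀ x : R, x = u + v * ω → Algebra.trace ℤ R x = 2 * u + t * v := by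
    rintro u v x rfl
    rw [Algebra.trace_eq_matrix_trace h.basis, Matrix.trace, Fin.sum_univ_two, Matrix.diag,
      Matrix.diag, Algebra.leftMulMatrix_eq_repr_mul, Algebra.leftMulMatrix_eq_repr_mul, h.basis_zero, h.basis_one,
      (h.basis_repr (u := u) (v := v) (mul_one _)).1, (h.basis_repr (u := -v * ν) (v := u + v * t) ?_).2]
    · ring
    · push_cast
      linear_combination v * hω
  rw [Algebra.discr_def, Matrix.det_fin_two]
  simp only [Algebra.traceMatrix_apply, Algebra.traceForm_apply, h.basis_zero, h.basis_one]
  rw [htr 1 0 _ (by simp), htr 0 1 (1 * ω) (by simp), htr 0 1 (ω * 1) (by simp),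
    htr (-ν) t (ω * ω) (by push_cast; linear_combination hω)]
  ring

end QuadraticOrder

section QuadraticField

open NumberField

variable {K : Type*} [Field K] [NumberField K]

theorem RingOfIntegers.exists_eq_mul_of_sq {α : 𝓞 K} {n s r : ℤ} (hn : n ≠ 0)
    (h : α ^ 2 - n * s * α + n ^ 2 * r = 0) : ∃ y : 𝓞 K, α = n * y := by
  have hK : (α : K) ^ 2 - n * s * α + n ^ 2 * r = 0 := by
    have := congrArg (algebraMap (𝓞 K) K) h
    simpa using this
  have hn' : (n : K) ≠ 0 := by exact_mod_cast hn
  have hz : IsIntegral ℤ ((α : K) / n) := by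
    refine ⟨Polynomial.X ^ 2 - Polynomial.C s * Polynomial.X + Polynomial.C r, ?_, ?_⟩
    · monicity!
    · simp only [Polynomial.eval₂_add, Polynomial.eval₂_sub, Polynomial.eval₂_mul,
        Polynomial.eval₂_pow, Polynomial.eval₂_X, Polynomial.eval₂_C, algebraMap_int_eq]
      rw [eq_intCast, eq_intCast]
      field_simp
      linear_combination hK
  obtain ⟨y, hy⟩ : ∃ y : 𝓞 K, (y : K) = α / n := ⟨⟨_, hz⟩, rfl⟩
  refine ⟨y, RingOfIntegers.ext ?_⟩
  change algebraMap (𝓞 K) K α = algebraMap (𝓞 K) K (n * y)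
  rw [map_mul, map_intCast, show algebraMap (𝓞 K) K y = algebraMap (𝓞 K) K α / n from hy]
  field_simp

theorem exists_isIntegralGenerator (hdeg : finrank ℚ K = 2) :
    ∃ ω : 𝓞 K, IsIntegralGenerator ω := by
  have b := finBasisOfFinrankEq ℤ (𝓞 K) ((RingOfIntegers.rank K).trans hdeg)
  have hb : ∀ x : 𝓞 K, x = b.repr x 0 * b 0 + b.repr x 1 * b 1 := by
    intro x
    conv_lhs => rw [← b.sum_repr x]
    simp [Fin.sum_univ_two]
  have hb0 : ∀ u v : ℤ, (u : 𝓞 K) * b 0 + v * b 1 = 0 → u = 0 ∧ v = 0 := by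
    intro u v h
    exact LinearIndependent.pair_iff.1 (by
      have := b.linearIndependent
      rwa [show (b : Fin 2 → 𝓞 K) = ![b 0, b 1] from List.ofFn_inj.1 rfl] at this) u v (by simpa using h)
  obtain ⟨a, ha⟩ : ∃ a, b.repr 1 0 = a := ⟨_, rfl⟩
  obtain ⟨c, hc⟩ : ∃ c, b.repr 1 1 = c := ⟨_, rfl⟩
  have h1 := hb 1
  rw [ha, hc] at h1
  have hgcd : IsCoprime a c := by
    rw [Int.isCoprime_iff_gcd_eq_one]
    obtain ⟨g, hg⟩ : ∃ g, Int.gcd a c = g := ⟨_, rfl⟩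
    obtain ⟨a', ha'⟩ : (g : ℤ) ∣ a := hg ▸ Int.gcd_dvd_left a c
    obtain ⟨c', hc'⟩ : (g : ℤ) ∣ c := hg ▸ Int.gcd_dvd_right a c
    rw [hg]
    rw [ha', hc'] at h1
    push_cast at h1
    obtain ⟨p, q, hpq⟩ : ∃ p q : ℤ, (a' * b 0 + c' * b 1) * b 0 = p * b 0 + q * b 1 :=
      ⟨_, _, hb _⟩
    have := (hb0 (1 - g * p) (-(g * q)) (by
      push_cast
      linear_combination b 0 * h1 + g * hpq)).1
    have : (g : ℤ) ∣ 1 := ⟨p, by omega⟩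
    exact Nat.dvd_one.1 (by exact_mod_cast this)
  obtain ⟨u, v, huv⟩ := hgcd
  have huv' : (u : 𝓞 K) * a + v * c = 1 := by exact_mod_cast congrArg (Int.cast (R := 𝓞 K)) huv
  refine ⟨-v * b 0 + u * b 1, ⟨fun x => ?_, fun r s h => ?_⟩⟩
  · refine ⟨u * b.repr x 0 + v * b.repr x 1, a * b.repr x 1 - c * b.repr x 0, ?_⟩
    push_cast
    have := hb x
    obtain ⟨p, hp⟩ : ∃ p, b.repr x 0 = p := ⟨_, rfl⟩
    obtain ⟨q, hq⟩ : ∃ q, b.repr x 1 = q := ⟨_, rfl⟩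
    rw [hp, hq] at this ⊢
    linear_combination this - (u * p + v * q) * h1 - (p * b 0 + q * b 1) * huv'
  · have h2 := hb0 (r * a - s * v) (r * c + s * u) (by
      push_cast
      linear_combination h - r * h1)
    grind

theorem isFundDisc_of_isIntegralGenerator {ω : 𝓞 K} (h : IsIntegralGenerator ω) {t ν : ℤ}
    (ht : t = 0 ∨ t = 1) (hω : ω ^ 2 = t * ω - ν) : IsFundDisc (t ^ 2 - 4 * ν) := by
  refine ⟨by rcases ht with rfl | rfl <;> omega, ?_, fun l hl hlD => ?_⟩
  · rintro ⟨r, hr⟩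
    have hr' : (t : 𝓞 K) ^ 2 - 4 * ν = r * r := by exact_mod_cast congrArg (Int.cast (R := 𝓞 K)) hr
    have h2 : ((-t - r : ℤ) + (2 : ℤ) * ω) * ((-t + r : ℤ) + (2 : ℤ) * ω) = 0 := by
      push_cast
      linear_combination 4 * hω + hr'
    rcases mul_eq_zero.1 h2 with h2 | h2
    · have := (h.eq_zero _ _ h2).2
      omega
    · have := (h.eq_zero _ _ h2).2
      omega
  · have key : ∀ (u v s r : ℤ), (u + v * ω : 𝓞 K) ^ 2 - l * s * (u + v * ω) + l ^ 2 * r = 0 →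
        (l : ℤ) ∣ v := by
      intro u v s r hs
      obtain ⟨y, hy⟩ := RingOfIntegers.exists_eq_mul_of_sq (n := l) (s := s) (r := r)
        (by exact_mod_cast hl.ne_zero) (by exact_mod_cast hs)
      obtain ⟨u', v', rfl⟩ := h.exists_eq y
      exact ⟨v', (h.ext (u' := l * u') (v' := l * v') (by rw [hy]; push_cast; ring)).2⟩
    obtain ⟨e, he⟩ := hlD
    have he' : (t : 𝓞 K) ^ 2 - 4 * ν = l ^ 2 * e := by
      exact_mod_cast congrArg (Int.cast (R := 𝓞 K)) he
    have hl2 : l = 2 := by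
      have := key (-t) 2 0 (-e) (by push_cast; linear_combination 4 * hω + he')
      exact (Nat.prime_dvd_prime_iff_eq hl Nat.prime_two).1 (by exact_mod_cast this)
    subst hl2
    refine ⟨rfl, ?_⟩
    have ht0 : t = 0 := by
      rcases ht with rfl | rfl
      · rfl
      · push_cast at he
        omega
    subst ht0
    by_contra hcon
    have : (-ν) % 4 = 0 ∨ (-ν) % 4 = 1 := by
      push_cast at he
      omega
    rcases this with h4 | h4
    · obtain ⟨d, hd⟩ : ∃ d, ν = 4 * d := ⟨ν / 4, by omega⟩
      have := key 0 1 0 d (by rw [hd] at hω; push_cast at hω ⊢; linear_combination hω)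
      norm_num at this
    · obtain ⟨d, hd⟩ : ∃ d, ν = 4 * d - 1 := ⟨(ν + 1) / 4, by omega⟩
      have := key 1 1 1 d (by rw [hd] at hω; push_cast at hω ⊢; linear_combination hω)
      norm_num at this

/-- The ring of integers of a real quadratic field of discriminant `D`. -/
theorem exists_generator_of_real_quadratic (hreal : ∀ φ : K →+* ℂ, ∀ x, (φ x).im = 0)
    (hdeg : finrank ℚ K = 2) :
    ∃ (ω : 𝓞 K) (t ν : ℤ), IsIntegralGenerator ω ∧ (t = 0 ∨ t = 1) ∧ ω ^ 2 = t * ω - ν ∧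
      discr K = t ^ 2 - 4 * ν ∧ IsFundDisc (discr K) ∧ 0 < discr K := by
  obtain ⟨ω₀, h₀⟩ := exists_isIntegralGenerator hdeg
  obtain ⟨ω, t, ν, h, ht, hω⟩ := h₀.exists_sq_eq
  have hd : discr K = t ^ 2 - 4 * ν := by
    rw [← NumberField.discr_eq_discr K h.basis, h.discr_basis hω]
  have hf : IsFundDisc (discr K) := hd ▸ isFundDisc_of_isIntegralGenerator h ht hω
  refine ⟨ω, t, ν, h, ht, hω, hd, hf, ?_⟩
  have hne : discr K ≠ 0 := fun h => hf.2.1 (h ▸ IsSquare.zero)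
  refine lt_of_le_of_ne ?_ hne.symm
  obtain ⟨φ⟩ : Nonempty (K →+* ℂ) := inferInstance
  have hφ := hreal φ (2 * (ω : K) - t)
  have h2 : (2 * (ω : K) - t) ^ 2 = (discr K : ℤ) := by
    have := congrArg (algebraMap (𝓞 K) K) hω
    rw [hd]
    push_cast
    simp only [map_pow, map_sub, map_mul, map_intCast] at this
    linear_combination 4 * this
  have h3 := congrArg φ h2
  rw [map_pow, map_intCast] at h3
  have h4 := congrArg Complex.re h3
  rw [sq, Complex.mul_re, hφ, Complex.intCast_re] at h4
  have : (0 : ℝ) ≤ discr K := by rw [← h4]; nlinarith [sq_nonneg (φ (2 * (ω : K) - t)).re]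
  exact_mod_cast this

end QuadraticField

section IdealCount

variable {R : Type*} [CommRing R] {ω : R} {t ν : ℤ}

/-- The ring homomorphism `ℤ[ω] → ℤ/A` determined by a root modulo `A` of the minimal
polynomial of `ω`. -/
def IsIntegralGenerator.rootHom (h : IsIntegralGenerator ω) (hω : ω ^ 2 = t * ω - ν) {A : ℕ}
    (x : {x : ZMod A // x ^ 2 - t * x + ν = 0}) : R →+* ZMod A where
  toFun r := (h.basis.repr r 0 : ℤ) + (h.basis.repr r 1 : ℤ) * x.1
  map_one' := by
    obtain ⟨h1, h2⟩ := h.basis_repr (x := 1) (u := 1) (v := 0) (by simp)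
    simp [h1, h2]
  map_zero' := by simp
  map_add' r s := by
    simp only [map_add, Finsupp.add_apply]
    push_cast
    ring
  map_mul' r s := by
    obtain ⟨u, v, rfl⟩ := h.exists_eq r
    obtain ⟨u', v', rfl⟩ := h.exists_eq s
    rw [(h.basis_repr rfl).1, (h.basis_repr rfl).2, (h.basis_repr rfl).1, (h.basis_repr rfl).2]
    obtain ⟨h1, h2⟩ := h.basis_repr (x := (u + v * ω) * (u' + v' * ω)) (u := u * u' - v * v' * ν)
      (v := u * v' + u' * v + v * v' * t) (by push_cast; linear_combination v * v' * hω)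
    rw [h1, h2]
    push_cast
    linear_combination -(v * v') * x.2

theorem IsIntegralGenerator.rootHom_apply (h : IsIntegralGenerator ω) (hω : ω ^ 2 = t * ω - ν)
    {A : ℕ} (x : {x : ZMod A // x ^ 2 - t * x + ν = 0}) (u v : ℤ) :
    h.rootHom hω x (u + v * ω) = u + v * x.1 := by
  change ((h.basis.repr (u + v * ω) 0 : ℤ) : ZMod A) + (h.basis.repr (u + v * ω) 1 : ℤ) * x.1 = _
  rw [(h.basis_repr rfl).1, (h.basis_repr rfl).2]

/-- The ideal `e ⬝ ker (ω ↦ x)`. -/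
def IsIntegralGenerator.rootIdeal (h : IsIntegralGenerator ω) (hω : ω ^ 2 = t * ω - ν)
    (p : ℕ+ × (Σ A : ℕ+, {x : ZMod A // x ^ 2 - t * x + ν = 0})) : Ideal R :=
  Ideal.span {(p.1 : R)} * RingHom.ker (h.rootHom hω p.2.2)

theorem IsIntegralGenerator.mem_rootIdeal (h : IsIntegralGenerator ω) (hω : ω ^ 2 = t * ω - ν)
    (e A : ℕ+) (x : {x : ZMod A // x ^ 2 - t * x + ν = 0}) (r : R) :
    r ∈ h.rootIdeal hω ⟨e, A, x⟩ ↔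
      ∃ u v : ℤ, (e : R) * (u + v * ω) = r ∧ (u : ZMod A) + v * x.1 = 0 := by
  rw [IsIntegralGenerator.rootIdeal, Ideal.mem_span_singleton_mul]
  constructor
  · rintro ⟨z, hz, rfl⟩
    obtain ⟨u, v, rfl⟩ := h.exists_eq z
    rw [RingHom.mem_ker, h.rootHom_apply] at hz
    exact ⟨u, v, rfl, hz⟩
  · rintro ⟨u, v, rfl, hz⟩
    exact ⟨_, by rw [RingHom.mem_ker, h.rootHom_apply, hz], rfl⟩

theorem IsIntegralGenerator.rootIdeal_injective (h : IsIntegralGenerator ω)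
    (hω : ω ^ 2 = t * ω - ν) : Function.Injective (h.rootIdeal hω) := by
  have key : ∀ (e A : ℕ+) (x : {x : ZMod A // x ^ 2 - t * x + ν = 0}) (e' A' : ℕ+)
      (x' : {x : ZMod A' // x ^ 2 - t * x + ν = 0}),
      h.rootIdeal hω ⟨e, A, x⟩ ≤ h.rootIdeal hω ⟨e', A', x'⟩ → (e' : ℕ) ∣ e ∧
        (e' = e → (A' : ℕ) ∣ A ∧ ∀ y : ℤ, (y : ZMod A) = x.1 → (y : ZMod A') = x'.1) := by
    intro e A x e' A' x' hle
    have h1 : ∀ y : ℤ, (y : ZMod A) = x.1 → ∃ u v : ℤ, (e' : R) * (u + v * ω) = e * (-y + ω) ∧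
        (u : ZMod A') + v * x'.1 = 0 := fun y hy =>
      (h.mem_rootIdeal hω _ _ _ _).1 <| hle <| (h.mem_rootIdeal hω _ _ _ _).2
        ⟨-y, 1, by push_cast; ring, by push_cast; rw [hy]; ring⟩
    obtain ⟨y, hy⟩ := ZMod.intCast_surjective x.1
    refine ⟨?_, ?_⟩
    · obtain ⟨u, v, huv, -⟩ := h1 y hy
      have := (h.ext (u := e' * u) (v := e' * v) (u' := -(e * y)) (v' := e)
        (by push_cast; linear_combination huv)).2
      exact Int.natCast_dvd_natCast.1 ⟨v, this.symm⟩
    · rintro rfl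
      have he : ((e' : ℕ) : ℤ) ≠ 0 := by exact_mod_cast e'.ne_zero
      refine ⟨?_, fun y hy => ?_⟩
      · obtain ⟨u, v, huv, h0⟩ := (h.mem_rootIdeal hω _ _ _ _).1 <| hle <|
          (h.mem_rootIdeal hω e' A x (e' * A)).2 ⟨A, 0, by push_cast; ring, by simp⟩
        obtain ⟨h2, h3⟩ := h.ext (u := e' * u) (v := e' * v) (u' := e' * A) (v' := e' * 0)
          (by push_cast; linear_combination huv)
        rw [mul_left_cancel₀ he h2, mul_left_cancel₀ he h3] at h0
        rw [← ZMod.natCast_eq_zero_iff]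
        simpa using h0
      · obtain ⟨u, v, huv, h0⟩ := h1 y hy
        obtain ⟨h2, h3⟩ := h.ext (u := e' * u) (v := e' * v) (u' := e' * (-y)) (v' := e' * 1)
          (by push_cast; linear_combination huv)
        rw [mul_left_cancel₀ he h2, mul_left_cancel₀ he h3] at h0
        push_cast at h0
        linear_combination -h0
  rintro ⟨e, A, x⟩ ⟨e', A', x'⟩ heq
  have k1 := key _ _ _ _ _ _ heq.le
  have k2 := key _ _ _ _ _ _ heq.ge
  obtain rfl : e = e' := PNat.eq (Nat.dvd_antisymm k2.1 k1.1)
  obtain rfl : A = A' := PNat.eq (Nat.dvd_antisymm (k2.2 rfl).1 (k1.2 rfl).1)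
  obtain ⟨y, hy⟩ := ZMod.intCast_surjective x.1
  obtain rfl : x = x' := Subtype.ext (hy.symm.trans ((k1.2 rfl).2 y hy))
  rfl

end IdealCount

section IdealCount

variable {R : Type*} [CommRing R] [IsDedekindDomain R] [Module.Free ℤ R] [Module.Finite ℤ R]
  {ω : R} {t ν : ℤ}

theorem IsIntegralGenerator.card_quotient_rootIdeal (h : IsIntegralGenerator ω)
    (hω : ω ^ 2 = t * ω - ν) (p : ℕ+ × (Σ A : ℕ+, {x : ZMod A // x ^ 2 - t * x + ν = 0})) :
    Nat.card (R ⧸ h.rootIdeal hω p) = (p.1 : ℕ) ^ 2 * p.2.1 := by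
  have h1 : Ideal.absNorm (Ideal.span {((p.1 : ℕ) : R)}) = (p.1 : ℕ) ^ 2 := by
    rw [Ideal.absNorm_span_singleton, ← map_natCast (algebraMap ℤ R), Algebra.norm_algebraMap,
      Module.finrank_eq_card_basis h.basis, Fintype.card_fin, Int.natAbs_pow]
    simp
  have h2 : Ideal.absNorm (RingHom.ker (h.rootHom hω p.2.2)) = p.2.1 := by
    have hs : Function.Surjective (h.rootHom hω p.2.2) := fun y => by
      obtain ⟨u, rfl⟩ := ZMod.intCast_surjective y
      exact ⟨u, map_intCast _ _⟩
    rw [Ideal.absNorm_apply, Submodule.cardQuot_apply]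
    exact (Nat.card_congr (RingHom.quotientKerEquivOfSurjective hs).toEquiv).trans
      (Nat.card_zmod _)
  rw [← Submodule.cardQuot_apply, ← Ideal.absNorm_apply, IsIntegralGenerator.rootIdeal, map_mul,
    h1, h2]

theorem Ideal.exists_pnat_intCast_mem_iff {S : Type*} [CommRing S] [IsDedekindDomain S]
    [Module.Free ℤ S] [Module.Finite ℤ S] [CharZero S] {J : Ideal S} (hJ : J ≠ ⊥) :
    ∃ A : ℕ+, ∀ n : ℤ, (n : S) ∈ J ↔ (A : ℤ) ∣ n := by
  obtain ⟨a, ha⟩ : (J.comap (Int.castRingHom S)).IsPrincipal := inferInstance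
  have hmem : ∀ n : ℤ, (n : S) ∈ J ↔ a ∣ n := fun n => by
    rw [← Ideal.mem_span_singleton, ← Ideal.submodule_span_eq, ← ha, Ideal.mem_comap,
      eq_intCast]
  have ha0 : a ≠ 0 := by
    rintro rfl
    have h1 := (hmem (Ideal.absNorm J)).1 (by exact_mod_cast Ideal.absNorm_mem J)
    rw [zero_dvd_iff] at h1
    exact hJ (Ideal.absNorm_eq_zero_iff.1 (by exact_mod_cast h1))
  exact ⟨⟨a.natAbs, Int.natAbs_pos.2 ha0⟩, fun n => by rw [hmem]; simp⟩

theorem IsIntegralGenerator.exists_rootIdeal_eq [CharZero R] (h : IsIntegralGenerator ω)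
    (hω : ω ^ 2 = t * ω - ν) {I : Ideal R} (hI : I ≠ ⊥) : ∃ p, h.rootIdeal hω p = I := by
  -- the content of the ideal
  obtain ⟨e, he⟩ : ∃ e : ℕ+, (∃ u : ℤ, (u : R) + (e : ℤ) * ω ∈ I) ∧
      ∀ u v : ℤ, (u : R) + v * ω ∈ I → (e : ℤ) ∣ v := by
    let S : Ideal ℤ := (I.restrictScalars ℤ).map (h.basis.coord 1)
    obtain ⟨a, ha⟩ : S.IsPrincipal := inferInstance
    have hmem : ∀ n : ℤ, a ∣ n ↔ ∃ u : ℤ, (u : R) + n * ω ∈ I := fun n => by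
      rw [← Ideal.mem_span_singleton, ← Ideal.submodule_span_eq, ← ha, Submodule.mem_map]
      constructor
      · rintro ⟨r, hr, rfl⟩
        obtain ⟨u, v, rfl⟩ := h.exists_eq r
        refine ⟨u, ?_⟩
        rwa [Basis.coord_apply, (h.basis_repr rfl).2]
      · rintro ⟨u, hu⟩
        exact ⟨_, hu, by rw [Basis.coord_apply, (h.basis_repr rfl).2]⟩
    have ha0 : a ≠ 0 := by
      rintro rfl
      obtain ⟨A, hA⟩ := Ideal.exists_pnat_intCast_mem_iff hI
      have h1 : (0 : ℤ) ∣ A := (hmem _).2 ⟨0, by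
        simpa using I.mul_mem_right ω ((hA A).2 dvd_rfl)⟩
      rw [zero_dvd_iff] at h1
      exact A.ne_zero (by exact_mod_cast h1)
    refine ⟨⟨a.natAbs, Int.natAbs_pos.2 ha0⟩, (hmem _).1 (by simp), fun u v huv => ?_⟩
    simpa using (hmem v).2 ⟨u, huv⟩
  obtain ⟨⟨u₀, hu₀⟩, hdvd⟩ := he
  have hdvd' : ∀ u v : ℤ, (u : R) + v * ω ∈ I → (e : ℤ) ∣ u := by
    intro u v huv
    have h1 := hdvd (-v * ν) (u + v * t) (by
      have := I.mul_mem_left ω huv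
      convert! this using 1
      push_cast
      linear_combination -v * hω)
    exact (Int.dvd_add_left ((hdvd u v huv).mul_right t)).1 h1
  have he0 : (e : R) ≠ 0 := by exact_mod_cast e.ne_zero
  -- the primitive part
  let J : Ideal R := Submodule.comap (LinearMap.mulLeft R (e : R)) I
  have hJ : ∀ r : R, r ∈ J ↔ (e : R) * r ∈ I := fun r => Iff.rfl
  obtain ⟨u₁, rfl⟩ := hdvd' _ _ hu₀
  have hu₁ : (u₁ : R) + ω ∈ J := by
    rw [hJ]
    convert! hu₀ using 1
    push_cast
    ring
  have hJ0 : J ≠ ⊥ := by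
    intro h0
    rw [h0, Ideal.mem_bot] at hu₁
    exact one_ne_zero (h.eq_zero u₁ 1 (by simpa using hu₁)).2
  obtain ⟨A, hA⟩ := Ideal.exists_pnat_intCast_mem_iff hJ0
  have hroot : ((-u₁ : ℤ) : ZMod A) ^ 2 - t * (-u₁ : ℤ) + ν = 0 := by
    rw [intCast_root_iff, ← hA]
    convert! J.mul_mem_left (u₁ + t - ω) hu₁ using 1
    push_cast
    linear_combination hω
  have hJmem : ∀ u v : ℤ, (u : R) + v * ω ∈ J ↔ (u : ZMod A) + v * (-u₁ : ℤ) = 0 := by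
    intro u v
    have h1 : (u : R) + v * ω = (u - v * u₁ : ℤ) + v * (u₁ + ω) := by
      push_cast
      ring
    rw [h1, Ideal.add_mem_iff_left _ (J.mul_mem_left _ hu₁), hA,
      ← ZMod.intCast_zmod_eq_zero_iff_dvd]
    push_cast
    rw [mul_neg, sub_eq_add_neg]
  refine ⟨⟨e, A, _, hroot⟩, ?_⟩
  ext r
  rw [h.mem_rootIdeal]
  constructor
  · rintro ⟨u, v, rfl, huv⟩
    exact (hJ _).1 ((hJmem u v).2 huv)
  · intro hr
    obtain ⟨u, v, rfl⟩ := h.exists_eq r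
    obtain ⟨u', rfl⟩ := hdvd' _ _ hr
    obtain ⟨v', rfl⟩ := hdvd _ _ hr
    have h1 : (e : R) * (u' + v' * ω) = ((e : ℤ) * u' : ℤ) + ((e : ℤ) * v' : ℤ) * ω := by
      push_cast
      ring
    refine ⟨u', v', h1, (hJmem u' v').1 ?_⟩
    rw [hJ, h1]
    exact hr

end IdealCount

section EulerFactorization

open LSeries

theorem norm_kronFun_le (D : ℤ) (n : ℕ) : ‖((kronFun D : ArithmeticFunction ℂ) n)‖ ≤ 1 := by
  rw [ArithmeticFunction.intCoe_apply]
  simp only [kronFun, ArithmeticFunction.coe_mk]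
  split_ifs with h
  · simp
  · rw [Complex.norm_intCast]
    have h1 : |kron D n| ≤ 1 := by
      rw [kron, abs_mul, abs_pow]
      refine mul_le_one₀ (pow_le_one₀ (abs_nonneg _) ?_) (abs_nonneg _) ?_
      · split_ifs <;> simp
      · rcases jacobiSym.trichotomy D (n / 2 ^ n.factorization 2) with h | h | h <;> simp [h]
    exact_mod_cast h1

theorem lSeriesSummable_kronFun (D : ℤ) {s : ℂ} (hs : 1 < s.re) :
    LSeriesSummable (fun n => (kronFun D : ArithmeticFunction ℂ) n) s :=
  LSeriesSummable_of_bounded_of_one_lt_re (fun n _ => norm_kronFun_le D n) hs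

theorem lSeriesSummable_squareFun {s : ℂ} (hs : 1 < s.re) :
    LSeriesSummable (fun n => (squareFun : ArithmeticFunction ℂ) n) s := by
  refine LSeriesSummable_of_bounded_of_one_lt_re (m := 1) (fun n _ => ?_) hs
  rw [ArithmeticFunction.intCoe_apply]
  simp only [squareFun, ArithmeticFunction.coe_mk]
  split_ifs <;> simp

theorem LSeries_squareFun {s : ℂ} (hs : 1 < s.re) :
    LSeries (fun n => (squareFun : ArithmeticFunction ℂ) n) s = riemannZeta (2 * s) := by
  have hs2 : 1 < (2 * s).re := by simp; linarith
  rw [← LSeries_one_eq_riemannZeta hs2, LSeries, LSeries]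
  have hinj : Function.Injective fun n : ℕ => n ^ 2 := Nat.pow_left_injective (by norm_num)
  rw [← hinj.tsum_eq]
  · refine tsum_congr fun n => ?_
    rcases eq_or_ne n 0 with rfl | hn
    · simp
    · rw [term_of_ne_zero (pow_ne_zero 2 hn), term_of_ne_zero hn, ArithmeticFunction.intCoe_apply]
      simp only [squareFun, ArithmeticFunction.coe_mk, if_neg (pow_ne_zero 2 hn),
        if_pos (IsSquare.sq n), Int.cast_one, Pi.one_apply]
      rw [Nat.cast_pow, sq, Complex.natCast_mul_natCast_cpow, ← sq, mul_comm 2 s,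
        Complex.cpow_mul_ofNat]
  · intro n hn
    rw [Function.mem_support] at hn
    by_contra hcon
    apply hn
    rcases eq_or_ne n 0 with rfl | hn
    · simp
    · rw [term_of_ne_zero hn, ArithmeticFunction.intCoe_apply]
      have : ¬ IsSquare n := fun ⟨r, hr⟩ => hcon ⟨r, by simp [hr, sq]⟩
      simp [squareFun, this]

variable {t ν : ℤ}

theorem intCoe_polyCountFun_mul_squareFun (hD : IsFundDisc (t ^ 2 - 4 * ν)) (ht : t = 0 ∨ t = 1) :
    (polyCountFun t ν : ArithmeticFunction ℂ) * (squareFun : ArithmeticFunction ℂ) =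
      (kronFun (t ^ 2 - 4 * ν) : ArithmeticFunction ℂ) *
        ((ArithmeticFunction.zeta : ArithmeticFunction ℕ) : ArithmeticFunction ℂ) := by
  rw [← ArithmeticFunction.intCoe_mul, polyCountFun_mul_squareFun hD ht,
    ArithmeticFunction.intCoe_mul]
  rfl

theorem lSeriesSummable_natCoe_zeta {s : ℂ} (hs : 1 < s.re) : LSeriesSummable (fun n =>
    ((ArithmeticFunction.zeta : ArithmeticFunction ℕ) : ArithmeticFunction ℂ) n) s := by
  simpa only [ArithmeticFunction.natCoe_apply] using
    ArithmeticFunction.LSeriesSummable_zeta_iff.2 hs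

theorem lSeriesSummable_polyCountFun (hD : IsFundDisc (t ^ 2 - 4 * ν)) (ht : t = 0 ∨ t = 1)
    {s : ℂ} (hs : 1 < s.re) :
    LSeriesSummable (fun n => (polyCountFun t ν : ArithmeticFunction ℂ) n) s := by
  have h1 := ArithmeticFunction.LSeriesSummable_mul
    (lSeriesSummable_kronFun (t ^ 2 - 4 * ν) hs)
    (lSeriesSummable_natCoe_zeta hs)
  rw [← intCoe_polyCountFun_mul_squareFun hD ht] at h1
  refine Summable.of_norm_bounded h1.norm fun n => ?_
  refine norm_term_le s ?_
  rw [← ArithmeticFunction.intCoe_mul, ArithmeticFunction.intCoe_apply,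
    ArithmeticFunction.intCoe_apply, Complex.norm_intCast, Complex.norm_intCast]
  rcases eq_or_ne n 0 with rfl | hn
  · simp
  have h0 : ∀ m, 0 ≤ polyCountFun t ν m := fun m => by
    simp only [polyCountFun, ArithmeticFunction.coe_mk]
    split_ifs <;> positivity
  have h0' : ∀ m, 0 ≤ squareFun m := fun m => by
    simp only [squareFun, ArithmeticFunction.coe_mk]
    split_ifs <;> positivity
  have h2 : polyCountFun t ν n ≤ (polyCountFun t ν * squareFun) n := by
    rw [ArithmeticFunction.mul_apply]
    refine le_trans (le_of_eq ?_) (Finset.single_le_sum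
      (fun x _ => mul_nonneg (h0 _) (h0' _)) 
      (show (n, 1) ∈ n.divisorsAntidiagonal from
        Nat.mem_divisorsAntidiagonal.2 ⟨mul_one n, hn⟩))
    simp [squareFun]
  have h3 : |polyCountFun t ν n| ≤ |(polyCountFun t ν * squareFun) n| := by
    rw [abs_of_nonneg (h0 n)]
    exact h2.trans (le_abs_self _)
  exact_mod_cast h3

theorem LSeries_polyCountFun_mul (hD : IsFundDisc (t ^ 2 - 4 * ν)) (ht : t = 0 ∨ t = 1)
    {s : ℂ} (hs : 1 < s.re) :
    LSeries (fun n => (polyCountFun t ν : ArithmeticFunction ℂ) n) s * riemannZeta (2 * s) =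
      riemannZeta s * LSeries (fun n => (kronFun (t ^ 2 - 4 * ν) : ArithmeticFunction ℂ) n) s := by
  rw [← LSeries_squareFun hs, ← ArithmeticFunction.LSeries_mul'
    (lSeriesSummable_polyCountFun hD ht hs) (lSeriesSummable_squareFun hs),
    intCoe_polyCountFun_mul_squareFun hD ht, ArithmeticFunction.LSeries_mul'
    (lSeriesSummable_kronFun _ hs) (lSeriesSummable_natCoe_zeta hs),
    ← ArithmeticFunction.LSeries_zeta_eq_riemannZeta hs, mul_comm]
  simp only [ArithmeticFunction.natCoe_apply]

end EulerFactorization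

section IdealSum

open LSeries

variable {R : Type*} [CommRing R] [IsDedekindDomain R] [Module.Free ℤ R] [Module.Finite ℤ R]
  {ω : R} {t ν : ℤ}

theorem tsum_pnat_term (f : ℕ → ℂ) (s : ℂ) : ∑' n : ℕ+, term f s n = LSeries f s := by
  refine PNat.coe_injective.tsum_eq fun n hn => ?_
  rcases Nat.eq_zero_or_pos n with rfl | h
  · simp at hn
  · exact ⟨⟨n, h⟩, rfl⟩

theorem IsIntegralGenerator.rootIdeal_ne_bot [CharZero R] (h : IsIntegralGenerator ω)
    (hω : ω ^ 2 = t * ω - ν) (p) : h.rootIdeal hω p ≠ ⊥ := by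
  intro h0
  have h1 := h.card_quotient_rootIdeal hω p
  rw [← Submodule.cardQuot_apply, ← Ideal.absNorm_apply, h0, Ideal.absNorm_bot] at h1
  have h2 : 0 < (p.1 : ℕ) ^ 2 * p.2.1 := by positivity
  omega

theorem tsum_card_quotient_cpow [CharZero R] (h : IsIntegralGenerator ω)
    (hω : ω ^ 2 = t * ω - ν) (hD : IsFundDisc (t ^ 2 - 4 * ν)) (ht : t = 0 ∨ t = 1)
    {s : ℂ} (hs : 1 < s.re) :
    ∑' I : {I : Ideal R // I ≠ ⊥}, (Nat.card (R ⧸ (I : Ideal R)) : ℂ) ^ (-s) =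
      riemannZeta s * LSeries (fun n => (kronFun (t ^ 2 - 4 * ν) : ArithmeticFunction ℂ) n) s := by
  have hs2 : 1 < (2 * s).re := by simp; linarith
  let e : (ℕ+ × (Σ A : ℕ+, {x : ZMod A // x ^ 2 - t * x + ν = 0})) ≃ {I : Ideal R // I ≠ ⊥} :=
    Equiv.ofBijective (fun p => ⟨h.rootIdeal hω p, h.rootIdeal_ne_bot hω p⟩)
      ⟨fun p q hpq => h.rootIdeal_injective hω (congrArg Subtype.val hpq),
        fun I => (h.exists_rootIdeal_eq hω I.2).imp fun p hp => Subtype.ext hp⟩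
  have he : ∀ p, (Nat.card (R ⧸ (e p : Ideal R)) : ℂ) ^ (-s) =
      (p.1 : ℂ) ^ (-(2 * s)) * (p.2.1 : ℂ) ^ (-s) := fun p => by
    change (Nat.card (R ⧸ h.rootIdeal hω p) : ℂ) ^ (-s) = _
    rw [h.card_quotient_rootIdeal hω p, Nat.cast_mul, Complex.natCast_mul_natCast_cpow,
      Nat.cast_pow, sq, Complex.natCast_mul_natCast_cpow, ← sq, ← mul_neg, mul_comm 2 (-s),
      Complex.cpow_mul_ofNat]
  have hf : ∀ n : ℕ+, (n : ℂ) ^ (-(2 * s)) = term 1 (2 * s) n := fun n => by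
    rw [term_of_ne_zero n.ne_zero, Pi.one_apply, Complex.cpow_neg, one_div]
  have hfs : Summable fun n : ℕ+ => ‖(n : ℂ) ^ (-(2 * s))‖ := by
    simp_rw [hf]
    exact (LSeriesSummable_one_iff.2 hs2).norm.comp_injective PNat.coe_injective
  have hg : ∀ A : ℕ+, (Nat.card {x : ZMod A // x ^ 2 - t * x + ν = 0} : ℂ) * (A : ℂ) ^ (-s) =
      term (fun n => (polyCountFun t ν : ArithmeticFunction ℂ) n) s A := fun A => by
    rw [term_of_ne_zero A.ne_zero, ArithmeticFunction.intCoe_apply, Complex.cpow_neg, div_eq_mul_inv]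
    simp [polyCountFun, polyCount]
  have hfin : ∀ A : ℕ+, Finite {x : ZMod A // x ^ 2 - t * x + ν = 0} := fun A => inferInstance
  have hgs : Summable fun q : (Σ A : ℕ+, {x : ZMod A // x ^ 2 - t * x + ν = 0}) =>
      ‖(q.1 : ℂ) ^ (-s)‖ := by
    rw [summable_sigma_of_nonneg fun _ => norm_nonneg _]
    refine ⟨fun A => Summable.of_finite, ?_⟩
    refine ((lSeriesSummable_polyCountFun hD ht hs).norm.comp_injective
      PNat.coe_injective).congr fun A => ?_
    rw [Function.comp_apply, ← hg]
    dsimp only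
    rw [tsum_const, norm_mul, nsmul_eq_mul, Complex.norm_natCast]
  rw [← e.tsum_eq, tsum_congr he, ← tsum_mul_tsum_of_summable_norm
    (f := fun n : ℕ+ => (n : ℂ) ^ (-(2 * s)))
    (g := fun q : (Σ A : ℕ+, {x : ZMod A // x ^ 2 - t * x + ν = 0}) => (q.1 : ℂ) ^ (-s)) hfs hgs,
    tsum_congr hf, tsum_pnat_term, LSeries_one_eq_riemannZeta hs2, hgs.of_norm.tsum_sigma,
    ← LSeries_polyCountFun_mul hD ht hs, mul_comm, ← tsum_pnat_term]
  congr 1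
  refine tsum_congr fun A => ?_
  rw [← hg]
  dsimp only
  rw [tsum_const, nsmul_eq_mul]

end IdealSum

section FunctionalEquation

open LSeries Real

open scoped ZMod Nat

theorem IsFourierSelfDual.dft_eq {N : ℕ} [NeZero N] {f : ℤ → ℤ} {s : ℂ}
    (h : IsFourierSelfDual N f s) {Φ : ZMod N → ℂ} (hΦ : ∀ m : ℤ, Φ m = f m) (k : ZMod N) :
    𝓕 Φ k = s * Φ (-k) := by
  obtain ⟨m, hm⟩ := ZMod.intCast_surjective (-k)
  obtain rfl : k = -(m : ZMod N) := by rw [hm, neg_neg]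
  rw [neg_neg, hΦ, ← h.dual, ZMod.dft_apply, ← sum_range_natCast_zmod]
  refine Finset.sum_congr rfl fun x _ => ?_
  have h1 := ZMod.stdAddChar_coe (N := N) (x * m)
  have h2 := hΦ x
  push_cast at h1 h2 ⊢
  rw [mul_neg, neg_neg, h1, h2, smul_eq_mul, mul_comm]
  congr 2
  ring

theorem IsFourierSelfDual.even {N : ℕ} [NeZero N] {f : ℤ → ℤ} {s : ℂ}
    (h : IsFourierSelfDual N f s) {Φ : ZMod N → ℂ} (hΦ : ∀ m : ℤ, Φ m = f m) (hs : s ^ 2 = N)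
    (k : ZMod N) : Φ (-k) = Φ k := by
  have hN : (N : ℂ) ≠ 0 := Nat.cast_ne_zero.2 (NeZero.ne N)
  have h1 : 𝓕 Φ = s • fun k => Φ (-k) := by
    ext k
    rw [h.dft_eq hΦ]
    rfl
  have h2 := congrFun (ZMod.dft_dft Φ) k
  have h3 := congrFun (congrArg ZMod.dft h1) k
  rw [h2, ZMod.dft_const_smul, ZMod.dft_comp_neg, Pi.smul_apply, h.dft_eq hΦ, neg_neg, smul_eq_mul,
    smul_eq_mul, ← mul_assoc, ← sq, hs] at h3
  exact mul_left_cancel₀ hN h3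

theorem exp_add_exp_neg_eq_cos (z : ℂ) :
    Complex.exp (π * Complex.I * z / 2) + Complex.exp (-π * Complex.I * z / 2) =
      2 * Complex.cos (π * z / 2) := by
  rw [Complex.two_cos]
  congr 2 <;> ring

theorem LFunction_one_sub_of_isFourierSelfDual {N : ℕ} [NeZero N] {f : ℤ → ℤ} {r : ℂ}
    (h : IsFourierSelfDual N f r) {Φ : ZMod N → ℂ} (hΦ : ∀ m : ℤ, Φ m = f m) (hr : r ^ 2 = N)
    {s : ℂ} (hs : 1 < s.re) :
    ZMod.LFunction Φ (1 - s) = N ^ (s - 1) * (2 * π) ^ (-s) * Complex.Gamma s *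
      (2 * Complex.cos (π * s / 2)) * (r * ZMod.LFunction Φ s) := by
  have hev : (fun x => Φ (-x)) = Φ := funext (h.even hΦ hr)
  have h𝓕 : 𝓕 Φ = r • Φ := by
    ext k
    rw [h.dft_eq hΦ, h.even hΦ hr]
    rfl
  have hL : ZMod.LFunction (r • Φ) s = r * ZMod.LFunction Φ s := by
    simp only [ZMod.LFunction, Pi.smul_apply, smul_eq_mul, Finset.mul_sum]
    exact Finset.sum_congr rfl fun x _ => by ring
  rw [ZMod.LFunction_one_sub Φ (fun n hn => ?hs) (Or.inr ?_), hev, h𝓕, hL,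
    ← exp_add_exp_neg_eq_cos]
  · ring
  · rintro rfl
    simp at hs
  · rw [hn, Complex.neg_re, Complex.natCast_re] at hs
    linarith [n.cast_nonneg (α := ℝ)]

theorem exists_LFunction_kron {D : ℤ} (hD : IsFundDisc D) (h0 : 0 < D) :
    ∃ L : ℂ → ℂ, (∀ s ≠ 1, DifferentiableAt ℂ L s) ∧
      (∀ s : ℂ, 1 < s.re → L s = LSeries (fun n => (kronFun D : ArithmeticFunction ℂ) n) s) ∧
      ∀ k : ℕ, 1 ≤ k → riemannZeta (1 - 2 * k) * L (1 - 2 * k) =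
        4 * (D : ℂ) ^ (2 * k - 1) * (√(D : ℝ) : ℝ) * ((2 * k - 1)! : ℂ) ^ 2 / (2 * π) ^ (4 * k) *
          (riemannZeta (2 * k) * L (2 * k)) := by
  obtain ⟨f, hf, hfk⟩ := isFourierSelfDual_kron hD h0
  obtain ⟨N, rfl⟩ := Int.eq_ofNat_of_zero_le h0.le
  rw [Int.toNat_natCast] at hf
  have : NeZero N := ⟨by rintro rfl; simp at h0⟩
  let Φ : ZMod N → ℂ := fun x => f x.val
  have hΦ : ∀ m : ℤ, Φ m = f m := fun m => by
    simp only [Φ]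
    rw [map_eq_of_periodic hf.periodic (a := ((m : ZMod N).val : ℤ)) (b := m)]
    rw [← ZMod.intCast_eq_intCast_iff_dvd_sub]
    simp
  have hr : ((√((N : ℤ) : ℝ) : ℝ) : ℂ) ^ 2 = N := by
    rw [← Complex.ofReal_pow, Real.sq_sqrt (by positivity)]
    simp
  refine ⟨ZMod.LFunction Φ, fun s hs => ZMod.differentiableAt_LFunction Φ s (Or.inl hs),
    fun s hs => ?_, fun k hk => ?_⟩
  · rw [ZMod.LFunction_eq_LSeries Φ hs]
    refine LSeries_congr (fun {n} hn => ?_) s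
    rw [← Int.cast_natCast, hΦ, hfk n hn, ArithmeticFunction.intCoe_apply]
    simp [kronFun, hn]
  · have hre : 1 < (2 * k : ℂ).re := by
      have : (1 : ℝ) ≤ k := by exact_mod_cast hk
      simp
      linarith
    have hcos : Complex.cos (π * (2 * k) / 2) ^ 2 = 1 := by
      have : Complex.sin (π * (2 * k) / 2) = 0 := by
        rw [show (π * (2 * k) / 2 : ℂ) = k * π by ring, Complex.sin_nat_mul_pi]
      have h2 := Complex.sin_sq_add_cos_sq (π * (2 * k) / 2)
      rwa [this, zero_pow two_ne_zero, zero_add] at h2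
    have hΓ : Complex.Gamma (2 * k) = ((2 * k - 1)! : ℂ) := by
      rw [← Complex.Gamma_nat_eq_factorial]
      congr 1
      rw [Nat.cast_sub (by omega)]
      push_cast
      ring
    have hpow : (N : ℂ) ^ (2 * k - 1 : ℂ) = (N : ℂ) ^ (2 * k - 1) := by
      rw [← Complex.cpow_natCast, Nat.cast_sub (by omega)]
      push_cast
      rfl
    have hpi : ((2 * π : ℂ)) ^ (-(2 * k) : ℂ) = ((2 * π : ℂ) ^ (2 * k))⁻¹ := by
      rw [Complex.cpow_neg, ← Complex.cpow_natCast]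
      push_cast
      rfl
    rw [LFunction_one_sub_of_isFourierSelfDual hf hΦ hr hre, riemannZeta_one_sub, hΓ, hpow, hpi,
      Int.cast_natCast, show 4 * k = 2 * k + 2 * k by ring, pow_add (2 * π : ℂ)]
    · generalize Complex.cos (π * (2 * k) / 2) = c at hcos ⊢
      generalize (2 * π : ℂ) ^ (2 * k) = P
      linear_combination (4 * (N : ℂ) ^ (2 * k - 1) * (√N : ℝ) * ((2 * k - 1)! : ℂ) ^ 2 * P⁻¹ ^ 2 *
        riemannZeta (2 * k) * ZMod.LFunction Φ (2 * k)) * hcos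
    · intro n hn
      rw [hn, Complex.neg_re, Complex.natCast_re] at hre
      linarith [n.cast_nonneg (α := ℝ)]
    · intro h1
      rw [h1] at hre
      simp at hre

end FunctionalEquation

section ZagierFormula

open LSeries Real NumberField

open scoped Nat

theorem integral_qsum_eq {t ν : ℤ} (hD : IsFundDisc (t ^ 2 - 4 * ν))
    (h0 : 0 < t ^ 2 - 4 * ν) {k : ℕ} (hk : 1 ≤ k) :
    ((∫ x in (0 : ℝ)..1, qsum (t ^ 2 - 4 * ν) (2 * k - 1) x : ℝ) : ℂ) =
      ((t ^ 2 - 4 * ν : ℤ) : ℂ) ^ (2 * k - 1) * (√((t ^ 2 - 4 * ν : ℤ) : ℝ) : ℝ) *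
        ((2 * k - 1)! : ℂ) ^ 2 / ((4 * k - 1)! : ℂ) *
        LSeries (fun n => (polyCountFun t ν : ArithmeticFunction ℂ) n) (2 * k) := by
  have hs := hasSum_rootCount h0 hD.2.1 (p := 2 * k - 1) (by omega)
  have h1 := (Complex.hasSum_ofReal.2 hs).tsum_eq
  rw [← h1, LSeries, ← tsum_mul_left]
  refine tsum_congr fun A => ?_
  have h4 : 2 * (2 * k - 1) + 1 = 4 * k - 1 := by omega
  have h2 : 2 * k - 1 + 1 = 2 * k := by omega
  rw [h4, h2]
  rcases eq_or_ne A 0 with rfl | hA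
  · simp [show k ≠ 0 by omega]
  · rw [term_of_ne_zero hA, ArithmeticFunction.intCoe_apply, rootCount_eq_polyCount t ν hA,
      show (2 * k : ℂ) = ((2 * k : ℕ) : ℂ) by push_cast; rfl, Complex.cpow_natCast]
    simp [polyCountFun, hA]

theorem eq_riemannZeta_mul_of_isDedekindZeta {Z L : ℂ → ℂ} {c : ℂ → ℂ}
    (hZ : ∀ s ≠ 1, DifferentiableAt ℂ Z s) (hL : ∀ s ≠ 1, DifferentiableAt ℂ L s)
    (hZc : ∀ s : ℂ, 1 < s.re → Z s = c s) (hLc : ∀ s : ℂ, 1 < s.re → riemannZeta s * L s = c s)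
    {s : ℂ} (hs : s ≠ 1) : Z s = riemannZeta s * L s := by
  have hopen : IsOpen ({1}ᶜ : Set ℂ) := isOpen_compl_singleton
  have h1 : AnalyticOnNhd ℂ Z {1}ᶜ :=
    DifferentiableOn.analyticOnNhd (fun s hs => (hZ s hs).differentiableWithinAt) hopen
  have h2 : AnalyticOnNhd ℂ (fun s => riemannZeta s * L s) {1}ᶜ :=
    DifferentiableOn.analyticOnNhd (fun s hs =>
      ((differentiableAt_riemannZeta hs).mul (hL s hs)).differentiableWithinAt) hopen
  refine h1.eqOn_of_preconnected_of_eventuallyEq h2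
    (isConnected_compl_singleton_of_one_lt_rank (by simp) 1).isPreconnected
    (z₀ := 2) (by simp) ?_ hs
  have : ∀ᶠ z : ℂ in nhds 2, 1 < z.re :=
    (isOpen_lt continuous_const Complex.continuous_re).mem_nhds (by simp)
  filter_upwards [this] with z hz
  rw [hZc z hz, hLc z hz]

end ZagierFormula

theorem zagier_formula
    (K : Type*) [Field K] [NumberField K] (hreal : IsTotallyReal K)
    (hdeg : finrank ℚ K = 2)
    (D : ℤ) (hD : D = NumberField.discr K)
    (k : ℕ) (hk : 1 ≤ k)
    (Z : ℂ → ℂ) (hZ : IsDedekindZeta K Z) :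
    Z (1 - 2 * (k : ℂ)) = 4 *
      ∑ j ∈ Finset.Icc 1 (k / 3 + 1),
        (bSiegel j (4 * k) : ℂ) *
          ∑ m ∈ j.divisors,
            (kron D m : ℂ) * (m : ℂ) ^ (2 * k - 1) *
              (eSum (2 * k - 1) (((j / m : ℕ) : ℤ) ^ 2 * D) : ℂ) := by
  obtain ⟨ω, t, ν, hω, ht, hω2, hd, hf, h0⟩ := exists_generator_of_real_quadratic hreal hdeg
  subst hD
  have hS := sum_bSiegel_eq hf hk
  obtain ⟨L, hL, hLs, hLfe⟩ := exists_LFunction_kron hf h0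
  have hk0 : (k : ℂ) ≠ 0 := Nat.cast_ne_zero.2 (by omega)
  have hre : 1 < (2 * k : ℂ).re := by
    have : (1 : ℝ) ≤ k := by exact_mod_cast hk
    simp
    linarith
  have hne : (1 - 2 * k : ℂ) ≠ 1 := by simpa using hk0
  rw [eq_riemannZeta_mul_of_isDedekindZeta hZ.1 hL hZ.2 (fun s hs => ?_) hne, hLfe k hk]
  · generalize ∑ j ∈ Finset.Icc 1 (k / 3 + 1), (bSiegel j (4 * k) : ℂ) * _ = S at hS ⊢
    have h_int : (∫ x in (0 : ℝ)..1, (qsum (NumberField.discr K) (2 * k - 1) x : ℂ)) =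
      ((∫ x in (0 : ℝ)..1, qsum (NumberField.discr K) (2 * k - 1) x : ℝ) : ℂ) :=
      intervalIntegral.integral_ofReal
    rw [hd] at hf h0 hLs
    rw [h_int, hd, integral_qsum_eq hf h0 hk] at hS
    rw [hd]
    have hL2 := LSeries_polyCountFun_mul hf ht hre
    rw [← hLs _ hre] at hL2
    have hζ := riemannZeta_two_mul_nat (k := 2 * k) (by omega)
    rw [show 2 * (2 * k) = 4 * k by ring, Odd.neg_one_pow ⟨k, rfl⟩] at hζ
    push_cast at hζ
    have hfac : ((4 * k).factorial : ℂ) = 4 * k * ((4 * k - 1).factorial : ℂ) := by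
      rw [← Nat.mul_factorial_pred (show 4 * k ≠ 0 by omega)]
      push_cast
      rfl
    have h2pow : (2 * Real.pi : ℂ) ^ (4 * k) = 2 * 2 ^ (4 * k - 1) * (Real.pi : ℂ) ^ (4 * k) := by
      rw [mul_pow, ← pow_succ', Nat.sub_add_cancel (by omega)]
    have hF : ((4 * k - 1).factorial : ℂ) ≠ 0 := Nat.cast_ne_zero.2 (Nat.factorial_ne_zero _)
    have hT : (2 : ℂ) ^ (4 * k - 1) ≠ 0 := pow_ne_zero _ two_ne_zero
    have hP : (Real.pi : ℂ) ^ (4 * k) ≠ 0 :=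
      pow_ne_zero _ (Complex.ofReal_ne_zero.2 Real.pi_ne_zero)
    rw [← hL2, hζ, hfac, h2pow]
    generalize ((4 * k - 1).factorial : ℂ) = F at *
    generalize (2 : ℂ) ^ (4 * k - 1) = T at *
    generalize (Real.pi : ℂ) ^ (4 * k) = P at *
    generalize LSeries _ _ = l at *
    generalize (((t ^ 2 - 4 * ν : ℤ) : ℂ) ^ (2 * k - 1)) = d at *
    field_simp at hS ⊢
    linear_combination -hS
  · rw [hLs s hs, hd, ← tsum_card_quotient_cpow hω hω2 (hd ▸ hf) ht hs]
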